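/- Let (R, m) be a Noetherian local ring whose completion R̂ satisfies Serre's condition S_2, and let x be a non-zerodivisor of R. Then ω_{R̂}/x·ω_{R̂} is isomorphic to the canonical module ω_{R̂/xR̂} of R̂/xR̂ if and only if ω_{R̂}/x·ω_{R̂} satisfies Serre's condition S_2. -/

import Mathlib

open CategoryTheory IsLocalRing Pointwise

noncomputable section

/-- `E` is an injective hull of `S ⧸ J` over `S`. -/
def IsInjHull (S : Type) [CommRing S] (J : Ideal S) (E : Type) [AddCommGroup E]
    [Module S E] : Prop :=
  Module.Injective S E ∧
    ∃ f : (S ⧸ J) →ₗ[S] E, Function.Injective f ∧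
      ∀ N : Submodule S E, N ≠ ⊥ → N ⊓ LinearMap.range f ≠ ⊥

/-- Local cohomology `H^i_J(M)`. -/
abbrev LC (S : Type) [CommRing S] (J : Ideal S) (i : ℕ) (M : ModuleCat S) : ModuleCat S :=
  (localCohomology J i).obj M

/-- Krull dimension of a module (dimension of its support). -/
def mdim (S : Type) [CommRing S] (M : Type) [AddCommGroup M] [Module S M] : WithBot ℕ∞ :=
  Order.krullDim (Module.support S M)

/-- Depth/grade of an ideal `J` on `M`: supremum of lengths of `M`-regular sequences in `J`. -/
def gradeI (S : Type) [CommRing S] (J : Ideal S) (M : Type) [AddCommGroup M]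
    [Module S M] : ℕ∞ :=
  sSup {n : ℕ∞ | ∃ rs : List S, (rs.length : ℕ∞) = n ∧ (∀ r ∈ rs, r ∈ J) ∧
    RingTheory.Sequence.IsRegular M rs}

/-- The local "height" of `M` at a prime `p`, i.e. `dim_{S_p} M_p`. -/
def htM (S : Type) [CommRing S] (M : Type) [AddCommGroup M] [Module S M]
    (p : PrimeSpectrum S) : WithBot ℕ∞ :=
  mdim (Localization.AtPrime p.asIdeal) (LocalizedModule p.asIdeal.primeCompl M)

/-- `ht_M(a) = inf { dim_{S_p} M_p : p ⊇ a, p ∈ Supp M }`. -/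
def htI (S : Type) [CommRing S] (M : Type) [AddCommGroup M] [Module S M]
    (a : Ideal S) : WithBot ℕ∞ :=
  sInf {d | ∃ p ∈ Module.support S M, a ≤ p.asIdeal ∧ d = htM S M p}

/-- Serre's condition `S_n` for the module `M`. -/
def Serre (S : Type) [CommRing S] (n : ℕ) (M : Type) [AddCommGroup M] [Module S M] : Prop :=
  ∀ (p : Ideal S) [p.IsPrime],
    min (n : WithBot ℕ∞)
        (mdim (Localization.AtPrime p) (LocalizedModule p.primeCompl M)) ≤
      (gradeI (Localization.AtPrime p) (IsLocalRing.maximalIdeal (Localization.AtPrime p))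
        (LocalizedModule p.primeCompl M) : ℕ∞)

/-- Attached primes of `M` (Macdonald): primes of the form `Ann(M ⧸ N)`. -/
def attachedPrimes (S : Type) [CommRing S] (M : Type) [AddCommGroup M] [Module S M] :
    Set (Ideal S) :=
  {p | p.IsPrime ∧ ∃ N : Submodule S M, p = Module.annihilator S (M ⧸ N)}

/-- `ω` is a canonical module of the `d`-dimensional module `M` over `(S, J)`:
its "Matlis dual" `Hom_S(ω, E)` is isomorphic to `H^d_J(M)`. -/
def IsCanonicalModule (S : Type) [CommRing S] (J : Ideal S) (d : ℕ)
    (M ω : ModuleCat S) : Prop :=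
  Module.Finite S ω ∧ ∃ E : ModuleCat S, IsInjHull S J ↥E ∧
    Nonempty ((↥ω →ₗ[S] ↥E) ≃ₗ[S] ↥(LC S J d M))

/-- `(S, J)` is quasi-Gorenstein: `H^d_J(S)` is an injective hull of `S ⧸ J`, `d = dim S`. -/
def IsQuasiGorensteinAt (S : Type) [CommRing S] (J : Ideal S) : Prop :=
  ∃ d : ℕ, ringKrullDim S = (d : WithBot ℕ∞) ∧
    ∃ E : ModuleCat S, IsInjHull S J ↥E ∧
      Nonempty (↥(LC S J d (ModuleCat.of S S)) ≃ₗ[S] ↥E)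

/-- Totally reflexive modules. -/
def TotallyReflexive (S : Type) [CommRing S] (M : ModuleCat S) : Prop :=
  Module.Finite S ↥M ∧ Module.IsReflexive S ↥M ∧
    ∀ i : ℕ, 0 < i →
      Subsingleton ↥(((Ext S (ModuleCat S) i).obj (Opposite.op M)).obj (ModuleCat.of S S)) ∧
      Subsingleton ↥(((Ext S (ModuleCat S) i).obj
        (Opposite.op (ModuleCat.of S (Module.Dual S ↥M)))).obj (ModuleCat.of S S))

/-- `G`-dimension at most `n`. -/
def GdimLE (S : Type) [CommRing S] : ℕ → ModuleCat S → Prop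
  | 0, M => TotallyReflexive S M
  | n + 1, M => ∃ (G : ModuleCat S) (f : ↥G →ₗ[S] ↥M), Function.Surjective f ∧
      TotallyReflexive S G ∧ GdimLE S n (ModuleCat.of S (LinearMap.ker f))

/-- Injective dimension at most `n`. -/
def InjDimLE (S : Type) [CommRing S] : ℕ → ModuleCat S → Prop
  | 0, M => Module.Injective S ↥M
  | n + 1, M => ∃ (E : ModuleCat S) (f : ↥M →ₗ[S] ↥E), Function.Injective f ∧
      Module.Injective S ↥E ∧ InjDimLE S n (ModuleCat.of S (↥E ⧸ LinearMap.range f))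

/-- Injective dimension, as an element of `ℕ∞`. -/
def injDim (S : Type) [CommRing S] (M : ModuleCat S) : ℕ∞ :=
  sInf {n : ℕ∞ | ∃ k : ℕ, (k : ℕ∞) = n ∧ InjDimLE S k M}

/-- Minimal number of generators. -/
def genNumber (S : Type) [CommRing S] (M : Type) [AddCommGroup M] [Module S M] : ℕ∞ :=
  sInf {n : ℕ∞ | ∃ s : Finset M, (s.card : ℕ∞) = n ∧ Submodule.span S (↑s : Set M) = ⊤}

/-- The socle `0 :_M J`. -/
def socle (S : Type) [CommRing S] (J : Ideal S) (M : Type) [AddCommGroup M] [Module S M] :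
    Submodule S M :=
  ⨅ r ∈ J, LinearMap.ker (LinearMap.lsmul S M r)

/-- Limit closure of the sequence `x` on `M`. -/
def limClo (S : Type) [CommRing S] {v : ℕ} (x : Fin v → S) (M : Type) [AddCommGroup M]
    [Module S M] : Submodule S M :=
  ⨆ t : ℕ, (Ideal.span (Set.range fun i => x i ^ (t + 1)) • (⊤ : Submodule S M)).comap
      (LinearMap.lsmul S M ((∏ i, x i) ^ t))

end

/-- Krull dimension of a ring, valued in `WithBot ℕ∞`. -/
noncomputable def rdim (S : Type) [CommRing S] : WithBot ℕ∞ :=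
  Order.krullDim (PrimeSpectrum S)
/-- The maximal-adic completion of a local ring. -/
abbrev Cmpl (R : Type) [CommRing R] [IsLocalRing R] : Type :=
  AdicCompletion (IsLocalRing.maximalIdeal R) R


noncomputable section

namespace SeqLim

variable {S : Type} [CommRing S]
variable {X : ℕ → Type} [∀ t, AddCommGroup (X t)] [∀ t, Module S (X t)]

/-- Iterated transition maps of a sequence of modules. -/
def tr (f : ∀ t, X t →ₗ[S] X (t + 1)) (i j : ℕ) (h : i ≤ j) : X i →ₗ[S] X j :=
  Nat.leRecOn (C := fun j => X i →ₗ[S] X j) h (fun {k} g => (f k).comp g) LinearMap.id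

/-- The direct limit of a sequence of modules. -/
def Lim (f : ∀ t, X t →ₗ[S] X (t + 1)) : Type :=
  Module.DirectLimit X (tr f)

instance (f : ∀ t, X t →ₗ[S] X (t + 1)) : AddCommGroup (Lim f) :=
  inferInstanceAs (AddCommGroup (Module.DirectLimit X (tr f)))

instance (f : ∀ t, X t →ₗ[S] X (t + 1)) : Module S (Lim f) :=
  inferInstanceAs (Module S (Module.DirectLimit X (tr f)))

variable (f : ∀ t, X t →ₗ[S] X (t + 1))

theorem tr_self (i : ℕ) : tr f i i le_rfl = LinearMap.id := Nat.leRecOn_self _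

theorem tr_succ (i j : ℕ) (h : i ≤ j) : tr f i (j + 1) (h.trans j.le_succ) = f j ∘ₗ tr f i j h :=
  Nat.leRecOn_succ h _

theorem tr_trans (i j k : ℕ) (h : i ≤ j) (h' : j ≤ k) :
    tr f i k (h.trans h') = tr f j k h' ∘ₗ tr f i j h := by
  induction k, h' using Nat.le_induction with
  | base => rw [tr_self]; rfl
  | succ k hk ih => rw [tr_succ f j k hk, tr_succ f i k (h.trans hk), ih]; rfl

instance : DirectedSystem X fun i j h => tr f i j h where
  map_self i x := by rw [tr_self]; rfl
  map_map i j k hij hjk x := by rw [tr_trans f k j i hij hjk]; rfl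

/-- The canonical map from a term to the limit. -/
def of (t : ℕ) : X t →ₗ[S] Lim f :=
  Module.DirectLimit.of S ℕ X (tr f) t

theorem of_tr (i j : ℕ) (h : i ≤ j) (x : X i) : of f j (tr f i j h x) = of f i x :=
  Module.DirectLimit.of_f

theorem exists_of (z : Lim f) : ∃ t x, of f t x = z := Module.DirectLimit.exists_of z

theorem exists_of_ge (z : Lim f) (s : ℕ) : ∃ t, s ≤ t ∧ ∃ x, of f t x = z := by
  obtain ⟨t, x, rfl⟩ := exists_of f z
  exact ⟨max s t, le_max_left _ _, tr f t _ (le_max_right _ _) x, of_tr f _ _ _ _⟩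

theorem exists_tr_eq_zero {t : ℕ} {x : X t} (h : of f t x = 0) : ∃ s, ∃ hs : t ≤ s, tr f t s hs x = 0 :=
  Module.DirectLimit.of.zero_exact h

variable {f}
variable {Y : ℕ → Type} [∀ t, AddCommGroup (Y t)] [∀ t, Module S (Y t)]
  {g : ∀ t, Y t →ₗ[S] Y (t + 1)}

theorem tr_comm (u : ∀ t, X t →ₗ[S] Y t) (hu : ∀ t, u (t + 1) ∘ₗ f t = g t ∘ₗ u t)
    (i j : ℕ) (h : i ≤ j) : u j ∘ₗ tr f i j h = tr g i j h ∘ₗ u i := by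
  induction j, h using Nat.le_induction with
  | base => rw [tr_self, tr_self]; rfl
  | succ k hk ih =>
    rw [tr_succ f i k hk, tr_succ g i k hk, ← LinearMap.comp_assoc, hu, LinearMap.comp_assoc, ih]
    rfl

/-- The map on limits induced by a map of sequences. -/
def map (u : ∀ t, X t →ₗ[S] Y t) (hu : ∀ t, u (t + 1) ∘ₗ f t = g t ∘ₗ u t) : Lim f →ₗ[S] Lim g :=
  Module.DirectLimit.map u (tr_comm u hu)

theorem map_of (u : ∀ t, X t →ₗ[S] Y t) (hu : ∀ t, u (t + 1) ∘ₗ f t = g t ∘ₗ u t) (t : ℕ) (x : X t) :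
    map u hu (of f t x) = of g t (u t x) :=
  Module.DirectLimit.map_apply_of _ _ _

theorem lim_ext {N : Type} [AddCommGroup N] [Module S N] {a b : Lim f →ₗ[S] N}
    (h : ∀ t x, a (of f t x) = b (of f t x)) : a = b := by
  refine LinearMap.ext fun z => ?_
  obtain ⟨t, x, rfl⟩ := exists_of f z
  exact h t x

theorem map_injective (u : ∀ t, X t →ₗ[S] Y t) (hu : ∀ t, u (t + 1) ∘ₗ f t = g t ∘ₗ u t)
    (h : ∀ t, Function.Injective (u t)) : Function.Injective (map u hu) := by
  rw [injective_iff_map_eq_zero]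
  intro z hz
  obtain ⟨t, x, rfl⟩ := exists_of f z
  rw [map_of] at hz
  obtain ⟨s, hs, h0⟩ := exists_tr_eq_zero g hz
  have := LinearMap.congr_fun (tr_comm u hu t s hs) x
  simp only [LinearMap.comp_apply] at this
  rw [h0] at this
  rw [← of_tr f t s hs, (map_eq_zero_iff _ (h s)).1 this, map_zero]

theorem map_surjective (u : ∀ t, X t →ₗ[S] Y t) (hu : ∀ t, u (t + 1) ∘ₗ f t = g t ∘ₗ u t)
    (h : ∀ t, Function.Surjective (u t)) : Function.Surjective (map u hu) := by
  intro z
  obtain ⟨t, x, rfl⟩ := exists_of g z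
  obtain ⟨y, rfl⟩ := h t x
  exact ⟨of f t y, map_of _ _ _ _⟩

variable {Z : ℕ → Type} [∀ t, AddCommGroup (Z t)] [∀ t, Module S (Z t)]
  {k : ∀ t, Z t →ₗ[S] Z (t + 1)}

theorem map_exact (u : ∀ t, X t →ₗ[S] Y t) (hu : ∀ t, u (t + 1) ∘ₗ f t = g t ∘ₗ u t)
    (v : ∀ t, Y t →ₗ[S] Z t) (hv : ∀ t, v (t + 1) ∘ₗ g t = k t ∘ₗ v t)
    (h : ∀ t, Function.Exact (u t) (v t)) : Function.Exact (map u hu) (map v hv) := by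
  intro z
  constructor
  · intro hz
    obtain ⟨t, y, rfl⟩ := exists_of g z
    rw [map_of] at hz
    obtain ⟨s, hs, h0⟩ := exists_tr_eq_zero k hz
    have := LinearMap.congr_fun (tr_comm v hv t s hs) y
    simp only [LinearMap.comp_apply] at this
    rw [h0] at this
    obtain ⟨x, hx⟩ := (h s _).1 this
    exact ⟨of f s x, by rw [map_of, hx, of_tr]⟩
  · rintro ⟨w, rfl⟩
    obtain ⟨t, x, rfl⟩ := exists_of f w
    rw [map_of, map_of, (h t).apply_apply_eq_zero, map_zero]

/-- Two modules jointly covered by a sequence of modules with the same kernels are isomorphic. -/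
theorem exists_equiv {N N' : Type} [AddCommGroup N] [Module S N] [AddCommGroup N'] [Module S N']
    (u : ∀ t, X t →ₗ[S] N) (u' : ∀ t, X t →ₗ[S] N')
    (hu : ∀ t, u (t + 1) ∘ₗ f t = u t) (hu' : ∀ t, u' (t + 1) ∘ₗ f t = u' t)
    (hs : ∀ z, ∃ t x, u t x = z) (hs' : ∀ z, ∃ t x, u' t x = z)
    (hk : ∀ t x, u t x = 0 ↔ u' t x = 0) : ∃ e : N ≃ₗ[S] N', ∀ t x, e (u t x) = u' t x := by
  have key : ∀ {M : Type} [AddCommGroup M] [Module S M] (u : ∀ t, X t →ₗ[S] M),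
      (∀ t, u (t + 1) ∘ₗ f t = u t) → ∀ i j h, u j ∘ₗ tr f i j h = u i := by
    intro M _ _ u hu i j h
    induction j, h using Nat.le_induction with
    | base => rw [tr_self]; rfl
    | succ k hk ih => rw [tr_succ f i k hk, ← LinearMap.comp_assoc, hu, ih]
  let a : Lim f →ₗ[S] N := Module.DirectLimit.lift S ℕ X (tr f) u
    fun i j h x => LinearMap.congr_fun (key u hu i j h) x
  let a' : Lim f →ₗ[S] N' := Module.DirectLimit.lift S ℕ X (tr f) u'
    fun i j h x => LinearMap.congr_fun (key u' hu' i j h) x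
  have ha : ∀ t x, a (of f t x) = u t x := fun t x => Module.DirectLimit.lift_of _ _ _
  have ha' : ∀ t x, a' (of f t x) = u' t x := fun t x => Module.DirectLimit.lift_of _ _ _
  have sa : Function.Surjective a := fun z => by
    obtain ⟨t, x, h⟩ := hs z; exact ⟨of f t x, by rw [ha, h]⟩
  have sa' : Function.Surjective a' := fun z => by
    obtain ⟨t, x, h⟩ := hs' z; exact ⟨of f t x, by rw [ha', h]⟩
  have hker : LinearMap.ker a = LinearMap.ker a' := by
    ext z
    obtain ⟨t, x, rfl⟩ := exists_of f z
    simp only [LinearMap.mem_ker, ha, ha', hk]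
  let e := (a.quotKerEquivOfSurjective sa).symm ≪≫ₗ Submodule.quotEquivOfEq _ _ hker ≪≫ₗ
    a'.quotKerEquivOfSurjective sa'
  refine ⟨e, fun t x => ?_⟩
  have : (a.quotKerEquivOfSurjective sa).symm (u t x) = Submodule.Quotient.mk (of f t x) := by
    rw [LinearEquiv.symm_apply_eq, ← ha]; rfl
  simp only [e, LinearEquiv.trans_apply, this]
  exact ha' t x

end SeqLim

/-- Compatible projective resolutions of the quotients `S ⧸ J ^ t`. -/
structure PowRes (S : Type) [CommRing S] (J : Ideal S) where
  /-- the terms -/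
  P : ℕ → ℕ → Type
  [acg : ∀ t n, AddCommGroup (P t n)]
  [mod : ∀ t n, Module S (P t n)]
  proj : ∀ t n, Module.Projective S (P t n)
  /-- the differentials -/
  d : ∀ t n, P t (n + 1) →ₗ[S] P t n
  /-- the lifts of the projections -/
  φ : ∀ t n, P (t + 1) n →ₗ[S] P t n
  comm : ∀ t n, d t n ∘ₗ φ t (n + 1) = φ t n ∘ₗ d (t + 1) n
  /-- the augmentations -/
  ε : ∀ t, P t 0 →ₗ[S] S ⧸ J ^ t
  ε_surj : ∀ t, Function.Surjective (ε t)
  exact_zero : ∀ t, Function.Exact (d t 0) (ε t)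
  exact_succ : ∀ t n, Function.Exact (d t (n + 1)) (d t n)
  ε_comm : ∀ t (y : P (t + 1) 0) (s : S), ε (t + 1) y = Submodule.Quotient.mk s →
    ε t (φ t 0 y) = Submodule.Quotient.mk s

attribute [instance] PowRes.acg PowRes.mod PowRes.proj

namespace PowRes

open SeqLim

variable {S : Type} [CommRing S] {J : Ideal S} (Φ : PowRes S J)
variable (M : Type) [AddCommGroup M] [Module S M]
variable {N : Type} [AddCommGroup N] [Module S N]
variable {L : Type} [AddCommGroup L] [Module S L]

/-- Transition maps of the cochain groups. -/
def trn (n t : ℕ) : (Φ.P t n →ₗ[S] M) →ₗ[S] (Φ.P (t + 1) n →ₗ[S] M) :=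
  LinearMap.lcomp S M (Φ.φ t n)

/-- Cochains. -/
abbrev C (n : ℕ) : Type := Lim (Φ.trn M n)

/-- The class of a cochain. -/
abbrev cof (n t : ℕ) : (Φ.P t n →ₗ[S] M) →ₗ[S] Φ.C M n := SeqLim.of (Φ.trn M n) t

/-- The differential. -/
def δ (n : ℕ) : Φ.C M n →ₗ[S] Φ.C M (n + 1) :=
  SeqLim.map (fun t => LinearMap.lcomp S M (Φ.d t n)) fun t => by
    ext a y
    have := LinearMap.congr_fun (Φ.comm t n) y
    simp only [LinearMap.comp_apply] at this
    simp [trn, this]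

theorem δ_cof (n t : ℕ) (a : Φ.P t n →ₗ[S] M) :
    Φ.δ M n (Φ.cof M n t a) = Φ.cof M (n + 1) t (a ∘ₗ Φ.d t n) :=
  SeqLim.map_of _ _ _ _

theorem d_comp_d (t n : ℕ) : Φ.d t n ∘ₗ Φ.d t (n + 1) = 0 :=
  (Φ.exact_succ t n).linearMap_comp_eq_zero

theorem δ_comp_δ (n : ℕ) : Φ.δ M (n + 1) ∘ₗ Φ.δ M n = 0 := by
  refine SeqLim.lim_ext fun t a => ?_
  rw [LinearMap.comp_apply, δ_cof, δ_cof, LinearMap.comp_assoc, d_comp_d]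
  simp

variable {M}

/-- Functoriality of cochains. -/
def cmap (n : ℕ) (f : M →ₗ[S] N) : Φ.C M n →ₗ[S] Φ.C N n :=
  SeqLim.map (fun t => LinearMap.compRight S f) fun _ => by
    ext a y; simp [trn]

theorem cmap_cof (n t : ℕ) (f : M →ₗ[S] N) (a : Φ.P t n →ₗ[S] M) :
    Φ.cmap n f (Φ.cof M n t a) = Φ.cof N n t (f ∘ₗ a) :=
  SeqLim.map_of _ _ _ _

theorem cmap_δ (n : ℕ) (f : M →ₗ[S] N) (c : Φ.C M n) :
    Φ.cmap (n + 1) f (Φ.δ M n c) = Φ.δ N n (Φ.cmap n f c) := by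
  obtain ⟨t, a, rfl⟩ := SeqLim.exists_of _ c
  rw [cmap_cof, δ_cof, δ_cof, cmap_cof, LinearMap.comp_assoc]

theorem cmap_injective (n : ℕ) {f : M →ₗ[S] N} (hf : Function.Injective f) :
    Function.Injective (Φ.cmap n f) :=
  SeqLim.map_injective _ _ fun t a b h => by
    ext y; exact hf (LinearMap.congr_fun h y)

theorem cmap_surjective (n : ℕ) {f : M →ₗ[S] N} (hf : Function.Surjective f) :
    Function.Surjective (Φ.cmap n f) :=
  SeqLim.map_surjective _ _ fun _ a => Module.projective_lifting_property f a hf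

theorem cmap_exact (n : ℕ) {f : M →ₗ[S] N} {g : N →ₗ[S] L} (hfg : Function.Exact f g) :
    Function.Exact (Φ.cmap n f) (Φ.cmap n g) := by
  refine SeqLim.map_exact _ _ _ _ fun t a => ⟨fun h => ?_, ?_⟩
  · have h' : ∀ y, a y ∈ LinearMap.range f := fun y => (hfg _).1 (LinearMap.congr_fun h y)
    obtain ⟨b, hb⟩ := Module.projective_lifting_property f.rangeRestrict (a.codRestrict _ h')
      f.surjective_rangeRestrict
    refine ⟨b, ?_⟩
    ext y
    exact congr_arg Subtype.val (LinearMap.congr_fun hb y)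
  · rintro ⟨b, rfl⟩
    ext y
    exact hfg.apply_apply_eq_zero _

theorem cmap_id (n : ℕ) : Φ.cmap n (LinearMap.id : M →ₗ[S] M) = LinearMap.id :=
  SeqLim.lim_ext fun t a => by rw [cmap_cof]; rfl

theorem cmap_comp (n : ℕ) (g : N →ₗ[S] L) (f : M →ₗ[S] N) :
    Φ.cmap n (g ∘ₗ f) = Φ.cmap n g ∘ₗ Φ.cmap n f :=
  SeqLim.lim_ext fun t a => by
    rw [LinearMap.comp_apply, cmap_cof, cmap_cof, cmap_cof, LinearMap.comp_assoc]

theorem cmap_smul (n : ℕ) (s : S) (f : M →ₗ[S] N) : Φ.cmap n (s • f) = s • Φ.cmap n f :=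
  SeqLim.lim_ext fun t a => by
    rw [LinearMap.smul_apply, cmap_cof, cmap_cof, ← map_smul]; rfl

variable (M)

/-- Coboundaries. -/
def Bd : ∀ n, Submodule S (Φ.C M n)
  | 0 => ⊥
  | n + 1 => LinearMap.range (Φ.δ M n)

/-- Cocycles. -/
abbrev Zc (n : ℕ) : Submodule S (Φ.C M n) := LinearMap.ker (Φ.δ M n)

theorem Bd_le_Zc (n : ℕ) : Φ.Bd M n ≤ Φ.Zc M n := by
  cases n with
  | zero => exact bot_le
  | succ n => exact LinearMap.range_le_ker_iff.2 (Φ.δ_comp_δ M n)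

/-- Cohomology, a model of local cohomology. -/
abbrev H (n : ℕ) : Type := Φ.Zc M n ⧸ (Φ.Bd M n).submoduleOf (Φ.Zc M n)

/-- Class of a cocycle. -/
abbrev cl (n : ℕ) : Φ.Zc M n →ₗ[S] Φ.H M n := Submodule.mkQ _

theorem cl_surjective (n : ℕ) : Function.Surjective (Φ.cl M n) := Submodule.mkQ_surjective _

theorem cl_eq_zero {n : ℕ} (z : Φ.Zc M n) : Φ.cl M n z = 0 ↔ (z : Φ.C M n) ∈ Φ.Bd M n := by
  rw [Submodule.mkQ_apply, Submodule.Quotient.mk_eq_zero]; rfl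

variable {M}

theorem cmap_mem_Zc {n : ℕ} (f : M →ₗ[S] N) {c : Φ.C M n} (h : c ∈ Φ.Zc M n) :
    Φ.cmap n f c ∈ Φ.Zc N n := by
  rw [LinearMap.mem_ker, ← cmap_δ, LinearMap.mem_ker.1 h, map_zero]

theorem cmap_mem_Bd {n : ℕ} (f : M →ₗ[S] N) {c : Φ.C M n} (h : c ∈ Φ.Bd M n) :
    Φ.cmap n f c ∈ Φ.Bd N n := by
  cases n with
  | zero => rw [(Submodule.mem_bot S).1 h, map_zero]; exact zero_mem _
  | succ n => obtain ⟨b, rfl⟩ := h; exact ⟨_, (Φ.cmap_δ n f b).symm⟩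

/-- Functoriality on cocycles. -/
def zmap (n : ℕ) (f : M →ₗ[S] N) : Φ.Zc M n →ₗ[S] Φ.Zc N n :=
  (Φ.cmap n f).restrict fun _ h => Φ.cmap_mem_Zc f h

/-- Functoriality of cohomology. -/
def hmap (n : ℕ) (f : M →ₗ[S] N) : Φ.H M n →ₗ[S] Φ.H N n :=
  Submodule.mapQ _ _ (Φ.zmap n f) fun _ h => Φ.cmap_mem_Bd f h

theorem hmap_cl (n : ℕ) (f : M →ₗ[S] N) (z : Φ.Zc M n) :
    Φ.hmap n f (Φ.cl M n z) = Φ.cl N n (Φ.zmap n f z) := rfl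

theorem hmap_id (n : ℕ) : Φ.hmap n (LinearMap.id : M →ₗ[S] M) = LinearMap.id := by
  refine LinearMap.ext fun z => ?_
  obtain ⟨z, rfl⟩ := Φ.cl_surjective M n z
  rw [hmap_cl]
  exact congr_arg (Φ.cl M n) (Subtype.ext (LinearMap.congr_fun (Φ.cmap_id n) _))

theorem hmap_comp (n : ℕ) (g : N →ₗ[S] L) (f : M →ₗ[S] N) :
    Φ.hmap n (g ∘ₗ f) = Φ.hmap n g ∘ₗ Φ.hmap n f := by
  refine LinearMap.ext fun z => ?_
  obtain ⟨z, rfl⟩ := Φ.cl_surjective M n z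
  rw [LinearMap.comp_apply, hmap_cl, hmap_cl, hmap_cl]
  congr 1
  ext1
  exact LinearMap.congr_fun (Φ.cmap_comp n g f) _

theorem hmap_smul (n : ℕ) (s : S) (f : M →ₗ[S] N) : Φ.hmap n (s • f) = s • Φ.hmap n f := by
  refine LinearMap.ext fun z => ?_
  obtain ⟨z, rfl⟩ := Φ.cl_surjective M n z
  rw [LinearMap.smul_apply, hmap_cl, hmap_cl, ← map_smul]
  congr 1
  ext1
  exact LinearMap.congr_fun (Φ.cmap_smul n s f) _

/-- Cohomology of isomorphic modules. -/
def hcongr (n : ℕ) (e : M ≃ₗ[S] N) : Φ.H M n ≃ₗ[S] Φ.H N n :=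
  LinearEquiv.ofLinearMap (Φ.hmap n e) (Φ.hmap n e.symm)
    (by rw [← hmap_comp]; simp [hmap_id]) (by rw [← hmap_comp]; simp [hmap_id])

end PowRes

end

noncomputable section

theorem exists_comp_eq_of_ker_le {S T A B : Type} [CommRing S] [AddCommGroup T] [Module S T]
    [AddCommGroup A] [Module S A] [AddCommGroup B] [Module S B] (α : T →ₗ[S] A) (β : T →ₗ[S] B)
    (hα : Function.Surjective α) (h : LinearMap.ker α ≤ LinearMap.ker β) :
    ∃ γ : A →ₗ[S] B, ∀ t, γ (α t) = β t := by
  refine ⟨(LinearMap.ker α).liftQ β h ∘ₗ (α.quotKerEquivOfSurjective hα).symm, fun t => ?_⟩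
  have : (α.quotKerEquivOfSurjective hα).symm (α t) = Submodule.Quotient.mk t := by
    rw [LinearEquiv.symm_apply_eq]; rfl
  simp only [LinearMap.comp_apply, LinearEquiv.coe_coe, this]
  rfl

namespace PowRes

open SeqLim

variable {S : Type} [CommRing S] {J : Ideal S} (Φ : PowRes S J)
variable {M : Type} [AddCommGroup M] [Module S M]
variable {N : Type} [AddCommGroup N] [Module S N]
variable {L : Type} [AddCommGroup L] [Module S L]

theorem hmap_exact (n : ℕ) {f : M →ₗ[S] N} {g : N →ₗ[S] L} (hf : Function.Injective f)
    (hg : Function.Surjective g) (hfg : Function.Exact f g) :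
    Function.Exact (Φ.hmap n f) (Φ.hmap n g) := by
  have key : ∀ c ∈ Φ.Zc N n, Φ.cmap n g c = 0 → ∃ b ∈ Φ.Zc M n, Φ.cmap n f b = c := by
    intro c hc h
    obtain ⟨b, rfl⟩ := (Φ.cmap_exact n hfg c).1 h
    refine ⟨b, ?_, rfl⟩
    rw [LinearMap.mem_ker, ← cmap_δ] at hc
    exact (map_eq_zero_iff _ (Φ.cmap_injective _ hf)).1 hc
  intro z
  constructor
  · intro hz
    obtain ⟨⟨z, hzc⟩, rfl⟩ := Φ.cl_surjective N n z
    rw [hmap_cl, cl_eq_zero] at hz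
    have hz : Φ.cmap n g z ∈ Φ.Bd L n := hz
    cases n with
    | zero =>
      obtain ⟨b, hb, h⟩ := key z hzc hz
      exact ⟨Φ.cl M 0 ⟨b, hb⟩, congr_arg (Φ.cl N 0) (Subtype.ext h)⟩
    | succ n =>
      obtain ⟨w, hw⟩ := hz
      obtain ⟨c, rfl⟩ := Φ.cmap_surjective n hg w
      obtain ⟨b, hb, h⟩ := key (z - Φ.δ N n c)
        (sub_mem hzc (Φ.Bd_le_Zc N (n + 1) ⟨c, rfl⟩)) (by rw [map_sub, cmap_δ, hw, sub_self])
      refine ⟨Φ.cl M (n + 1) ⟨b, hb⟩, ?_⟩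
      rw [hmap_cl, ← sub_eq_zero, ← map_sub, cl_eq_zero]
      refine ⟨-c, ?_⟩
      simp only [AddSubgroupClass.coe_sub]
      change _ = Φ.cmap (n + 1) f b - z
      rw [h, map_neg]; abel
  · rintro ⟨w, rfl⟩
    rw [← LinearMap.comp_apply, ← hmap_comp, hfg.linearMap_comp_eq_zero]
    rw [← zero_smul S (0 : M →ₗ[S] L), hmap_smul]
    simp

theorem exists_connecting (n : ℕ) {f : M →ₗ[S] N} {g : N →ₗ[S] L} (hf : Function.Injective f)
    (hg : Function.Surjective g) (hfg : Function.Exact f g) :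
    ∃ κ : Φ.H L n →ₗ[S] Φ.H M (n + 1),
      Function.Exact (Φ.hmap n g) κ ∧ Function.Exact κ (Φ.hmap (n + 1) f) := by
  let T : Submodule S (Φ.C N n × Φ.Zc M (n + 1) × Φ.Zc L n) :=
    LinearMap.eqLocus (Φ.cmap n g ∘ₗ LinearMap.fst S _ _)
        (Submodule.subtype _ ∘ₗ LinearMap.snd S _ _ ∘ₗ LinearMap.snd S _ _) ⊓
      LinearMap.eqLocus (Φ.δ N n ∘ₗ LinearMap.fst S _ _)
        (Φ.cmap (n + 1) f ∘ₗ Submodule.subtype _ ∘ₗ LinearMap.fst S _ _ ∘ₗ LinearMap.snd S _ _)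
  have memT : ∀ c z w, (c, z, w) ∈ T ↔
      Φ.cmap n g c = w ∧ Φ.δ N n c = Φ.cmap (n + 1) f z := fun c z w => Iff.rfl
  have mk : ∀ c, ∀ w : Φ.Zc L n, Φ.cmap n g c = w → ∃ z : Φ.Zc M (n + 1),
      Φ.cmap (n + 1) f z = Φ.δ N n c := by
    intro c w hc
    obtain ⟨b, hb⟩ := (Φ.cmap_exact (n + 1) hfg (Φ.δ N n c)).1
      (by rw [cmap_δ, hc]; exact w.2)
    refine ⟨⟨b, ?_⟩, hb⟩
    apply Φ.cmap_injective (n + 2) hf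
    rw [cmap_δ, hb, map_zero]
    exact LinearMap.congr_fun (Φ.δ_comp_δ N n) c
  have lift : ∀ w : Φ.Zc L n, ∃ c z, (c, z, w) ∈ T := by
    intro w
    obtain ⟨c, hc⟩ := Φ.cmap_surjective n hg w
    obtain ⟨z, hz⟩ := mk c w hc
    exact ⟨c, z, hc, hz.symm⟩
  obtain ⟨κ, hκ⟩ := exists_comp_eq_of_ker_le
    (Φ.cl L n ∘ₗ LinearMap.snd S _ _ ∘ₗ LinearMap.snd S _ _ ∘ₗ T.subtype)
    (Φ.cl M (n + 1) ∘ₗ LinearMap.fst S _ _ ∘ₗ LinearMap.snd S _ _ ∘ₗ T.subtype)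
    (fun y => by
      obtain ⟨w, rfl⟩ := Φ.cl_surjective L n y
      obtain ⟨c, z, h⟩ := lift w
      exact ⟨⟨_, h⟩, rfl⟩)
    (by
      rintro ⟨⟨c, z, w⟩, h⟩ hw
      obtain ⟨hc, hz⟩ := (memT _ _ _).1 h
      have hw : (w : Φ.C L n) ∈ Φ.Bd L n := (Φ.cl_eq_zero L w).1 hw
      refine (Φ.cl_eq_zero M z).2 ?_
      have key : ∃ c', Φ.cmap n g c' = 0 ∧ Φ.δ N n c' = Φ.δ N n c := by
        cases n with
        | zero => exact ⟨c, by rw [hc]; exact hw, rfl⟩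
        | succ n =>
          obtain ⟨v, hv⟩ := hw
          obtain ⟨u, rfl⟩ := Φ.cmap_surjective n hg v
          refine ⟨c - Φ.δ N n u, by rw [map_sub, cmap_δ, hv, hc, sub_self], ?_⟩
          rw [map_sub, ← LinearMap.comp_apply (Φ.δ N (n + 1)), δ_comp_δ]; simp
      obtain ⟨c', h1, h2⟩ := key
      obtain ⟨b, rfl⟩ := (Φ.cmap_exact n hfg c').1 h1
      refine ⟨b, Φ.cmap_injective _ hf ?_⟩
      rw [cmap_δ, h2, hz])
  have hκ' : ∀ c z w, (c, z, w) ∈ T → κ (Φ.cl L n w) = Φ.cl M (n + 1) z :=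
    fun c z w h => hκ ⟨_, h⟩
  refine ⟨κ, fun y => ⟨fun hy => ?_, ?_⟩, fun y => ⟨fun hy => ?_, ?_⟩⟩
  · obtain ⟨w, rfl⟩ := Φ.cl_surjective L n y
    obtain ⟨c, z, h⟩ := lift w
    rw [hκ' c z w h, cl_eq_zero] at hy
    obtain ⟨b, hb⟩ := hy
    obtain ⟨hc, hz⟩ := (memT _ _ _).1 h
    refine ⟨Φ.cl N n ⟨c - Φ.cmap n f b, ?_⟩, ?_⟩
    · rw [LinearMap.mem_ker, map_sub, ← cmap_δ, hb, hz, sub_self]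
    · refine congr_arg (Φ.cl L n) (Subtype.ext ?_)
      change Φ.cmap n g (c - Φ.cmap n f b) = w
      rw [map_sub, (Φ.cmap_exact n hfg).apply_apply_eq_zero, hc, sub_zero]
  · rintro ⟨v, rfl⟩
    obtain ⟨c, rfl⟩ := Φ.cl_surjective N n v
    rw [hmap_cl, hκ' c 0 (Φ.zmap n g c) ((memT _ _ _).2 ⟨rfl, by simp⟩), map_zero]
  · obtain ⟨z, rfl⟩ := Φ.cl_surjective M (n + 1) y
    rw [hmap_cl, cl_eq_zero] at hy
    obtain ⟨c, hc⟩ := hy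
    have hc : Φ.δ N n c = Φ.cmap (n + 1) f z := hc
    refine ⟨Φ.cl L n ⟨Φ.cmap n g c, ?_⟩, hκ' c z _ ⟨rfl, hc⟩⟩
    rw [LinearMap.mem_ker, ← cmap_δ, hc, (Φ.cmap_exact (n + 1) hfg).apply_apply_eq_zero]
  · rintro ⟨v, rfl⟩
    obtain ⟨w, rfl⟩ := Φ.cl_surjective L n v
    obtain ⟨c, z, h⟩ := lift w
    rw [hκ' c z w h, hmap_cl, cl_eq_zero]
    exact ⟨c, ((memT _ _ _).1 h).2⟩

end PowRes

end

noncomputable section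

/-- The `J`-power torsion submodule. -/
def gam {S : Type} [CommRing S] (J : Ideal S) (M : Type) [AddCommGroup M] [Module S M] :
    Submodule S M where
  carrier := {m | ∃ t : ℕ, ∀ r ∈ J ^ t, r • m = 0}
  zero_mem' := ⟨0, fun r _ => smul_zero r⟩
  add_mem' := by
    rintro a b ⟨s, hs⟩ ⟨t, ht⟩
    refine ⟨s + t, fun r hr => ?_⟩
    rw [smul_add, hs r (Ideal.pow_le_pow_right (Nat.le_add_right s t) hr),
      ht r (Ideal.pow_le_pow_right (Nat.le_add_left t s) hr), add_zero]
  smul_mem' := by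
    rintro c a ⟨s, hs⟩
    exact ⟨s, fun r hr => by rw [smul_comm, hs r hr, smul_zero]⟩

theorem mem_gam {S : Type} [CommRing S] {J : Ideal S} {M : Type} [AddCommGroup M] [Module S M]
    {m : M} : m ∈ gam J M ↔ ∃ t : ℕ, ∀ r ∈ J ^ t, r • m = 0 := Iff.rfl

namespace PowRes

open SeqLim

variable {S : Type} [CommRing S] {J : Ideal S} (Φ : PowRes S J)
variable (M : Type) [AddCommGroup M] [Module S M]
variable {N : Type} [AddCommGroup N] [Module S N]

/-- Cocycles at a finite level. -/
abbrev Zt (n t : ℕ) : Submodule S (Φ.P t n →ₗ[S] M) := LinearMap.ker (LinearMap.lcomp S M (Φ.d t n))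

/-- Coboundaries at a finite level. -/
def Bt : ∀ n t : ℕ, Submodule S (Φ.P t n →ₗ[S] M)
  | 0, _ => ⊥
  | n + 1, t => LinearMap.range (LinearMap.lcomp S M (Φ.d t n))

theorem mem_Zt {n t : ℕ} {a : Φ.P t n →ₗ[S] M} : a ∈ Φ.Zt M n t ↔ a ∘ₗ Φ.d t n = 0 := Iff.rfl

theorem trn_mem_Zt {n t : ℕ} {a : Φ.P t n →ₗ[S] M} (h : a ∈ Φ.Zt M n t) :
    Φ.trn M n t a ∈ Φ.Zt M n (t + 1) := by
  rw [mem_Zt] at h ⊢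
  change (a ∘ₗ Φ.φ t n) ∘ₗ _ = 0
  rw [LinearMap.comp_assoc, ← Φ.comm, ← LinearMap.comp_assoc, h, LinearMap.zero_comp]

/-- Transition maps on cocycles. -/
def ztr (n t : ℕ) : Φ.Zt M n t →ₗ[S] Φ.Zt M n (t + 1) :=
  (Φ.trn M n t).restrict fun _ h => Φ.trn_mem_Zt M h

theorem coe_tr_ztr (n s t : ℕ) (h : s ≤ t) (a : Φ.Zt M n s) :
    (tr (Φ.ztr M n) s t h a : Φ.P t n →ₗ[S] M) = tr (Φ.trn M n) s t h a :=
  LinearMap.congr_fun (tr_comm (f := Φ.ztr M n) (g := Φ.trn M n)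
    (fun t => (Φ.Zt M n t).subtype) (fun _ => rfl) s t h) a

theorem tr_trn_comp_d (n s t : ℕ) (h : s ≤ t) (a : Φ.P s n →ₗ[S] M) :
    tr (Φ.trn M n) s t h a ∘ₗ Φ.d t n = tr (Φ.trn M (n + 1)) s t h (a ∘ₗ Φ.d s n) :=
  LinearMap.congr_fun (tr_comm (f := Φ.trn M n) (g := Φ.trn M (n + 1))
    (fun t => LinearMap.lcomp S M (Φ.d t n)) (fun t => by
      ext a y
      have := LinearMap.congr_fun (Φ.comm t n) y
      simp only [LinearMap.comp_apply] at this
      simp [trn, this]) s t h) a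

/-- The class of a finite-level cocycle. -/
def zcl (n t : ℕ) : Φ.Zt M n t →ₗ[S] Φ.H M n :=
  Φ.cl M n ∘ₗ (Φ.cof M n t).restrict fun a h => by
    rw [LinearMap.mem_ker, δ_cof, (Φ.mem_Zt M).1 h, map_zero]

theorem zcl_ztr (n t : ℕ) : Φ.zcl M n (t + 1) ∘ₗ Φ.ztr M n t = Φ.zcl M n t := by
  refine LinearMap.ext fun a => congr_arg (Φ.cl M n) (Subtype.ext ?_)
  have := of_tr (Φ.trn M n) t (t + 1) t.le_succ a
  rw [tr_succ _ t t le_rfl, tr_self] at this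
  exact this

theorem exists_zcl (n : ℕ) (z : Φ.H M n) : ∃ t a, Φ.zcl M n t a = z := by
  obtain ⟨⟨c, hc⟩, rfl⟩ := Φ.cl_surjective M n z
  obtain ⟨t, a, rfl⟩ := SeqLim.exists_of _ c
  rw [LinearMap.mem_ker, δ_cof] at hc
  obtain ⟨s, hs, h0⟩ := exists_tr_eq_zero _ hc
  refine ⟨s, ⟨tr (Φ.trn M n) t s hs a, ?_⟩, ?_⟩
  · rw [mem_Zt, tr_trn_comp_d, h0]
  · exact congr_arg (Φ.cl M n) (Subtype.ext (of_tr _ _ _ _ _))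

theorem zcl_eq_zero {n t : ℕ} (a : Φ.Zt M n t) :
    Φ.zcl M n t a = 0 ↔ ∃ s, ∃ h : t ≤ s, tr (Φ.trn M n) t s h a ∈ Φ.Bt M n s := by
  constructor
  · intro h
    have h : Φ.cof M n t a ∈ Φ.Bd M n := (Φ.cl_eq_zero M _).1 h
    cases n with
    | zero =>
      obtain ⟨s, hs, h0⟩ := exists_tr_eq_zero _ ((Submodule.mem_bot S).1 h)
      exact ⟨s, hs, h0⟩
    | succ n =>
      obtain ⟨c, hc⟩ := h
      obtain ⟨s, hs, b, rfl⟩ := SeqLim.exists_of_ge _ c t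
      rw [δ_cof] at hc
      have : Φ.cof M (n + 1) s (tr (Φ.trn M (n + 1)) t s hs a - b ∘ₗ Φ.d s n) = 0 := by
        rw [map_sub, of_tr, hc, sub_self]
      obtain ⟨u, hu, h0⟩ := exists_tr_eq_zero _ this
      refine ⟨u, hs.trans hu, tr (Φ.trn M n) s u hu b, ?_⟩
      rw [map_sub, ← tr_trn_comp_d, sub_eq_zero] at h0
      rw [tr_trans _ t s u hs hu]
      exact h0.symm
  · rintro ⟨s, hs, h⟩
    refine (Φ.cl_eq_zero M _).2 ?_
    change Φ.cof M n t a ∈ _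
    rw [cof, ← of_tr _ t s hs]
    cases n with
    | zero => rw [(Submodule.mem_bot S).1 h, map_zero]; exact zero_mem _
    | succ n =>
      obtain ⟨b, hb⟩ := h
      refine ⟨Φ.cof M n s b, ?_⟩
      rw [δ_cof, ← hb]; rfl

theorem subsingleton_H_of_injective [Module.Injective S M] (n : ℕ) :
    Subsingleton (Φ.H M (n + 1)) := by
  refine subsingleton_of_forall_eq 0 fun z => ?_
  obtain ⟨t, a, rfl⟩ := Φ.exists_zcl M (n + 1) z
  refine (Φ.zcl_eq_zero M a).2 ⟨t, le_rfl, ?_⟩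
  rw [tr_self]
  obtain ⟨γ, hγ⟩ := exists_comp_eq_of_ker_le (Φ.d t n).rangeRestrict a.1
    (Φ.d t n).surjective_rangeRestrict (by
      intro y hy
      rw [LinearMap.ker_rangeRestrict] at hy
      obtain ⟨w, rfl⟩ := (Φ.exact_succ t n y).1 hy
      exact LinearMap.congr_fun ((Φ.mem_Zt M).1 a.2) w)
  obtain ⟨b, hb⟩ := Module.Injective.out (LinearMap.range (Φ.d t n)).subtype
    (Submodule.subtype_injective _) γ
  refine ⟨b, ?_⟩
  ext y
  exact (hb ⟨Φ.d t n y, y, rfl⟩).trans (hγ y)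

/-- A lift of `1`. -/
def e (t : ℕ) : Φ.P t 0 := (Φ.ε_surj t (Submodule.Quotient.mk 1)).choose

theorem ε_e (t : ℕ) : Φ.ε t (Φ.e t) = Submodule.Quotient.mk 1 :=
  (Φ.ε_surj t (Submodule.Quotient.mk 1)).choose_spec

variable {M} in
theorem apply_eq_of_ε_eq {t : ℕ} (a : Φ.Zt M 0 t) {y y' : Φ.P t 0} (h : Φ.ε t y = Φ.ε t y') :
    a.1 y = a.1 y' := by
  rw [← sub_eq_zero, ← map_sub]
  obtain ⟨w, hw⟩ := (Φ.exact_zero t (y - y')).1 (by rw [map_sub, h, sub_self])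
  rw [← hw]
  exact LinearMap.congr_fun ((Φ.mem_Zt M).1 a.2) w

variable {M} in
theorem apply_eq_smul {t : ℕ} (a : Φ.Zt M 0 t) {y : Φ.P t 0} {s : S}
    (h : Φ.ε t y = Submodule.Quotient.mk s) : a.1 y = s • a.1 (Φ.e t) := by
  rw [← map_smul]
  apply Φ.apply_eq_of_ε_eq
  rw [h, map_smul, ε_e, ← Submodule.Quotient.mk_smul, smul_eq_mul, mul_one]

/-- Evaluation of degree-zero cocycles. -/
def ev (t : ℕ) : Φ.Zt M 0 t →ₗ[S] gam J M :=
  (LinearMap.applyₗ (Φ.e t) ∘ₗ (Φ.Zt M 0 t).subtype).codRestrict _ fun a => ⟨t, fun r hr => by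
    have := Φ.apply_eq_smul a (y := 0) (s := r)
      (by rw [map_zero, eq_comm, Submodule.Quotient.mk_eq_zero]; exact hr)
    rw [map_zero] at this
    exact this.symm⟩

theorem ev_ztr (t : ℕ) : Φ.ev M (t + 1) ∘ₗ Φ.ztr M 0 t = Φ.ev M t := by
  refine LinearMap.ext fun a => Subtype.ext ?_
  change a.1 (Φ.φ t 0 (Φ.e (t + 1))) = a.1 (Φ.e t)
  apply Φ.apply_eq_of_ε_eq
  rw [ε_e, Φ.ε_comm t _ 1 (Φ.ε_e (t + 1))]

theorem ev_injective (t : ℕ) : Function.Injective (Φ.ev M t) := by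
  rw [injective_iff_map_eq_zero]
  intro a ha
  have ha : a.1 (Φ.e t) = 0 := congr_arg Subtype.val ha
  refine Subtype.ext (LinearMap.ext fun y => ?_)
  obtain ⟨s, hs⟩ := Submodule.Quotient.mk_surjective _ (Φ.ε t y)
  rw [Φ.apply_eq_smul a hs.symm, ha, smul_zero]; rfl

theorem exists_H_zero_equiv : ∃ η : Φ.H M 0 ≃ₗ[S] gam J M,
    ∀ t a, η (Φ.zcl M 0 t a) = Φ.ev M t a := by
  refine SeqLim.exists_equiv (f := Φ.ztr M 0) _ _ (Φ.zcl_ztr M 0) (Φ.ev_ztr M)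
    (Φ.exists_zcl M 0) ?_ fun t a => ?_
  · rintro ⟨m, t, hm⟩
    have hle : J ^ t ≤ LinearMap.ker (LinearMap.toSpanSingleton S M m) := fun r hr => hm r hr
    refine ⟨t, ⟨Submodule.liftQ (J ^ t) (LinearMap.toSpanSingleton S M m) hle ∘ₗ Φ.ε t, ?_⟩, ?_⟩
    · rw [mem_Zt, LinearMap.comp_assoc, (Φ.exact_zero t).linearMap_comp_eq_zero,
        LinearMap.comp_zero]
    · refine Subtype.ext ?_
      change Submodule.liftQ (J ^ t) _ hle (Φ.ε t (Φ.e t)) = m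
      rw [ε_e]
      exact one_smul S m
  · rw [zcl_eq_zero, map_eq_zero_iff _ (Φ.ev_injective M t)]
    constructor
    · rintro ⟨s, hs, h⟩
      rw [← coe_tr_ztr] at h
      have h0 : tr (Φ.ztr M 0) t s hs a = 0 := Subtype.ext h
      have key := LinearMap.congr_fun (tr_comm (f := Φ.ztr M 0) (g := fun _ => LinearMap.id)
        (Φ.ev M) (Φ.ev_ztr M) t s hs) a
      have hid : ∀ s hs, tr (fun _ => (LinearMap.id : gam J M →ₗ[S] gam J M)) t s hs
          = LinearMap.id := by
        intro s hs
        induction s, hs using Nat.le_induction with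
        | base => rw [tr_self]
        | succ k hk ih => rw [tr_succ _ t k hk, ih]; rfl
      rw [LinearMap.comp_apply, h0, map_zero, hid] at key
      exact (map_eq_zero_iff _ (Φ.ev_injective M t)).1 key.symm
    · rintro rfl
      exact ⟨t, le_rfl, by simp⟩

/-- Degree zero cohomology is the torsion functor. -/
def η : Φ.H M 0 ≃ₗ[S] gam J M := (Φ.exists_H_zero_equiv M).choose

theorem η_zcl (t : ℕ) (a : Φ.Zt M 0 t) : Φ.η M (Φ.zcl M 0 t a) = Φ.ev M t a :=
  (Φ.exists_H_zero_equiv M).choose_spec t a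

variable {M} in
theorem η_hmap (f : M →ₗ[S] N) (z : Φ.H M 0) : (Φ.η N (Φ.hmap 0 f z) : N) = f (Φ.η M z) := by
  obtain ⟨t, a, rfl⟩ := Φ.exists_zcl M 0 z
  have : Φ.hmap 0 f (Φ.zcl M 0 t a) = Φ.zcl N 0 t ⟨f ∘ₗ a.1, by
      rw [mem_Zt, LinearMap.comp_assoc, (Φ.mem_Zt M).1 a.2, LinearMap.comp_zero]⟩ :=
    congr_arg (Φ.cl N 0) (Subtype.ext (Φ.cmap_cof 0 t f a.1))
  rw [this, η_zcl, η_zcl]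
  rfl

end PowRes

end

noncomputable section

open CategoryTheory Limits Opposite

section OppositeHomology

variable {S : Type} [CommRing S] (K : ChainComplex (ModuleCat.{0} S)ᵒᵖ ℕ) (n : ℕ)
  {Z : ModuleCat.{0} S} (k : Z ⟶ (K.X n).unop) (hk : k ≫ (K.d (n + 1) n).unop = 0)

/-- Cocycles of an opposite chain complex map to the homology. -/
def opHomologyClass : Z ⟶ (K.homology n).unop :=
  (K.homologyι n ≫ K.descOpcycles k.op (n + 1) (by simp) (Quiver.Hom.unop_inj hk)).unop

theorem opHomologyClass_eq : opHomologyClass K n k hk =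
    (K.descOpcycles k.op (n + 1) (by simp) (Quiver.Hom.unop_inj hk)).unop ≫ (K.homologyι n).unop :=
  rfl

theorem desc_comp_pOpcycles :
    (K.descOpcycles k.op (n + 1) (by simp) (Quiver.Hom.unop_inj hk)).unop ≫ (K.pOpcycles n).unop
      = k := by
  rw [← unop_comp, K.p_descOpcycles]; rfl

theorem opHomologyClass_surjective
    (hk' : ∀ b, (K.d (n + 1) n).unop.hom b = 0 → ∃ a, k.hom a = b) :
    Function.Surjective (opHomologyClass K n k hk).hom := by
  have h1 : Function.Surjective (K.homologyι n).unop.hom :=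
    (ModuleCat.epi_iff_surjective _).1 inferInstance
  have h2 : Function.Injective (K.pOpcycles n).unop.hom :=
    (ModuleCat.mono_iff_injective _).1 inferInstance
  intro y
  obtain ⟨o, rfl⟩ := h1 y
  obtain ⟨a, ha⟩ := hk' ((K.pOpcycles n).unop.hom o) (by
    have := congr_arg Quiver.Hom.unop (K.d_pOpcycles (n + 1) n)
    exact LinearMap.congr_fun (congr_arg ModuleCat.Hom.hom this) o)
  refine ⟨a, ?_⟩
  rw [opHomologyClass_eq, ModuleCat.hom_comp, LinearMap.comp_apply]
  congr 1
  apply h2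
  rw [← ha]
  exact LinearMap.congr_fun (congr_arg ModuleCat.Hom.hom (desc_comp_pOpcycles K n k hk)) a

theorem opHomologyClass_eq_zero_iff (j : ℕ) (hj : (ComplexShape.down ℕ).next n = j) (a : Z) :
    (opHomologyClass K n k hk).hom a = 0 ↔ ∃ b, (K.d n j).unop.hom b = k.hom a := by
  have h2 : Function.Injective (K.pOpcycles n).unop.hom :=
    (ModuleCat.mono_iff_injective _).1 inferInstance
  have hex : (ShortComplex.mk (K.homologyι n) (K.fromOpcycles n j) (by simp)).Exact :=
    ShortComplex.exact_of_f_is_kernel _ (K.homologyIsKernel n j hj)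
  have hex' := (ShortComplex.moduleCat_exact_iff _).1 hex.unop
  rw [opHomologyClass_eq, ModuleCat.hom_comp, LinearMap.comp_apply]
  have hd : ∀ b, (K.pOpcycles n).unop.hom ((K.fromOpcycles n j).unop.hom b)
      = (K.d n j).unop.hom b := fun b => by
    have := congr_arg Quiver.Hom.unop (K.p_fromOpcycles n j)
    exact LinearMap.congr_fun (congr_arg ModuleCat.Hom.hom this) b
  have hp : ∀ a, (K.pOpcycles n).unop.hom ((K.descOpcycles k.op (n + 1) (by simp)
      (Quiver.Hom.unop_inj hk)).unop.hom a) = k.hom a :=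
    LinearMap.congr_fun (congr_arg ModuleCat.Hom.hom (desc_comp_pOpcycles K n k hk))
  constructor
  · intro h
    obtain ⟨b, hb⟩ := hex' _ h
    exact ⟨b, (hd b).symm.trans ((congr_arg _ hb).trans (hp a))⟩
  · rintro ⟨b, hb⟩
    rw [← hd, ← hp] at hb
    rw [← h2 hb]
    have := congr_arg Quiver.Hom.unop (K.homologyι_comp_fromOpcycles n j)
    exact LinearMap.congr_fun (congr_arg ModuleCat.Hom.hom this) b

theorem opHomologyClass_naturality (L : ChainComplex (ModuleCat.{0} S)ᵒᵖ ℕ) (φ : L ⟶ K)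
    {Z' : ModuleCat.{0} S} (k' : Z' ⟶ (L.X n).unop) (hk' : k' ≫ (L.d (n + 1) n).unop = 0)
    (z : Z ⟶ Z') (hz : k ≫ (φ.f n).unop = z ≫ k') :
    opHomologyClass K n k hk ≫ (HomologicalComplex.homologyMap φ n).unop =
      z ≫ opHomologyClass L n k' hk' := by
  rw [opHomologyClass, opHomologyClass]
  apply Quiver.Hom.op_inj
  simp only [op_comp, Quiver.Hom.op_unop]
  rw [HomologicalComplex.homologyι_naturality_assoc, Category.assoc]
  congr 1
  rw [← cancel_epi (L.pOpcycles n), HomologicalComplex.p_opcyclesMap_assoc, K.p_descOpcycles,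
    L.p_descOpcycles_assoc]
  exact congr_arg Quiver.Hom.op hz

end OppositeHomology

section Construction

variable {S : Type} [CommRing S] (J : Ideal S)

/-- The quotient by a power, as an object. -/
abbrev quotPow (t : ℕ) : ModuleCat.{0} S := ModuleCat.of S (S ⧸ J ^ t)

/-- The projection between quotients by powers. -/
abbrev quotPowMap (t : ℕ) : quotPow J (t + 1) ⟶ quotPow J t :=
  ModuleCat.ofHom (Submodule.mapQ _ _ LinearMap.id (Ideal.pow_le_pow_right t.le_succ))

/-- A chosen projective resolution. -/
def quotPowRes (t : ℕ) : ProjectiveResolution (quotPow J t) := projectiveResolution _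

/-- A lift of the projection. -/
def quotPowLift (t : ℕ) : (quotPowRes J (t + 1)).complex ⟶ (quotPowRes J t).complex :=
  ProjectiveResolution.lift (quotPowMap J t) _ _

theorem quotPowLift_comm (t : ℕ) : (quotPowLift J t).f 0 ≫ (quotPowRes J t).π.f 0 =
    (quotPowRes J (t + 1)).π.f 0 ≫ quotPowMap J t :=
  ProjectiveResolution.lift_commutes_zero _ _ _

/-- Compatible resolutions exist. -/
def stdPowRes : PowRes S J where
  P t n := (quotPowRes J t).complex.X n
  proj t n := (IsProjective.iff_projective _).2 ((quotPowRes J t).projective n)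
  d t n := ((quotPowRes J t).complex.d (n + 1) n).hom
  φ t n := ((quotPowLift J t).f n).hom
  comm t n := congr_arg ModuleCat.Hom.hom ((quotPowLift J t).comm (n + 1) n)
  ε t := ((quotPowRes J t).π.f 0).hom
  ε_surj t := (ModuleCat.epi_iff_surjective ((quotPowRes J t).π.f 0)).1 inferInstance
  exact_zero t := (ShortComplex.ShortExact.moduleCat_exact_iff_function_exact _).1 (quotPowRes J t).exact₀
  exact_succ t n := (ShortComplex.ShortExact.moduleCat_exact_iff_function_exact _).1
    ((quotPowRes J t).exact_succ n)
  ε_comm t y s h := by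
    have := LinearMap.congr_fun (congr_arg ModuleCat.Hom.hom (quotPowLift_comm J t)) y
    refine Eq.trans this ?_
    exact congr_arg (quotPowMap J t).hom h

end Construction

end

noncomputable section

open CategoryTheory Limits Opposite

section Comparison

variable {S : Type} [CommRing S] (J : Ideal S) (M : ModuleCat.{0} S) (n : ℕ)

/-- The cochain complex computing `Ext`, as a chain complex in the opposite category. -/
abbrev extCplx (t : ℕ) : ChainComplex (ModuleCat.{0} S)ᵒᵖ ℕ :=
  ((((linearYoneda S (ModuleCat.{0} S)).obj M).rightOp).mapHomologicalComplex _).obj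
    (quotPowRes J t).complex

/-- The inclusion of cocycles. -/
def zIncl (t : ℕ) : ModuleCat.of S ((stdPowRes J).Zt M n t) ⟶ ((extCplx J M t).X n).unop :=
  ModuleCat.ofHom (Y := ModuleCat.of S ((quotPowRes J t).complex.X n ⟶ M))
    { toFun := fun a => ModuleCat.ofHom a.1
      map_add' := fun _ _ => rfl
      map_smul' := fun _ _ => rfl }

theorem zIncl_comp (t : ℕ) : zIncl J M n t ≫ ((extCplx J M t).d (n + 1) n).unop = 0 := by
  ext a
  exact congr_arg ModuleCat.ofHom a.2

/-- Cocycles to `Ext`. -/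
def extClass (t : ℕ) : ModuleCat.of S ((stdPowRes J).Zt M n t) ⟶
    ((Ext S (ModuleCat.{0} S) n).obj (op (quotPow J t))).obj M :=
  opHomologyClass (extCplx J M t) n (zIncl J M n t) (zIncl_comp J M n t) ≫
    ((quotPowRes J t).isoLeftDerivedObj ((linearYoneda S (ModuleCat.{0} S)).obj M).rightOp n).hom.unop

theorem isoUnop_injective (t : ℕ) : Function.Bijective
    (((quotPowRes J t).isoLeftDerivedObj
      ((linearYoneda S (ModuleCat.{0} S)).obj M).rightOp n).hom.unop).hom :=
  (ConcreteCategory.isIso_iff_bijective _).1 inferInstance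

theorem extClass_surjective (t : ℕ) : Function.Surjective (extClass J M n t).hom := by
  refine (isoUnop_injective J M n t).2.comp (opHomologyClass_surjective _ n _ _ fun b hb => ?_)
  exact ⟨⟨ModuleCat.Hom.hom b, congr_arg ModuleCat.Hom.hom hb⟩, rfl⟩

theorem extClass_eq_zero_iff (t : ℕ) (a : (stdPowRes J).Zt M n t) :
    (extClass J M n t).hom a = 0 ↔ a.1 ∈ (stdPowRes J).Bt M n t := by
  refine (map_eq_zero_iff _ (isoUnop_injective J M n t).1).trans ?_
  cases n with
  | zero =>
    refine (opHomologyClass_eq_zero_iff (extCplx J M t) 0 (zIncl J M 0 t) (zIncl_comp J M 0 t) 0 (by simp) a).trans ?_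
    constructor
    · rintro ⟨b, hb⟩
      have h0 : (extCplx J M t).d 0 0 = 0 := (extCplx J M t).shape _ _ (by simp)
      rw [h0] at hb
      exact (congr_arg ModuleCat.Hom.hom hb).symm
    · intro h
      refine ⟨0, ?_⟩
      rw [map_zero]
      exact (congr_arg ModuleCat.ofHom h).symm
  | succ n =>
    refine (opHomologyClass_eq_zero_iff (extCplx J M t) (n + 1) (zIncl J M (n + 1) t)
      (zIncl_comp J M (n + 1) t) n (by simp) a).trans ?_
    constructor
    · rintro ⟨b, hb⟩
      exact ⟨ModuleCat.Hom.hom b, congr_arg ModuleCat.Hom.hom hb⟩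
    · rintro ⟨b, hb⟩
      exact ⟨ModuleCat.ofHom b, congr_arg ModuleCat.ofHom hb⟩

theorem extClass_naturality (t : ℕ) :
    extClass J M n t ≫ ((Ext S (ModuleCat.{0} S) n).map (quotPowMap J t).op).app M =
      ModuleCat.ofHom ((stdPowRes J).ztr M n t) ≫ extClass J M n (t + 1) := by
  have h1 := ProjectiveResolution.isoLeftDerivedObj_hom_naturality (quotPowMap J t)
    (quotPowRes J (t + 1)) (quotPowRes J t) (quotPowLift J t) (quotPowLift_comm J t)
    ((linearYoneda S (ModuleCat.{0} S)).obj M).rightOp n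
  have h2 := opHomologyClass_naturality (extCplx J M t) n (zIncl J M n t) (zIncl_comp J M n t)
    (extCplx J M (t + 1))
    (((((linearYoneda S (ModuleCat.{0} S)).obj M).rightOp).mapHomologicalComplex _).map
      (quotPowLift J t)) (zIncl J M n (t + 1)) (zIncl_comp J M n (t + 1))
    (ModuleCat.ofHom ((stdPowRes J).ztr M n t)) rfl
  have h1' := congr_arg Quiver.Hom.unop h1
  rw [unop_comp, unop_comp] at h1'
  calc _ = opHomologyClass (extCplx J M t) n (zIncl J M n t) (zIncl_comp J M n t) ≫ _ :=
        Category.assoc _ _ _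
    _ = _ := by
      refine (congr_arg (fun f => opHomologyClass (extCplx J M t) n (zIncl J M n t)
        (zIncl_comp J M n t) ≫ f) h1').trans ?_
      refine (Category.assoc _ _ _).symm.trans ?_
      refine (congr_arg (fun f => f ≫ _) h2).trans ?_
      exact Category.assoc _ _ _

/-- The evaluated diagram of `Ext` modules. -/
abbrev extDiag : (ℕᵒᵖ)ᵒᵖ ⥤ ModuleCat.{0} S :=
  localCohomology.diagram (localCohomology.idealPowersDiagram J) n ⋙ (evaluation _ _).obj M

/-- The colimit cocone defining local cohomology. -/
abbrev lcCocone : Cocone (extDiag J M n) :=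
  ((evaluation _ _).obj M).mapCocone (colimit.cocone
    (localCohomology.diagram (localCohomology.idealPowersDiagram J) n))

/-- It is a colimit. -/
def lcIsColimit : IsColimit (lcCocone J M n) :=
  isColimitOfPreserves ((evaluation _ _).obj M) (colimit.isColimit
    (localCohomology.diagram (localCohomology.idealPowersDiagram J) n))

/-- The arrow between consecutive indices. -/
abbrev stepArrow {s t : ℕ} (h : s ≤ t) : (op (op s) : (ℕᵒᵖ)ᵒᵖ) ⟶ op (op t) :=
  (homOfLE h).op.op

theorem extClass_tr (s t : ℕ) (h : s ≤ t) (a : (stdPowRes J).Zt M n s) :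
    ((extDiag J M n).map (stepArrow h)).hom ((extClass J M n s).hom a) =
      (extClass J M n t).hom (SeqLim.tr ((stdPowRes J).ztr M n) s t h a) := by
  induction t, h using Nat.le_induction with
  | base =>
    rw [SeqLim.tr_self, Subsingleton.elim (stepArrow (le_refl s)) (𝟙 _),
      (extDiag J M n).map_id]
    rfl
  | succ k hk ih =>
    rw [SeqLim.tr_succ _ s k hk,
      Subsingleton.elim (stepArrow (hk.trans k.le_succ)) (stepArrow hk ≫ stepArrow k.le_succ),
      (extDiag J M n).map_comp]
    exact (congr_arg ((extDiag J M n).map (stepArrow k.le_succ)).hom ih).trans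
      (LinearMap.congr_fun (congr_arg ModuleCat.Hom.hom (extClass_naturality J M n k)) _)

theorem exists_step_eq_zero {F : (ℕᵒᵖ)ᵒᵖ ⥤ ModuleCat.{0} S} {c : Cocone F} (hc : IsColimit c)
    (t : ℕ) (y : F.obj (op (op t))) (h : (c.ι.app (op (op t))).hom y = 0) :
    ∃ s, ∃ hs : t ≤ s, (F.map (stepArrow hs)).hom y = 0 := by
  obtain ⟨⟨⟨s⟩⟩, f, g, hfg⟩ := (Concrete.isColimit_rep_eq_iff_exists F hc
    (j := op (op t)) y (0 : F.obj (op (op t)))).1 (h.trans (map_zero _).symm)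
  refine ⟨s, leOfHom f.unop.unop, ?_⟩
  rw [Subsingleton.elim (stepArrow _) f]
  exact hfg.trans (map_zero _)

theorem nonempty_LC_equiv : Nonempty ((stdPowRes J).H M n ≃ₗ[S] LC S J n M) := by
  have hw : ∀ {s t : ℕ} (h : s ≤ t) (y), ((lcCocone J M n).ι.app (op (op t))).hom
      (((extDiag J M n).map (stepArrow h)).hom y) = ((lcCocone J M n).ι.app (op (op s))).hom y :=
    fun h y => LinearMap.congr_fun (congr_arg ModuleCat.Hom.hom
      ((lcCocone J M n).w (stepArrow h))) y
  refine (SeqLim.exists_equiv (f := (stdPowRes J).ztr M n) (N' := LC S J n M)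
    ((stdPowRes J).zcl M n)
    (fun t => ((lcCocone J M n).ι.app (op (op t))).hom ∘ₗ (extClass J M n t).hom)
    ((stdPowRes J).zcl_ztr M n) ?_ ((stdPowRes J).exists_zcl M n) ?_ ?_).nonempty
  · intro t
    refine LinearMap.ext fun a => ?_
    have := extClass_tr J M n t (t + 1) t.le_succ a
    rw [SeqLim.tr_succ _ t t le_rfl, SeqLim.tr_self] at this
    exact (congr_arg ((lcCocone J M n).ι.app (op (op (t + 1)))).hom this).symm.trans (hw _ _)
  · intro z
    obtain ⟨⟨⟨t⟩⟩, y, hy⟩ := Concrete.isColimit_exists_rep _ (lcIsColimit J M n) z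
    obtain ⟨a, rfl⟩ := extClass_surjective J M n t y
    exact ⟨t, a, hy⟩
  · intro t a
    rw [(stdPowRes J).zcl_eq_zero]
    constructor
    · rintro ⟨s, hs, h⟩
      rw [← PowRes.coe_tr_ztr, ← extClass_eq_zero_iff, ← extClass_tr] at h
      exact (hw hs _).symm.trans
        ((congr_arg ((lcCocone J M n).ι.app (op (op s))).hom h).trans (map_zero _))
    · intro h
      obtain ⟨s, hs, hfg⟩ := exists_step_eq_zero (lcIsColimit J M n) t ((extClass J M n t).hom a) h
      refine ⟨s, hs, ?_⟩
      rw [← PowRes.coe_tr_ztr, ← extClass_eq_zero_iff, ← extClass_tr]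
      exact hfg

end Comparison

end

noncomputable section

/-- Every module embeds into an injective module. -/
theorem exists_injective_embedding (S : Type) [CommRing S] (M : Type) [AddCommGroup M] [Module S M] :
    ∃ (Q : Type) (_ : AddCommGroup Q) (_ : Module S Q) (f : M →ₗ[S] Q),
      Module.Injective S Q ∧ Function.Injective f :=
  ⟨(CategoryTheory.Injective.under (ModuleCat.of S M) : ModuleCat S), inferInstance, inferInstance,
    (CategoryTheory.Injective.ι (ModuleCat.of S M)).hom,
    Module.injective_module_of_injective_object S _
      (inj := (inferInstance : CategoryTheory.Injective (CategoryTheory.Injective.under _))),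
    (ModuleCat.mono_iff_injective _).1 inferInstance⟩

section Gamma

variable {S : Type} [CommRing S] {J : Ideal S} {M N : Type} [AddCommGroup M] [Module S M]
  [AddCommGroup N] [Module S N]

theorem map_mem_gam (f : M →ₗ[S] N) {m : M} (h : m ∈ gam J M) : f m ∈ gam J N := by
  obtain ⟨t, ht⟩ := mem_gam.1 h
  exact mem_gam.2 ⟨t, fun r hr => by rw [← map_smul, ht r hr, map_zero]⟩

theorem gam_map_eq_top (f : M →ₗ[S] N) (hf : Function.Surjective f) (h : gam J M = ⊤) :
    gam J N = ⊤ := by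
  refine eq_top_iff.2 fun n _ => ?_
  obtain ⟨m, rfl⟩ := hf n
  exact map_mem_gam f (h ▸ Submodule.mem_top)

theorem gam_eq_top_of_injective (f : M →ₗ[S] N) (hf : Function.Injective f) (h : gam J N = ⊤) :
    gam J M = ⊤ := by
  refine eq_top_iff.2 fun n _ => ?_
  obtain ⟨t, ht⟩ := mem_gam.1 (show f n ∈ gam J N from h ▸ Submodule.mem_top)
  exact mem_gam.2 ⟨t, fun r hr => hf (by rw [map_smul, ht r hr, map_zero])⟩

theorem gam_gam : gam J (gam J M) = ⊤ := by
  refine eq_top_iff.2 fun n _ => ?_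
  obtain ⟨t, ht⟩ := mem_gam.1 n.2
  exact mem_gam.2 ⟨t, fun r hr => Subtype.ext (ht r hr)⟩

/-- A finitely generated submodule of torsion elements is killed by a power. -/
theorem exists_pow_smul_eq_zero_of_fg {K : Submodule S M} (hK : K.FG) (h : K ≤ gam J M) :
    ∃ t, ∀ r ∈ J ^ t, ∀ m ∈ K, r • m = 0 := by
  induction K, hK using Submodule.fg_induction with
  | singleton x =>
    obtain ⟨t, ht⟩ := mem_gam.1 (h (Submodule.mem_span_singleton_self x))
    refine ⟨t, fun r hr m hm => ?_⟩
    obtain ⟨a, rfl⟩ := Submodule.mem_span_singleton.1 hm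
    rw [smul_comm, ht r hr, smul_zero]
  | sup K₁ K₂ h1 h2 i1 i2 =>
    obtain ⟨t1, H1⟩ := i1 (le_sup_left.trans h)
    obtain ⟨t2, H2⟩ := i2 (le_sup_right.trans h)
    refine ⟨t1 + t2, fun r hr m hm => ?_⟩
    obtain ⟨a, ha, b, hb, rfl⟩ := Submodule.mem_sup.1 hm
    rw [smul_add, H1 r (Ideal.pow_le_pow_right (Nat.le_add_right _ _) hr) a ha,
      H2 r (Ideal.pow_le_pow_right (Nat.le_add_left _ _) hr) b hb, add_zero]

/-- Over a noetherian ring the torsion part of an injective module is injective. -/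
theorem injective_gam (J : Ideal S) [IsNoetherianRing S] (Q : Type) [AddCommGroup Q] [Module S Q]
    [Module.Injective S Q] : Module.Injective S (gam J Q) := by
  refine Module.Baer.injective fun I g => ?_
  have hfg : (LinearMap.range ((gam J Q).subtype ∘ₗ g)).FG := by
    rw [LinearMap.range_eq_map]
    exact (IsNoetherian.noetherian (⊤ : Submodule S I)).map _
  obtain ⟨t, ht⟩ := exists_pow_smul_eq_zero_of_fg (J := J) hfg (by rintro _ ⟨i, rfl⟩; exact (g i).2)
  obtain ⟨k, hk⟩ := Ideal.exists_pow_inf_eq_pow_smul J (M := S) I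
  have hle : ∀ (a : S) (ha : a ∈ I), a ∈ J ^ (t + k) → (g ⟨a, ha⟩ : Q) = 0 := by
    intro a ha haJ
    have h1 : a ∈ J ^ t • I := by
      have h2 : a ∈ J ^ (t + k) • (⊤ : Ideal S) ⊓ I := ⟨by simpa using haJ, ha⟩
      rw [hk _ (Nat.le_add_left _ _), Nat.add_sub_cancel] at h2
      exact (smul_mono_right (J ^ t) (inf_le_right : J ^ k • (⊤ : Ideal S) ⊓ I ≤ I) :) h2
    have h3 : J ^ t • I ≤ (LinearMap.ker ((gam J Q).subtype ∘ₗ g)).map I.subtype :=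
      Submodule.smul_le.2 fun r hr n hn => ⟨r • ⟨n, hn⟩, by
        rw [SetLike.mem_coe, LinearMap.mem_ker, map_smul]
        exact ht r hr _ ⟨_, rfl⟩, rfl⟩
    obtain ⟨b, hb, rfl⟩ := h3 h1
    exact hb
  let α : I →ₗ[S] S ⧸ J ^ (t + k) := (J ^ (t + k)).mkQ ∘ₗ I.subtype
  obtain ⟨γ, hγ⟩ := exists_comp_eq_of_ker_le α.rangeRestrict ((gam J Q).subtype ∘ₗ g)
    α.surjective_rangeRestrict (fun a ha => by
      refine hle a a.2 ?_
      have : α a = 0 := congr_arg Subtype.val ha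
      exact (Submodule.Quotient.mk_eq_zero _).1 this)
  obtain ⟨ψ, hψ⟩ := Module.Injective.out (LinearMap.range α).subtype Subtype.val_injective γ
  have hm : ∀ a : S, (ψ ∘ₗ (J ^ (t + k)).mkQ) a ∈ gam J Q := fun a =>
    mem_gam.2 ⟨t + k, fun r hr => by
      rw [← map_smul, LinearMap.comp_apply, Submodule.mkQ_apply,
        (Submodule.Quotient.mk_eq_zero (J ^ (t + k)) (x := r • a)).2
          (Ideal.mul_mem_right a _ hr), map_zero]⟩
  refine ⟨(ψ ∘ₗ (J ^ (t + k)).mkQ).codRestrict _ hm, fun a ha => Subtype.ext ?_⟩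
  exact (hψ (α.rangeRestrict ⟨a, ha⟩)).trans (hγ ⟨a, ha⟩)

end Gamma

namespace PowRes

variable {S : Type} [CommRing S] {J : Ideal S} (Φ : PowRes S J)
variable {M : Type} [AddCommGroup M] [Module S M]
variable {N : Type} [AddCommGroup N] [Module S N]
variable {L : Type} [AddCommGroup L] [Module S L]

theorem hmap_zero_surjective {f : M →ₗ[S] N} (hf : Function.Surjective f) (h : gam J M = ⊤) :
    Function.Surjective (Φ.hmap 0 f) := by
  intro z
  obtain ⟨m, hm⟩ := hf (Φ.η N z : N)
  refine ⟨(Φ.η M).symm ⟨m, h ▸ Submodule.mem_top⟩, (Φ.η N).injective (Subtype.ext ?_)⟩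
  rw [η_hmap, LinearEquiv.apply_symm_apply, hm]

theorem subsingleton_H_of_gam_eq_top [IsNoetherianRing S] (n : ℕ) :
    ∀ (M : Type) [AddCommGroup M] [Module S M], gam J M = ⊤ → Subsingleton (Φ.H M (n + 1)) := by
  induction n with
  | zero =>
    intro M _ _ hM
    obtain ⟨Q, _, _, f, hQ, hf⟩ := exists_injective_embedding S M
    have := injective_gam J Q
    let f' : M →ₗ[S] gam J Q := f.codRestrict _ fun m => map_mem_gam f (hM ▸ Submodule.mem_top)
    have hf' : Function.Injective f' := fun a b hab => hf (congr_arg Subtype.val hab)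
    obtain ⟨κ, h1, h2⟩ := Φ.exists_connecting 0 hf' (Submodule.mkQ_surjective (LinearMap.range f'))
      (LinearMap.exact_map_mkQ_range f')
    have hs := Φ.hmap_zero_surjective (Submodule.mkQ_surjective (LinearMap.range f')) gam_gam
    have := Φ.subsingleton_H_of_injective (gam J Q) 0
    refine subsingleton_of_forall_eq 0 fun z => ?_
    obtain ⟨y, rfl⟩ := (h2 z).1 (Subsingleton.elim _ _)
    exact (h1 y).2 (hs y)
  | succ n ih =>
    intro M _ _ hM
    obtain ⟨Q, _, _, f, hQ, hf⟩ := exists_injective_embedding S M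
    have := injective_gam J Q
    let f' : M →ₗ[S] gam J Q := f.codRestrict _ fun m => map_mem_gam f (hM ▸ Submodule.mem_top)
    have hf' : Function.Injective f' := fun a b hab => hf (congr_arg Subtype.val hab)
    obtain ⟨κ, h1, h2⟩ := Φ.exists_connecting (n + 1) hf'
      (Submodule.mkQ_surjective (LinearMap.range f')) (LinearMap.exact_map_mkQ_range f')
    have := Φ.subsingleton_H_of_injective (gam J Q) (n + 1)
    have := ih (gam J Q ⧸ LinearMap.range f')
      (gam_map_eq_top _ (Submodule.mkQ_surjective _) gam_gam)
    refine subsingleton_of_forall_eq 0 fun z => ?_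
    obtain ⟨y, rfl⟩ := (h2 z).1 (Subsingleton.elim _ _)
    rw [Subsingleton.elim y 0, map_zero]

theorem gam_H_eq_top (n : ℕ) :
    ∀ (M : Type) [AddCommGroup M] [Module S M], gam J (Φ.H M n) = ⊤ := by
  induction n with
  | zero =>
    intro M _ _
    exact gam_eq_top_of_injective (Φ.η M).toLinearMap (Φ.η M).injective gam_gam
  | succ n ih =>
    intro M _ _
    obtain ⟨Q, _, _, f, hQ, hf⟩ := exists_injective_embedding S M
    obtain ⟨κ, h1, h2⟩ := Φ.exists_connecting n hf
      (Submodule.mkQ_surjective (LinearMap.range f)) (LinearMap.exact_map_mkQ_range f)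
    have := Φ.subsingleton_H_of_injective Q n
    exact gam_map_eq_top κ (fun z => (h2 z).1 (Subsingleton.elim _ _)) (ih _)

end PowRes

end

theorem isPrecomplete_pi {A : Type} [CommRing A] (I : Ideal A) [IsPrecomplete I A] (k : ℕ) :
    IsPrecomplete I (Fin k → A) := by
  refine ⟨fun f hf => ?_⟩
  have key : ∀ (n : ℕ) (v : Fin k → A), v ∈ (I ^ n • ⊤ : Submodule A (Fin k → A)) ↔
      ∀ i, v i ∈ I ^ n := by
    intro n v
    constructor
    · intro h i
      have := Submodule.mem_map_of_mem (f := LinearMap.proj (R := A) (φ := fun _ : Fin k => A) i) h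
      rw [Submodule.map_smul''] at this
      have h2 := (smul_mono_right (I ^ n) (le_top (a :=
        Submodule.map (LinearMap.proj (R := A) (φ := fun _ : Fin k => A) i) ⊤)) :) this
      simpa using h2
    · intro h
      rw [← Finset.univ_sum_single v]
      refine Submodule.sum_mem _ fun i _ => ?_
      have : (Pi.single i (v i) : Fin k → A) = v i • Pi.single i 1 := by
        rw [← Pi.single_smul, smul_eq_mul, mul_one]
      rw [this]
      exact Submodule.smul_mem_smul (h i) Submodule.mem_top
  have h1 : ∀ i, ∃ L, ∀ n, f n i ≡ L [SMOD (I ^ n • ⊤ : Submodule A A)] := fun i => by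
    refine IsPrecomplete.prec ‹_› fun {m n} hmn => ?_
    have := hf hmn
    rw [SModEq.sub_mem, key] at this
    rw [SModEq.sub_mem]
    simpa using this i
  choose L hL using h1
  refine ⟨L, fun n => ?_⟩
  rw [SModEq.sub_mem, key]
  intro i
  have := hL i n
  rw [SModEq.sub_mem] at this
  simpa using this

/-- Nakayama's lemma over a complete ring. -/
theorem fg_of_finset_of_isPrecomplete {A : Type} [CommRing A] (I : Ideal A) [IsPrecomplete I A]
    {M : Type} [AddCommGroup M] [Module A M] [IsHausdorff I M] {k : ℕ} (v : Fin k → M)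
    (h : ∀ m : M, ∃ c : Fin k → A, m - ∑ i, c i • v i ∈ (I • ⊤ : Submodule A M)) :
    ∀ m : M, ∃ c : Fin k → A, m = ∑ i, c i • v i := by
  have := isPrecomplete_pi I k
  have hs : Function.Surjective (Fintype.linearCombination A v) := by
    refine surjective_of_mkQ_comp_surjective (I := I) fun z => ?_
    obtain ⟨m, rfl⟩ := Submodule.mkQ_surjective _ z
    obtain ⟨c, hc⟩ := h m
    exact ⟨c, ((Submodule.Quotient.eq _).2 hc).symm⟩
  intro m
  obtain ⟨c, hc⟩ := hs m
  exact ⟨c, hc.symm⟩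

theorem finite_of_finite_quotient {A : Type} [CommRing A] (I : Ideal A) [IsPrecomplete I A]
    (M : Type) [AddCommGroup M] [Module A M] [IsHausdorff I M]
    [Module.Finite A (M ⧸ (I • ⊤ : Submodule A M))] : Module.Finite A M := by
  obtain ⟨k, w, hw⟩ := Module.Finite.exists_fin (R := A) (M := M ⧸ (I • ⊤ : Submodule A M))
  choose v hv using fun i => Submodule.mkQ_surjective _ (w i)
  have := fg_of_finset_of_isPrecomplete I v fun m => by
    obtain ⟨c, hc⟩ := (Submodule.mem_span_range_iff_exists_fun A).1
      (hw ▸ Submodule.mem_top : Submodule.mkQ _ m ∈ Submodule.span A (Set.range w))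
    refine ⟨c, (Submodule.Quotient.eq _).1 ?_⟩
    rw [← Submodule.mkQ_apply, ← Submodule.mkQ_apply, ← hc, map_sum]
    simp only [map_smul, hv]
  refine Module.Finite.of_surjective (Fintype.linearCombination A v) fun m => ?_
  obtain ⟨c, hc⟩ := this m
  exact ⟨c, hc.symm⟩

/-- A complete local ring with finitely generated maximal ideal is noetherian. -/
theorem isNoetherianRing_of_isAdicComplete {A : Type} [CommRing A] [IsLocalRing A]
    [IsAdicComplete (maximalIdeal A) A] (hm : (maximalIdeal A).FG) : IsNoetherianRing A := by
  by_contra hA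
  obtain ⟨P, hP⟩ : ∃ P : Ideal A, Maximal (fun I : Ideal A => ¬ I.FG) P := by
    obtain ⟨I, hI⟩ : ∃ I : Ideal A, ¬ I.FG := by
      by_contra! h
      exact hA ⟨h⟩
    have hub : ∀ C ⊆ {I : Ideal A | ¬ I.FG}, IsChain (· ≤ ·) C → ∀ J ∈ C,
        ∃ ub ∈ {I : Ideal A | ¬ I.FG}, ∀ z ∈ C, z ≤ ub := by
      intro C hC hch J hJ
      refine ⟨sSup C, fun ⟨G, hG⟩ => ?_, fun _ => le_sSup⟩
      obtain ⟨K, hKC, hGK⟩ : ∃ K ∈ C, (G : Set A) ⊆ K := by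
        refine hch.directedOn.exists_mem_subset_of_finset_subset_biUnion ⟨J, hJ⟩ fun _ hx => ?_
        simp only [Set.mem_iUnion, SetLike.mem_coe, exists_prop]
        exact (Submodule.mem_sSup_of_directed ⟨J, hJ⟩ hch.directedOn).1
          (hG ▸ Submodule.subset_span hx)
      have : K = sSup C := le_antisymm (le_sSup hKC) (hG ▸ Ideal.span_le.2 hGK)
      exact hC hKC (this ▸ ⟨G, hG⟩)
    obtain ⟨P, -, hP⟩ := zorn_le_nonempty₀ {I : Ideal A | ¬ I.FG} hub I hI
    exact ⟨P, hP⟩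
  have hprime := Ideal.isOka_fg.isPrime_of_maximal_not hP
  have hle := le_maximalIdeal hprime.ne_top
  obtain ⟨a, ham, haP⟩ : ∃ a ∈ maximalIdeal A, a ∉ P := by
    by_contra! h
    exact hP.prop (le_antisymm hle h ▸ hm)
  have hfg : (P ⊔ Ideal.span {a}).FG :=
    of_not_not <| hP.not_prop_of_gt (Submodule.lt_sup_iff_notMem.2 haP)
  obtain ⟨k, w, hw⟩ := Submodule.fg_iff_exists_fin_generating_family.1 hfg
  have hw' : ∀ i, ∃ p ∈ P, ∃ b : A, w i = p + b * a := fun i => by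
    obtain ⟨p, hp, q, hq, h⟩ := Submodule.mem_sup.1
      (hw ▸ Submodule.subset_span ⟨i, rfl⟩ : w i ∈ P ⊔ Ideal.span {a})
    obtain ⟨b, rfl⟩ := Ideal.mem_span_singleton'.1 hq
    exact ⟨p, hp, b, h.symm⟩
  choose p hp b hb using hw'
  have : IsHausdorff (maximalIdeal A) P := ⟨fun x hx => Subtype.ext <|
    IsHausdorff.haus (inferInstance : IsHausdorff (maximalIdeal A) A) _ fun n => by
      have := hx n
      rw [SModEq.zero] at this ⊢
      have h2 := Submodule.mem_map_of_mem (f := P.subtype) this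
      rw [Submodule.map_smul''] at h2
      exact (smul_mono_right (maximalIdeal A ^ n) (le_top (a := Submodule.map P.subtype ⊤)) :) h2⟩
  have key := fg_of_finset_of_isPrecomplete (maximalIdeal A) (M := P) (fun i => ⟨p i, hp i⟩)
    fun m => by
      obtain ⟨c, hc⟩ := (Submodule.mem_span_range_iff_exists_fun A).1
        (hw ▸ (le_sup_left : P ≤ P ⊔ Ideal.span {a}) m.2 : (m : A) ∈ Submodule.span A (Set.range w))
      refine ⟨c, ?_⟩
      have h1 : (∑ i, c i * b i) * a ∈ P := by
        have : (∑ i, c i * b i) * a = m - ∑ i, c i * p i := by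
          rw [← hc, Finset.sum_mul, ← Finset.sum_sub_distrib]
          refine Finset.sum_congr rfl fun i _ => ?_
          rw [hb i, smul_eq_mul]; ring
        rw [this]
        exact sub_mem m.2 (sum_mem fun i _ => Ideal.mul_mem_left _ _ (hp i))
      have h2 := (hprime.mem_or_mem h1).resolve_right haP
      have h3 : m - ∑ i, c i • (⟨p i, hp i⟩ : P) = a • (⟨_, h2⟩ : P) := by
        refine Subtype.ext ?_
        simp only [Submodule.coe_sub, Submodule.coe_sum, Submodule.coe_smul, smul_eq_mul]
        rw [← hc, mul_comm a, Finset.sum_mul, ← Finset.sum_sub_distrib]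
        refine Finset.sum_congr rfl fun i _ => ?_
        rw [hb i, smul_eq_mul]; ring
      rw [h3]
      exact Submodule.smul_mem_smul ham Submodule.mem_top
  refine hP.prop (Submodule.fg_iff_exists_fin_generating_family.2 ⟨k, p, le_antisymm ?_ ?_⟩)
  · exact Submodule.span_le.2 (by rintro _ ⟨i, rfl⟩; exact hp i)
  · intro y hy
    obtain ⟨c, hc⟩ := key ⟨y, hy⟩
    refine (Submodule.mem_span_range_iff_exists_fun A).2 ⟨c, ?_⟩
    have := congr_arg Subtype.val hc
    simpa using this.symm

theorem isNoetherianRing_cmpl (R : Type) [CommRing R] [IsNoetherianRing R] [IsLocalRing R] :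
    IsNoetherianRing (Cmpl R) :=
  isNoetherianRing_of_isAdicComplete (by
    rw [AdicCompletion.maximalIdeal_eq_map]
    exact (maximalIdeal R).fg_of_isNoetherianRing.map _)

section Prelim

variable {A : Type} [CommRing A] {M : Type} [AddCommGroup M] [Module A M]

/-- Prime avoidance for finite sets of primes. -/
theorem exists_mem_forall_notMem {I : Ideal A} {s : Set (Ideal A)} (hs : s.Finite)
    (hp : ∀ p ∈ s, p.IsPrime) (h : ∀ p ∈ s, ¬ I ≤ p) : ∃ a ∈ I, ∀ p ∈ s, a ∉ p := by
  by_contra! hc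
  have : (I : Set A) ⊆ ⋃ p ∈ (hs.toFinset : Set (Ideal A)), (p : Set A) := fun a ha => by
    obtain ⟨p, hps, hap⟩ := hc a ha
    exact Set.mem_biUnion (by simpa using hps) hap
  obtain ⟨p, hps, hIp⟩ := (Ideal.subset_union_prime (f := id) ⊥ ⊥
    (fun p hps _ _ => hp p (by simpa using hps))).1 this
  exact h p (by simpa using hps) hIp

theorem isSMulRegular_of_forall_notMem [IsNoetherianRing A] {a : A}
    (h : ∀ p ∈ associatedPrimes A M, a ∉ p) : IsSMulRegular M a := by
  refine (injective_iff_map_eq_zero (LinearMap.lsmul A M a)).2 fun x hx => ?_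
  by_contra hx0
  have : a ∈ ⋃ p ∈ associatedPrimes A M, (p : Set A) := by
    rw [biUnion_associatedPrimes_eq_zero_divisors]
    exact ⟨x, hx0, hx⟩
  obtain ⟨p, hp, hap⟩ := Set.mem_iUnion₂.1 this
  exact h p hp hap

theorem smul_exact (a : A) :
    Function.Exact (LinearMap.lsmul A M a) (a • (⊤ : Submodule A M)).mkQ := by
  intro x
  rw [Submodule.mkQ_apply, Submodule.Quotient.mk_eq_zero, Submodule.mem_smul_pointwise_iff_exists]
  simp

theorem exists_notMem_of_gam_eq_bot [IsNoetherianRing A] [Module.Finite A M] {J : Ideal A}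
    (h : gam J M = ⊥) : ∃ a ∈ J, ∀ p ∈ associatedPrimes A M, a ∉ p := by
  refine exists_mem_forall_notMem (associatedPrimes.finite A M)
    (fun p hp => IsAssociatedPrime.isPrime hp) fun p hp hle => ?_
  obtain ⟨hpr, x, rfl⟩ := isAssociatedPrime_iff.1 hp
  have hx : x ∈ gam J M := mem_gam.2 ⟨1, fun r hr => by
    rw [pow_one] at hr
    simpa using hle hr⟩
  rw [h, Submodule.mem_bot] at hx
  subst hx
  exact hpr.ne_top (by ext; simp)

theorem gam_quotient_gam [IsNoetherianRing A] [Module.Finite A M] {J : Ideal A} :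
    gam J (M ⧸ gam J M) = ⊥ := by
  refine eq_bot_iff.2 fun z hz => ?_
  obtain ⟨m, rfl⟩ := Submodule.mkQ_surjective _ z
  obtain ⟨t, ht⟩ := mem_gam.1 hz
  obtain ⟨s, hs⟩ := exists_pow_smul_eq_zero_of_fg (IsNoetherian.noetherian (gam J M)) le_rfl
  rw [Submodule.mem_bot, Submodule.mkQ_apply, Submodule.Quotient.mk_eq_zero]
  refine mem_gam.2 ⟨s + t, fun r hr => ?_⟩
  rw [pow_add] at hr
  refine Submodule.mul_induction_on hr (fun a ha b hb => ?_) fun a b ha hb => by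
    rw [add_smul, ha, hb, add_zero]
  rw [mul_smul]
  refine hs a ha _ ?_
  have := ht b hb
  rwa [← map_smul, Submodule.mkQ_apply, Submodule.Quotient.mk_eq_zero] at this

end Prelim

namespace PowRes

variable {S : Type} [CommRing S] {J : Ideal S} (Φ : PowRes S J)
variable {M : Type} [AddCommGroup M] [Module S M]

theorem hmap_lsmul (n : ℕ) (a : S) (z : Φ.H M n) : Φ.hmap n (LinearMap.lsmul S M a) z = a • z := by
  have : LinearMap.lsmul S M a = a • LinearMap.id := by ext; simp
  rw [this, hmap_smul, hmap_id]
  rfl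

/-- The long exact sequence of a regular element. -/
theorem exists_connecting_smul (n : ℕ) {a : S} (ha : IsSMulRegular M a) :
    (∀ z : Φ.H M n, Φ.hmap n (a • (⊤ : Submodule S M)).mkQ z = 0 ↔ ∃ y, a • y = z) ∧
    ∃ κ : Φ.H (M ⧸ a • (⊤ : Submodule S M)) n →ₗ[S] Φ.H M (n + 1),
      (∀ z, κ z = 0 ↔ ∃ y, Φ.hmap n (a • (⊤ : Submodule S M)).mkQ y = z) ∧
      ∀ z, a • z = 0 ↔ ∃ y, κ y = z := by
  have hi : Function.Injective (LinearMap.lsmul S M a) := ha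
  obtain ⟨κ, h1, h2⟩ := Φ.exists_connecting n hi (Submodule.mkQ_surjective _) (smul_exact a)
  refine ⟨fun z => ?_, κ, fun z => h1 z, fun z => ?_⟩
  · refine (Φ.hmap_exact n hi (Submodule.mkQ_surjective _) (smul_exact a) z).trans ?_
    simp only [Set.mem_range, hmap_lsmul]
  · rw [← hmap_lsmul]
    exact h2 z

theorem hmap_mkQ_gam_injective [IsNoetherianRing S] (n : ℕ) :
    Function.Injective (Φ.hmap (n + 1) (gam J M).mkQ) := by
  have := Φ.subsingleton_H_of_gam_eq_top n (gam J M) gam_gam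
  refine (injective_iff_map_eq_zero _).2 fun z hz => ?_
  obtain ⟨y, rfl⟩ := (Φ.hmap_exact (n + 1) (gam J M).injective_subtype (gam J M).mkQ_surjective
    (LinearMap.exact_subtype_mkQ _) z).1 hz
  rw [Subsingleton.elim y 0, map_zero]

theorem hmap_mkQ_gam_surjective [IsNoetherianRing S] (n : ℕ) :
    Function.Surjective (Φ.hmap n (gam J M).mkQ) := by
  have := Φ.subsingleton_H_of_gam_eq_top n (gam J M) gam_gam
  obtain ⟨κ, h1, h2⟩ := Φ.exists_connecting n (gam J M).injective_subtype (gam J M).mkQ_surjective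
    (LinearMap.exact_subtype_mkQ _)
  exact fun z => (h1 z).1 (Subsingleton.elim _ _)

end PowRes

section Matlis

variable {A : Type} [CommRing A] [IsLocalRing A] {E : Type} [AddCommGroup E] [Module A E]
variable {X : Type} [AddCommGroup X] [Module A X]
variable {Y : Type} [AddCommGroup Y] [Module A Y]

namespace IsInjHull

variable (hE : IsInjHull A (maximalIdeal A) E)
include hE

theorem exists_comp_eq (f : X →ₗ[A] Y) (φ : X →ₗ[A] E) (h : LinearMap.ker f ≤ LinearMap.ker φ) :
    ∃ ψ : Y →ₗ[A] E, ψ ∘ₗ f = φ := by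
  obtain ⟨γ, hγ⟩ := exists_comp_eq_of_ker_le f.rangeRestrict φ f.surjective_rangeRestrict
    (by rwa [LinearMap.ker_rangeRestrict])
  have := hE.1
  obtain ⟨ψ, hψ⟩ := Module.Injective.out (LinearMap.range f).subtype Subtype.val_injective γ
  exact ⟨ψ, LinearMap.ext fun x => (hψ (f.rangeRestrict x)).trans (hγ x)⟩

theorem exists_apply_ne_zero {x : X} (hx : x ≠ 0) : ∃ φ : X →ₗ[A] E, φ x ≠ 0 := by
  obtain ⟨-, f, hf, -⟩ := id hE
  obtain ⟨ψ, hψ⟩ := hE.exists_comp_eq (LinearMap.toSpanSingleton A X x)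
    (f ∘ₗ (maximalIdeal A).mkQ) (fun a ha => by
      have ha' : a • x = 0 := ha
      have : a ∈ maximalIdeal A := fun hu => hx (hu.smul_eq_zero.1 ha')
      rw [LinearMap.mem_ker, LinearMap.comp_apply, Submodule.mkQ_apply,
        (Submodule.Quotient.mk_eq_zero _).2 this, map_zero])
  refine ⟨ψ, fun h => ?_⟩
  have h1 := LinearMap.congr_fun hψ 1
  rw [LinearMap.comp_apply, LinearMap.toSpanSingleton_apply, one_smul, h] at h1
  have h2 : (maximalIdeal A).mkQ 1 = 0 := hf (h1.symm.trans (map_zero f).symm)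
  rw [Submodule.mkQ_apply, Submodule.Quotient.mk_eq_zero] at h2
  exact (maximalIdeal.isMaximal A).ne_top ((Ideal.eq_top_iff_one _).2 h2)

theorem injective_of_lcomp_surjective (f : X →ₗ[A] Y)
    (h : ∀ φ : X →ₗ[A] E, ∃ ψ : Y →ₗ[A] E, ψ ∘ₗ f = φ) : Function.Injective f := by
  refine (injective_iff_map_eq_zero _).2 fun x hx => ?_
  by_contra h0
  obtain ⟨φ, hφ⟩ := hE.exists_apply_ne_zero h0
  obtain ⟨ψ, rfl⟩ := h φ
  exact hφ (by rw [LinearMap.comp_apply, hx, map_zero])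

theorem finite_dual_of_injective (f : X →ₗ[A] Y) (hf : Function.Injective f)
    [Module.Finite A (Y →ₗ[A] E)] : Module.Finite A (X →ₗ[A] E) :=
  Module.Finite.of_surjective (LinearMap.lcomp A E f) fun φ =>
    hE.exists_comp_eq f φ (by rw [LinearMap.ker_eq_bot.2 hf]; exact bot_le)

omit [IsLocalRing A] hE in
theorem finite_dual_of_surjective [IsNoetherianRing A] (f : X →ₗ[A] Y)
    (hf : Function.Surjective f) [Module.Finite A (X →ₗ[A] E)] : Module.Finite A (Y →ₗ[A] E) :=
  Module.Finite.of_injective (LinearMap.lcomp A E f) fun φ ψ h =>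
    LinearMap.ext fun y => by
      obtain ⟨x, rfl⟩ := hf y
      exact LinearMap.congr_fun h x

omit hE in
/-- Elements of `E` killed by the maximal ideal form a finite module. -/
theorem mem_range_of_smul_eq_zero (f : (A ⧸ maximalIdeal A) →ₗ[A] E)
    (hf : ∀ N : Submodule A E, N ≠ ⊥ → N ⊓ LinearMap.range f ≠ ⊥) {e : E}
    (he : ∀ r ∈ maximalIdeal A, r • e = 0) : e ∈ LinearMap.range f := by
  by_cases h0 : e = 0
  · rw [h0]; exact zero_mem _
  obtain ⟨z, ⟨hz1, hz2⟩, hz0⟩ := Submodule.exists_mem_ne_zero_of_ne_bot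
    (hf (Submodule.span A {e}) (by simpa using h0))
  obtain ⟨a, rfl⟩ := Submodule.mem_span_singleton.1 hz1
  have ha : IsUnit a := by
    by_contra h
    exact hz0 (he a h)
  obtain ⟨u, rfl⟩ := ha
  have := Submodule.smul_mem _ ((u⁻¹ : Aˣ) : A) hz2
  rwa [smul_smul, Units.inv_mul, one_smul] at this

theorem finite_dual_of_socle [IsNoetherianRing A] [Module.Finite A X]
    (hX : ∀ r ∈ maximalIdeal A, ∀ x : X, r • x = 0) : Module.Finite A (X →ₗ[A] E) := by
  obtain ⟨-, f, -, hf⟩ := id hE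
  obtain ⟨k, v, hv⟩ := Module.Finite.exists_fin (R := A) (M := X)
  have hm : ∀ (φ : X →ₗ[A] E) (x : X), φ x ∈ LinearMap.range f := fun φ x =>
    mem_range_of_smul_eq_zero f hf fun r hr => by rw [← map_smul, hX r hr, map_zero]
  let g : (X →ₗ[A] E) →ₗ[A] (Fin k → LinearMap.range f) :=
    { toFun := fun φ i => ⟨φ (v i), hm φ _⟩
      map_add' := fun _ _ => rfl
      map_smul' := fun _ _ => rfl }
  refine Module.Finite.of_injective g fun φ ψ h => ?_
  refine LinearMap.ext_on hv ?_
  rintro _ ⟨i, rfl⟩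
  exact congr_arg Subtype.val (congr_fun h i)

omit hE in
theorem isHausdorff_dual (hX : gam (maximalIdeal A) X = ⊤) :
    IsHausdorff (maximalIdeal A) (X →ₗ[A] E) := by
  refine ⟨fun φ hφ => LinearMap.ext fun x => ?_⟩
  obtain ⟨t, ht⟩ := mem_gam.1 (hX ▸ Submodule.mem_top : x ∈ gam (maximalIdeal A) X)
  have := hφ t
  rw [SModEq.zero] at this
  have hle : (maximalIdeal A ^ t • ⊤ : Submodule A (X →ₗ[A] E)) ≤
      LinearMap.ker (LinearMap.applyₗ (R := A) (M₂ := E) x) :=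
    Submodule.smul_le.2 fun r hr ψ _ => by
      rw [LinearMap.mem_ker, map_smul, LinearMap.applyₗ_apply_apply, ← map_smul, ht r hr, map_zero]
  exact hle this

theorem finite_dual_of_colon [IsAdicComplete (maximalIdeal A) A]
    (hX : gam (maximalIdeal A) X = ⊤) {k : ℕ} (a : Fin k → A) (ha : ∀ i, a i ∈ maximalIdeal A)
    (U : Submodule A X) (hU : ∀ x, (∀ i, a i • x = 0) → x ∈ U)
    [Module.Finite A (U →ₗ[A] E)] : Module.Finite A (X →ₗ[A] E) := by
  have := isHausdorff_dual (E := E) hX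
  obtain ⟨γ, hγ⟩ := exists_comp_eq_of_ker_le (LinearMap.lcomp A E U.subtype)
    (maximalIdeal A • ⊤ : Submodule A (X →ₗ[A] E)).mkQ
    (fun φ => hE.exists_comp_eq U.subtype φ (by rw [Submodule.ker_subtype]; exact bot_le))
    (fun φ hφ => by
      rw [Submodule.ker_mkQ]
      obtain ⟨ψ, hψ⟩ := hE.exists_comp_eq (LinearMap.pi fun i => LinearMap.lsmul A X (a i)) φ
        (fun x hx => by
          have hx' : x ∈ U := hU x fun i => congr_fun (LinearMap.mem_ker.1 hx) i
          exact LinearMap.congr_fun (LinearMap.mem_ker.1 hφ) ⟨x, hx'⟩)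
      have : φ = ∑ i, a i • (ψ ∘ₗ LinearMap.single A (fun _ : Fin k => X) i) := by
        rw [← hψ]
        refine LinearMap.ext fun x => ?_
        simp only [LinearMap.comp_apply, LinearMap.sum_apply, LinearMap.smul_apply]
        rw [← Finset.univ_sum_single ((LinearMap.pi fun i => LinearMap.lsmul A X (a i)) x), map_sum]
        refine Finset.sum_congr rfl fun i _ => ?_
        rw [← map_smul, LinearMap.coe_single, ← Pi.single_smul]
        rfl
      rw [this]
      exact Submodule.sum_mem _ fun i _ => Submodule.smul_mem_smul (ha i) Submodule.mem_top)
  have : Module.Finite A ((X →ₗ[A] E) ⧸ (maximalIdeal A • ⊤ : Submodule A (X →ₗ[A] E))) :=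
    Module.Finite.of_surjective γ fun z => by
      obtain ⟨φ, rfl⟩ := Submodule.mkQ_surjective _ z
      exact ⟨_, hγ φ⟩
  exact finite_of_finite_quotient (maximalIdeal A) _

/-- The Matlis duals of local cohomology modules of finite modules are finite. -/
theorem finite_dual_H [IsNoetherianRing A] [IsAdicComplete (maximalIdeal A) A]
    (Φ : PowRes A (maximalIdeal A)) (n : ℕ) : ∀ (M : Type) [AddCommGroup M] [Module A M]
    [Module.Finite A M], Module.Finite A (Φ.H M n →ₗ[A] E) := by
  induction n with
  | zero =>
    intro M _ _ _
    have : Module.Finite A (gam (maximalIdeal A) M →ₗ[A] E) := by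
      obtain ⟨k, a, ha⟩ := Submodule.fg_iff_exists_fin_generating_family.1
        (maximalIdeal A).fg_of_isNoetherianRing
      let U : Submodule A (gam (maximalIdeal A) M) :=
        LinearMap.ker (LinearMap.pi fun i => LinearMap.lsmul A (gam (maximalIdeal A) M) (a i))
      have hU : ∀ x, x ∈ U ↔ ∀ i, a i • x = 0 := fun x => by
        rw [LinearMap.mem_ker]; exact funext_iff
      have : Module.Finite A (U →ₗ[A] E) := hE.finite_dual_of_socle fun r hr x => by
        have hle : maximalIdeal A ≤ LinearMap.ker (LinearMap.toSpanSingleton A U x) := by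
          refine ha.symm.le.trans (Submodule.span_le.2 ?_)
          rintro _ ⟨i, rfl⟩
          exact Subtype.ext ((hU x).1 x.2 i)
        exact hle hr
      exact hE.finite_dual_of_colon gam_gam a
        (fun i => ha ▸ Submodule.subset_span ⟨i, rfl⟩) U fun x hx => (hU x).2 hx
    exact hE.finite_dual_of_injective (Φ.η M).toLinearMap (Φ.η M).injective
  | succ n ih =>
    intro M _ _ _
    obtain ⟨a, ham, hap⟩ := exists_notMem_of_gam_eq_bot (gam_quotient_gam (J := maximalIdeal A) (M := M))
    have hreg := isSMulRegular_of_forall_notMem hap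
    have key : Module.Finite A (Φ.H (M ⧸ gam (maximalIdeal A) M) (n + 1) →ₗ[A] E) := by
      obtain ⟨-, κ, -, h2⟩ := Φ.exists_connecting_smul n hreg
      have := ih ((M ⧸ gam (maximalIdeal A) M) ⧸ a • (⊤ : Submodule A (M ⧸ gam (maximalIdeal A) M)))
      have : Module.Finite A (LinearMap.range κ →ₗ[A] E) :=
        finite_dual_of_surjective κ.rangeRestrict κ.surjective_rangeRestrict
      exact hE.finite_dual_of_colon (Φ.gam_H_eq_top _ _) (fun _ : Fin 1 => a) (fun _ => ham)
        (LinearMap.range κ) fun x hx => (h2 x).1 (hx 0)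
    exact hE.finite_dual_of_injective _ (Φ.hmap_mkQ_gam_injective n)

end IsInjHull

end Matlis

section Dimension

variable {A : Type} [CommRing A] [IsNoetherianRing A] [IsLocalRing A]

/-- The dimension of `A ⧸ p`, as a natural number. -/
noncomputable def ch (p : PrimeSpectrum A) : ℕ := (Order.coheight p).toNat

theorem coe_ch (p : PrimeSpectrum A) : (ch p : ℕ∞) = Order.coheight p := by
  refine ENat.natCast_toNat fun h => ?_
  have h1 := Order.coheight_le_krullDim p
  rw [h] at h1
  exact (ringKrullDim_lt_top (R := A)).ne (top_le_iff.1 h1)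

theorem ch_lt {p q : PrimeSpectrum A} (h : p < q) : ch q < ch p := by
  have := Order.coheight_add_one_le h
  rw [← coe_ch, ← coe_ch] at this
  exact_mod_cast this

theorem ch_le {p q : PrimeSpectrum A} (h : p ≤ q) : ch q ≤ ch p := by
  rcases h.eq_or_lt with rfl | h
  exacts [le_rfl, (ch_lt h).le]

theorem ch_pos {p : PrimeSpectrum A} (h : ¬ maximalIdeal A ≤ p.asIdeal) : 0 < ch p := by
  have : p < closedPoint A := lt_of_le_of_ne (le_maximalIdeal p.2.ne_top) fun h' =>
    h (by rw [h']; exact le_rfl)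
  exact (Nat.zero_le _).trans_lt (ch_lt this)

theorem ch_eq_zero {p : PrimeSpectrum A} (h : maximalIdeal A ≤ p.asIdeal) : ch p = 0 := by
  have hp : p = closedPoint A := PrimeSpectrum.ext
    (le_antisymm (le_maximalIdeal p.2.ne_top) h)
  have : Order.coheight p = 0 := Order.coheight_eq_zero.2 (by
    rw [hp]; exact fun q _ => le_maximalIdeal q.2.ne_top)
  exact_mod_cast (coe_ch p).trans this

theorem ch_coe_le_ringKrullDim (p : PrimeSpectrum A) : ((ch p : ℕ∞) : WithBot ℕ∞) ≤ ringKrullDim A := by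
  rw [coe_ch]; exact Order.coheight_le_krullDim p

theorem exists_mem_of_ch {a : A} (ha : a ∈ maximalIdeal A) (p : PrimeSpectrum A) :
    ∃ q, p ≤ q ∧ a ∈ q.asIdeal ∧ ch p ≤ ch q + 1 := by
  obtain ⟨s, hs, hl⟩ := Order.exists_series_of_coheight_eq_coe p (coe_ch p).symm
  have hlast : a ∈ s.last.asIdeal := by
    by_contra h
    have hlt : s.last < closedPoint A := lt_of_le_of_ne (le_maximalIdeal s.last.2.ne_top)
      fun h' => h (by rw [h']; exact ha)
    have h2 : ((s.snoc _ hlt).length : ℕ∞) ≤ Order.coheight p :=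
      Order.length_le_coheight (by rw [RelSeries.head_snoc, hs])
    rw [← coe_ch, RelSeries.snoc_length, hl] at h2
    exact absurd h2 (by exact_mod_cast Nat.not_succ_le_self _)
  rcases Nat.eq_zero_or_pos (ch p) with h0 | h0
  · exact ⟨closedPoint A, le_maximalIdeal p.2.ne_top, ha, by omega⟩
  obtain ⟨t, ht, htl, hth, -⟩ := PrimeSpectrum.exist_ltSeries_mem_one_of_mem_last s hlast
  have htp : 0 < t.length := by omega
  have hone : (1 : Fin (t.length + 1)).val = 1 := by
    rw [Fin.val_one']; exact Nat.mod_eq_of_lt (by omega)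
  refine ⟨t 1, ?_, ht, ?_⟩
  · rw [← hs, hth]
    exact t.monotone (Fin.zero_le _)
  · have h1 := Order.length_le_coheight (p := t.drop 1) (x := t 1) (by
      rw [RelSeries.head_drop])
    rw [← coe_ch, RelSeries.drop_length, hone] at h1
    have : t.length - 1 ≤ ch (t 1) := by exact_mod_cast h1
    omega

/-- `DimLE A M k n` says `dim M + k ≤ n`. -/
def DimLE (A : Type) [CommRing A] (M : Type) [AddCommGroup M] [Module A M] (k n : ℕ) : Prop :=
  ∀ p ∈ Module.support A M, ch p + k ≤ n

variable {M : Type} [AddCommGroup M] [Module A M] {N : Type} [AddCommGroup N] [Module A N]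

omit [IsNoetherianRing A] [IsLocalRing A] in
theorem DimLE.of_injective {k n : ℕ} (h : DimLE A M k n) (f : N →ₗ[A] M)
    (hf : Function.Injective f) : DimLE A N k n :=
  fun p hp => h p (Module.support_subset_of_injective f hf hp)

omit [IsNoetherianRing A] [IsLocalRing A] in
theorem DimLE.of_surjective {k n : ℕ} (h : DimLE A M k n) (f : M →ₗ[A] N)
    (hf : Function.Surjective f) : DimLE A N k n :=
  fun p hp => h p (Module.support_subset_of_surjective f hf hp)

omit [IsNoetherianRing A] [IsLocalRing A] in
theorem DimLE.mono {k n k' n' : ℕ} (h : DimLE A M k n) (h' : n + k' ≤ n' + k) : DimLE A M k' n' :=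
  fun p hp => by have := h p hp; omega

omit [IsNoetherianRing A] [IsLocalRing A] in
theorem mem_support_quotient [Module.Finite A M] {a : A} {p : PrimeSpectrum A} :
    p ∈ Module.support A (M ⧸ a • (⊤ : Submodule A M)) ↔ p ∈ Module.support A M ∧ a ∈ p.asIdeal := by
  rw [show Module.support A (M ⧸ a • (⊤ : Submodule A M)) = _ from Module.support_quotSMulTop a]
  simp [PrimeSpectrum.mem_zeroLocus]

omit [IsNoetherianRing A] [IsLocalRing A] in
theorem DimLE.quotient [Module.Finite A M] {k n : ℕ} (h : DimLE A M k n) {a : A}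
    (ha : ∀ p ∈ Module.support A M, ch p + k = n → a ∉ p.asIdeal) :
    DimLE A (M ⧸ a • (⊤ : Submodule A M)) (k + 1) n := fun p hp => by
  obtain ⟨h1, h2⟩ := mem_support_quotient.1 hp
  have := h p h1
  have h3 : ch p + k ≠ n := fun h3 => ha p h1 h3 h2
  omega

theorem mem_associatedPrimes_of_maximal [Module.Finite A M] {k n : ℕ} (h : DimLE A M k n)
    {p : PrimeSpectrum A} (hp : p ∈ Module.support A M) (hpn : ch p + k = n) :
    p.asIdeal ∈ associatedPrimes A M := by
  refine Module.associatedPrimes.minimalPrimes_annihilator_subset_associatedPrimes A M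
    ⟨⟨p.2, Module.annihilator_le_of_mem_support hp⟩, fun q hq hqp => ?_⟩
  by_contra hne
  have hq' : (⟨q, hq.1⟩ : PrimeSpectrum A) ∈ Module.support A M :=
    Module.mem_support_iff_of_finite.2 hq.2
  have h1 := h _ hq'
  have h2 : ch p < ch ⟨q, hq.1⟩ := ch_lt (lt_of_le_not_ge hqp hne)
  omega

theorem DimLE.quotient_of_isSMulRegular [Module.Finite A M] {k n : ℕ} (h : DimLE A M k n) {a : A}
    (ha : ∀ p ∈ associatedPrimes A M, a ∉ p) :
    DimLE A (M ⧸ a • (⊤ : Submodule A M)) (k + 1) n :=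
  h.quotient fun _ hp hpn => ha _ (mem_associatedPrimes_of_maximal h hp hpn)

theorem DimLE.exists_quotient [Module.Finite A M] {k n : ℕ} (h : DimLE A M k n) {I : Ideal A}
    (hI : ∀ p ∈ Module.support A M, ch p + k = n → ¬ I ≤ p.asIdeal) :
    ∃ a ∈ I, DimLE A (M ⧸ a • (⊤ : Submodule A M)) (k + 1) n := by
  have hfin : {q ∈ associatedPrimes A M | ¬ I ≤ q}.Finite :=
    (associatedPrimes.finite A M).subset fun _ h => h.1
  obtain ⟨a, ha, hap⟩ := exists_mem_forall_notMem hfin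
    (fun p hp => IsAssociatedPrime.isPrime hp.1) (fun p hp => hp.2)
  exact ⟨a, ha, h.quotient fun p hp hpn =>
    hap _ ⟨mem_associatedPrimes_of_maximal h hp hpn, hI p hp hpn⟩⟩

theorem DimLE.of_quotient [Module.Finite A M] {k n : ℕ} {a : A} (ha : a ∈ maximalIdeal A)
    (h : DimLE A (M ⧸ a • (⊤ : Submodule A M)) (k + 1) n) : DimLE A M k n := fun p hp => by
  obtain ⟨q, hpq, haq, hq⟩ := exists_mem_of_ch ha p
  have := h q (mem_support_quotient.2 ⟨Module.mem_support_mono hpq hp, haq⟩)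
  omega

theorem ch_eq_zero_of_gam (h : gam (maximalIdeal A) M = ⊤) {p : PrimeSpectrum A}
    (hp : p ∈ Module.support A M) : ch p = 0 := by
  obtain ⟨x, hx⟩ := Module.mem_support_iff_exists_annihilator.1 hp
  obtain ⟨t, ht⟩ := mem_gam.1 (h ▸ Submodule.mem_top : x ∈ gam (maximalIdeal A) M)
  refine ch_eq_zero (p.2.le_of_pow_le (n := t) fun r hr => hx ?_)
  exact (Submodule.mem_annihilator_span_singleton x r).2 (ht r hr)

omit [IsNoetherianRing A] [IsLocalRing A] in
theorem subsingleton_of_dimLE {k n : ℕ} (h : DimLE A M k n) (hkn : n < k) : Subsingleton M := by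
  rw [← Module.support_eq_empty_iff (R := A)]
  refine Set.eq_empty_of_forall_notMem fun p hp => ?_
  have := h p hp
  omega

end Dimension

section Dual

variable {A : Type} [CommRing A] {E : Type} [AddCommGroup E] [Module A E]
variable {X : Type} [AddCommGroup X] [Module A X]
variable {Y : Type} [AddCommGroup Y] [Module A Y]

theorem isSMulRegular_dual {a : A} (h : ∀ x : X, ∃ y, a • y = x) :
    IsSMulRegular (X →ₗ[A] E) a := by
  intro φ ψ hφ
  refine LinearMap.ext fun x => ?_
  obtain ⟨y, rfl⟩ := h x
  rw [map_smul, map_smul]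
  exact LinearMap.congr_fun hφ y

variable [IsLocalRing A] (hE : IsInjHull A (maximalIdeal A) E)
include hE

theorem IsInjHull.isSMulRegular_of_dual {a : A} (h : ∀ φ : X →ₗ[A] E, ∃ ψ, a • ψ = φ) :
    IsSMulRegular X a :=
  hE.injective_of_lcomp_surjective (LinearMap.lsmul A X a) fun φ => by
    obtain ⟨ψ, rfl⟩ := h φ
    exact ⟨ψ, by ext; simp⟩

theorem IsInjHull.exists_smul_eq {a : A} (h : IsSMulRegular X a) (φ : X →ₗ[A] E) :
    ∃ ψ, a • ψ = φ := by
  obtain ⟨ψ, hψ⟩ := hE.exists_comp_eq (LinearMap.lsmul A X a) φ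
    (by rw [LinearMap.ker_eq_bot.2 (show Function.Injective (LinearMap.lsmul A X a) from h)]; exact bot_le)
  exact ⟨ψ, by rw [← hψ]; ext; simp⟩

theorem IsInjHull.exists_injective_quotient {a : A} (κ : X →ₗ[A] Y)
    (hκ : ∀ z, a • z = 0 ↔ ∃ y, κ y = z) :
    ∃ g : ((Y →ₗ[A] E) ⧸ a • (⊤ : Submodule A (Y →ₗ[A] E))) →ₗ[A] (X →ₗ[A] E),
      Function.Injective g ∧ ∀ φ, g ((a • (⊤ : Submodule A (Y →ₗ[A] E))).mkQ φ) = φ ∘ₗ κ := by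
  refine ⟨(a • (⊤ : Submodule A (Y →ₗ[A] E))).liftQ (LinearMap.lcomp A E κ) ?_, ?_, fun φ => rfl⟩
  · rintro _ ⟨φ, -, rfl⟩
    refine LinearMap.mem_ker.2 (LinearMap.ext fun x => ?_)
    exact (map_smul φ a (κ x)).symm.trans ((congr_arg φ ((hκ _).2 ⟨x, rfl⟩)).trans (map_zero φ))
  · rw [← LinearMap.ker_eq_bot, Submodule.ker_liftQ_eq_bot']
    refine le_antisymm ?_ fun φ hφ => ?_
    · rintro _ ⟨φ, -, rfl⟩
      refine LinearMap.mem_ker.2 (LinearMap.ext fun x => ?_)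
      exact (map_smul φ a (κ x)).symm.trans ((congr_arg φ ((hκ _).2 ⟨x, rfl⟩)).trans (map_zero φ))
    · obtain ⟨ψ, hψ⟩ := hE.exists_comp_eq (LinearMap.lsmul A Y a) φ (fun y hy => by
        obtain ⟨x, rfl⟩ := (hκ y).1 hy
        exact LinearMap.congr_fun (LinearMap.mem_ker.1 hφ) x)
      rw [Submodule.mem_smul_pointwise_iff_exists]
      exact ⟨ψ, trivial, by rw [← hψ]; ext; simp⟩

end Dual

section Vanishing

variable {A : Type} [CommRing A] [IsNoetherianRing A] [IsLocalRing A]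
variable (Φ : PowRes A (maximalIdeal A))

namespace PowRes

omit [IsNoetherianRing A] in
theorem subsingleton_H (n : ℕ) (M : Type) [AddCommGroup M] [Module A M] [h : Subsingleton M] :
    Subsingleton (Φ.H M n) := by
  refine subsingleton_of_forall_eq 0 fun z => ?_
  have : (LinearMap.id : M →ₗ[A] M) = (0 : A) • LinearMap.id :=
    LinearMap.ext fun _ => Subsingleton.elim _ _
  have hz : Φ.hmap n (LinearMap.id : M →ₗ[A] M) z = z := by rw [hmap_id]; rfl
  rw [← hz, this, Φ.hmap_smul, zero_smul, LinearMap.zero_apply]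

theorem subsingleton_H_of_dimLE (n : ℕ) : ∀ (M : Type) [AddCommGroup M] [Module A M]
    [Module.Finite A M], DimLE A M 1 n → ∀ i, n ≤ i → Subsingleton (Φ.H M i) := by
  induction n with
  | zero =>
    intro M _ _ _ h i _
    have := subsingleton_of_dimLE h Nat.zero_lt_one
    exact Φ.subsingleton_H i M
  | succ n ih =>
    intro M _ _ _ h i hi
    obtain ⟨i, rfl⟩ : ∃ j, i = j + 1 := ⟨i - 1, by omega⟩
    obtain ⟨a, ham, hap⟩ :=
      exists_notMem_of_gam_eq_bot (gam_quotient_gam (J := maximalIdeal A) (M := M))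
    have h1 := (h.of_surjective _ (gam (maximalIdeal A) M).mkQ_surjective).quotient_of_isSMulRegular
      hap
    have := ih _ (h1.mono (k' := 1) (n' := n) (by omega)) i (by omega)
    obtain ⟨-, κ, -, hκ⟩ := Φ.exists_connecting_smul i (isSMulRegular_of_forall_notMem hap)
    suffices Subsingleton (Φ.H (M ⧸ gam (maximalIdeal A) M) (i + 1)) from
      (Φ.hmap_mkQ_gam_injective (M := M) i).subsingleton
    refine subsingleton_of_forall_eq 0 fun z => ?_
    have hzt : z ∈ gam (maximalIdeal A) (Φ.H (M ⧸ gam (maximalIdeal A) M) (i + 1)) := by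
      rw [Φ.gam_H_eq_top]; trivial
    obtain ⟨t, ht⟩ := mem_gam.1 hzt
    have hz := ht _ (Ideal.pow_mem_pow ham t)
    clear ht
    induction t with
    | zero => simpa using hz
    | succ t iht =>
      refine iht ?_
      rw [pow_succ', mul_smul] at hz
      obtain ⟨y, hy⟩ := (hκ _).1 hz
      rw [← hy, Subsingleton.elim y 0, map_zero]

end PowRes

end Vanishing

section DualDimension

variable {A : Type} [CommRing A] [IsNoetherianRing A] [IsLocalRing A]
  [IsAdicComplete (maximalIdeal A) A] (Φ : PowRes A (maximalIdeal A))
variable {E : Type} [AddCommGroup E] [Module A E] (hE : IsInjHull A (maximalIdeal A) E)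
include hE

theorem IsInjHull.dimLE_dual_H (n : ℕ) : ∀ (M : Type) [AddCommGroup M] [Module A M]
    [Module.Finite A M], DimLE A (Φ.H M n →ₗ[A] E) 0 n := by
  induction n with
  | zero =>
    intro M _ _ _ p hp
    refine (ch_eq_zero_of_gam ?_ hp).le
    obtain ⟨t, ht⟩ := exists_pow_smul_eq_zero_of_fg
      (IsNoetherian.noetherian (gam (maximalIdeal A) M)) le_rfl
    refine eq_top_iff.2 fun φ _ => mem_gam.2 ⟨t, fun r hr => LinearMap.ext fun z => ?_⟩
    have : r • z = 0 := (Φ.η M).injective (by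
      rw [map_smul, map_zero]
      exact Subtype.ext (ht r hr _ (Φ.η M z).2))
    rw [LinearMap.smul_apply, ← map_smul, this, map_zero, LinearMap.zero_apply]
  | succ n ih =>
    intro M _ _ _
    have := hE.finite_dual_H Φ (n + 1) (M ⧸ gam (maximalIdeal A) M)
    obtain ⟨a, ham, hap⟩ :=
      exists_notMem_of_gam_eq_bot (gam_quotient_gam (J := maximalIdeal A) (M := M))
    obtain ⟨-, κ, -, hκ⟩ := Φ.exists_connecting_smul n (isSMulRegular_of_forall_notMem hap)
    obtain ⟨g, hg, -⟩ := hE.exists_injective_quotient κ hκ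
    have h1 := ((ih _).of_injective g hg).mono (k' := 1) (n' := n + 1) (by omega)
    refine (DimLE.of_quotient ham h1).of_surjective
      (LinearMap.lcomp A E (Φ.hmap (n + 1) (gam (maximalIdeal A) M).mkQ)) fun φ => ?_
    exact hE.exists_comp_eq _ φ
      (by rw [LinearMap.ker_eq_bot.2 (Φ.hmap_mkQ_gam_injective n)]; exact bot_le)

end DualDimension

section Surjectivity

variable {A : Type} [CommRing A]
variable {N : Type} [AddCommGroup N] [Module A N]

theorem lsmul_eq_subtype_comp (y : A) : LinearMap.lsmul A N y =
    (LinearMap.range (LinearMap.lsmul A N y)).subtype ∘ₗ (LinearMap.lsmul A N y).rangeRestrict :=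
  rfl

theorem range_subtype_exact (y : A) :
    Function.Exact (LinearMap.range (LinearMap.lsmul A N y)).subtype
      (y • (⊤ : Submodule A N)).mkQ := by
  intro x
  rw [smul_exact (M := N) y x]
  simp

theorem ker_subtype_exact (y : A) :
    Function.Exact (LinearMap.ker (LinearMap.lsmul A N y)).subtype
      (LinearMap.lsmul A N y).rangeRestrict := by
  intro x
  rw [← LinearMap.mem_ker, LinearMap.ker_rangeRestrict]
  simp

variable [IsNoetherianRing A] [IsLocalRing A] (Φ : PowRes A (maximalIdeal A)) [Module.Finite A N]

namespace PowRes

theorem exists_smul_eq_H {e : ℕ} (hN : DimLE A N 0 e) {y : A}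
    (hy : DimLE A (N ⧸ y • (⊤ : Submodule A N)) 1 e) (z : Φ.H N e) : ∃ w, y • w = z := by
  have h1 := Φ.subsingleton_H_of_dimLE (e + 1) _ ((hN.of_injective _
    (LinearMap.ker (LinearMap.lsmul A N y)).injective_subtype).mono (k' := 1) (n' := e + 1)
      (by omega)) (e + 1) le_rfl
  have h2 := Φ.subsingleton_H_of_dimLE e _ hy e le_rfl
  obtain ⟨κ, hκ, -⟩ := Φ.exists_connecting e
    (LinearMap.ker (LinearMap.lsmul A N y)).injective_subtype
    (LinearMap.lsmul A N y).surjective_rangeRestrict (ker_subtype_exact y)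
  obtain ⟨u, rfl⟩ := (Φ.hmap_exact e (Submodule.injective_subtype _)
    (Submodule.mkQ_surjective _) (range_subtype_exact y) z).1 (Subsingleton.elim _ _)
  obtain ⟨w, rfl⟩ := (hκ u).1 (Subsingleton.elim _ _)
  refine ⟨w, ?_⟩
  rw [← hmap_lsmul, lsmul_eq_subtype_comp, hmap_comp]
  rfl

theorem exists_smul_eq_of_smul_eq_zero {e : ℕ} {y z : A}
    (hy : DimLE A (N ⧸ y • (⊤ : Submodule A N)) 0 e)
    (hz : DimLE A ((N ⧸ y • (⊤ : Submodule A N)) ⧸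
      z • (⊤ : Submodule A (N ⧸ y • (⊤ : Submodule A N)))) 1 e)
    {u : Φ.H N (e + 1)} (hu : y • u = 0) : ∃ w : Φ.H N (e + 1), y • w = 0 ∧ z • w = u := by
  set Z := LinearMap.ker (LinearMap.lsmul A N y)
  have hZ : DimLE A Z 0 e := fun p hp => by
    refine hy p (mem_support_quotient.2
      ⟨Module.support_subset_of_injective _ Z.injective_subtype hp, ?_⟩)
    obtain ⟨x, hx⟩ := Module.mem_support_iff_exists_annihilator.1 hp
    exact hx ((Submodule.mem_annihilator_span_singleton x y).2 (Subtype.ext x.2))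
  have h0 := Φ.subsingleton_H_of_dimLE (e + 1) _ (hZ.mono (k' := 1) (n' := e + 1) (by omega))
    (e + 1) le_rfl
  have h1 := Φ.subsingleton_H_of_dimLE (e + 1) _ (hZ.mono (k' := 1) (n' := e + 1) (by omega))
    (e + 2) (by omega)
  have hinj : Function.Injective (Φ.hmap (e + 1) (LinearMap.lsmul A N y).rangeRestrict) := by
    refine (injective_iff_map_eq_zero _).2 fun v hv => ?_
    obtain ⟨v', rfl⟩ := (Φ.hmap_exact (e + 1) Z.injective_subtype
      (LinearMap.lsmul A N y).surjective_rangeRestrict (ker_subtype_exact y) v).1 hv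
    rw [Subsingleton.elim v' 0, map_zero]
  have hsurj : Function.Surjective (Φ.hmap (e + 1) (LinearMap.lsmul A N y).rangeRestrict) := by
    obtain ⟨κ, hκ, -⟩ := Φ.exists_connecting (e + 1) Z.injective_subtype
      (LinearMap.lsmul A N y).surjective_rangeRestrict (ker_subtype_exact y)
    exact fun v => (hκ v).1 (Subsingleton.elim _ _)
  obtain ⟨κ, -, hκ⟩ := Φ.exists_connecting e (Submodule.injective_subtype _)
    (Submodule.mkQ_surjective _) (range_subtype_exact (N := N) y)
  have hsm : ∀ w : Φ.H N (e + 1), Φ.hmap (e + 1) (Submodule.subtype _)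
      (Φ.hmap (e + 1) (LinearMap.lsmul A N y).rangeRestrict w) = y • w := fun w => by
    rw [← hmap_lsmul, lsmul_eq_subtype_comp, hmap_comp]
    rfl
  obtain ⟨t, ht⟩ := (hκ (Φ.hmap (e + 1) (LinearMap.lsmul A N y).rangeRestrict u)).1
    ((hsm u).trans hu)
  obtain ⟨s, rfl⟩ := Φ.exists_smul_eq_H hy hz t
  obtain ⟨w, hw⟩ := hsurj (κ s)
  refine ⟨w, ?_, hinj ?_⟩
  · rw [← hsm, hw]
    exact (hκ _).2 ⟨s, rfl⟩
  · rw [map_smul, hw, ← map_smul, ht]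

/-- Associated primes of canonical-type modules have maximal dimension. -/
theorem le_ch_of_mem_associatedPrimes {e : ℕ} (hN : DimLE A N 0 e)
    {W : Type} [AddCommGroup W] [Module A W]
    (hW : ∀ y : A, (∀ z : Φ.H N e, ∃ w, y • w = z) → IsSMulRegular W y)
    {p : PrimeSpectrum A} (hp : p.asIdeal ∈ associatedPrimes A W) : e ≤ ch p := by
  by_contra! hlt
  obtain ⟨y, hy, hyN⟩ := hN.exists_quotient (I := p.asIdeal) fun q _ hq hpq => by
    have := ch_le (p := p) (q := q) hpq
    omega
  obtain ⟨-, x, hx⟩ := isAssociatedPrime_iff.1 hp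
  have h1 := hW y (Φ.exists_smul_eq_H hN hyN)
  have h2 : y • x = 0 := by
    rw [hx] at hy
    simpa using hy
  have h3 : x = 0 := h1 (h2.trans (smul_zero y).symm)
  exact p.2.ne_top (by rw [hx, h3]; ext; simp)

end PowRes

end Surjectivity

section Nonvanishing

variable {A : Type} [CommRing A] [IsNoetherianRing A] [IsLocalRing A]

omit [IsLocalRing A] in
theorem mem_support_of_mem_associatedPrimes {M : Type} [AddCommGroup M] [Module A M]
    {p : PrimeSpectrum A} (hp : p.asIdeal ∈ associatedPrimes A M) : p ∈ Module.support A M := by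
  obtain ⟨-, x, hx⟩ := isAssociatedPrime_iff.1 hp
  refine Module.mem_support_iff_exists_annihilator.2 ⟨x, fun r hr => ?_⟩
  rw [hx]
  simpa using (Submodule.mem_annihilator_span_singleton x r).1 hr

omit [IsLocalRing A] in
theorem exists_mem_associatedPrimes_le {M : Type} [AddCommGroup M] [Module A M] [Module.Finite A M]
    {p : PrimeSpectrum A} (hp : p ∈ Module.support A M) :
    ∃ q : PrimeSpectrum A, q ≤ p ∧ q.asIdeal ∈ associatedPrimes A M := by
  obtain ⟨q, hq, hqp⟩ := Ideal.exists_minimalPrimes_le (J := p.asIdeal)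
    (Module.annihilator_le_of_mem_support hp)
  exact ⟨⟨q, hq.1.1⟩, hqp,
    Module.associatedPrimes.minimalPrimes_annihilator_subset_associatedPrimes A M hq⟩

omit [IsLocalRing A] in
theorem exists_mem_associatedPrimes (M : Type) [AddCommGroup M] [Module A M] [Nontrivial M] :
    ∃ q : PrimeSpectrum A, q.asIdeal ∈ associatedPrimes A M := by
  obtain ⟨q, hq⟩ := associatedPrimes.nonempty A M
  exact ⟨⟨q, IsAssociatedPrime.isPrime hq⟩, hq⟩

variable (Φ : PowRes A (maximalIdeal A)) {E : Type} [AddCommGroup E] [Module A E]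

theorem le_ch_of_mem_associatedPrimes_dual {N : Type} [AddCommGroup N] [Module A N]
    [Module.Finite A N] {e : ℕ} (hN : DimLE A N 0 e) {p : PrimeSpectrum A}
    (hp : p.asIdeal ∈ associatedPrimes A (Φ.H N e →ₗ[A] E)) : e ≤ ch p :=
  Φ.le_ch_of_mem_associatedPrimes hN (fun _ => isSMulRegular_dual) hp

variable [IsAdicComplete (maximalIdeal A) A] (hE : IsInjHull A (maximalIdeal A) E)
include hE

theorem IsInjHull.nontrivial_H (n : ℕ) : ∀ (M : Type) [AddCommGroup M] [Module A M]
    [Module.Finite A M], DimLE A M 0 n → (∃ p ∈ Module.support A M, n ≤ ch p) →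
    Nontrivial (Φ.H M n) := by
  induction n with
  | zero =>
    rintro M _ _ _ h ⟨p, hp, -⟩
    rw [← not_subsingleton_iff_nontrivial]
    intro hs
    have : gam (maximalIdeal A) M = ⊥ := by
      have := (Φ.η M).symm.injective.subsingleton
      exact (Submodule.subsingleton_iff_eq_bot).1 this
    obtain ⟨a, ham, hap⟩ := exists_notMem_of_gam_eq_bot this
    refine hap p.asIdeal (mem_associatedPrimes_of_maximal h hp (Nat.le_zero.1 (h p hp))) ?_
    by_contra hpa
    have h0 := ch_pos fun hle => hpa (hle ham)
    have := h p hp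
    omega
  | succ n ih =>
    rintro M _ _ _ h ⟨p, hp, hpn⟩
    rw [← not_subsingleton_iff_nontrivial]
    intro hs
    set M₁ := M ⧸ gam (maximalIdeal A) M with hM₁
    have hs1 : Subsingleton (Φ.H M₁ (n + 1)) := (Φ.hmap_mkQ_gam_surjective (n + 1)).subsingleton
    have hp1 : p ∈ Module.support A M₁ := by
      rw [Module.support_of_exact (LinearMap.exact_subtype_mkQ (gam (maximalIdeal A) M))
        (Submodule.injective_subtype _) (Submodule.mkQ_surjective _)] at hp
      refine hp.resolve_left fun hp => ?_
      have := ch_eq_zero_of_gam gam_gam hp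
      omega
    have := hE.finite_dual_H Φ n M₁
    have hgam : gam (maximalIdeal A) M₁ = ⊥ := gam_quotient_gam
    obtain ⟨a, ham, hap⟩ : ∃ a ∈ maximalIdeal A, ∀ q ∈ associatedPrimes A M₁ ∪
        {q ∈ associatedPrimes A (Φ.H M₁ n →ₗ[A] E) | ¬ maximalIdeal A ≤ q}, a ∉ q := by
      refine exists_mem_forall_notMem ((associatedPrimes.finite A M₁).union
        ((associatedPrimes.finite A _).subset fun _ h => h.1)) ?_ ?_
      · rintro q (hq | hq)
        exacts [IsAssociatedPrime.isPrime hq, IsAssociatedPrime.isPrime hq.1]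
      · rintro q (hq | hq) hle
        · obtain ⟨b, hb, hbq⟩ := exists_notMem_of_gam_eq_bot hgam
          exact hbq q hq (hle hb)
        · exact hq.2 hle
    have hap1 : ∀ q ∈ associatedPrimes A M₁, a ∉ q := fun q hq => hap q (Or.inl hq)
    obtain ⟨hk, κ, hκ, -⟩ := Φ.exists_connecting_smul n (isSMulRegular_of_forall_notMem hap1)
    have hdim : DimLE A (M₁ ⧸ a • (⊤ : Submodule A M₁)) 0 n :=
      ((h.of_surjective _ (gam (maximalIdeal A) M).mkQ_surjective).quotient_of_isSMulRegular
        hap1).mono (by omega)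
    have hnt : Nontrivial (Φ.H (M₁ ⧸ a • (⊤ : Submodule A M₁)) n) := by
      refine ih _ hdim ?_
      obtain ⟨q, hpq, haq, hq⟩ := exists_mem_of_ch ham p
      exact ⟨q, mem_support_quotient.2 ⟨Module.mem_support_mono hpq hp1, haq⟩, by omega⟩
    have hsurj : Function.Surjective (Φ.hmap n (a • (⊤ : Submodule A M₁)).mkQ) := fun z =>
      (hκ z).1 (Subsingleton.elim _ _)
    let D := LinearMap.lcomp A E (Φ.hmap n (a • (⊤ : Submodule A M₁)).mkQ)
    have hD : Function.Injective D := fun φ ψ hφ => LinearMap.ext fun z => by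
      obtain ⟨y, rfl⟩ := hsurj z
      exact LinearMap.congr_fun hφ y
    obtain ⟨z, hz⟩ := exists_ne (0 : Φ.H (M₁ ⧸ a • (⊤ : Submodule A M₁)) n)
    obtain ⟨φ, hφ⟩ := hE.exists_apply_ne_zero hz
    have : Nontrivial (Φ.H (M₁ ⧸ a • (⊤ : Submodule A M₁)) n →ₗ[A] E) :=
      ⟨φ, 0, fun h => hφ (by rw [h]; rfl)⟩
    obtain ⟨r, hr⟩ := exists_mem_associatedPrimes (A := A)
      (Φ.H (M₁ ⧸ a • (⊤ : Submodule A M₁)) n →ₗ[A] E)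
    have h1 := le_ch_of_mem_associatedPrimes_dual Φ hdim hr
    have hrK := associatedPrimes.subset_of_injective (f := D) hD hr
    have har : a ∈ r.asIdeal := by
      refine IsAssociatedPrime.annihilator_le hr (Submodule.mem_annihilator.2 fun φ _ => ?_)
      refine hD (show D (a • φ) = D 0 from LinearMap.ext fun y => ?_)
      have : Φ.hmap n (a • (⊤ : Submodule A M₁)).mkQ (a • y) = 0 := (hk _).2 ⟨y, rfl⟩
      change a • φ (Φ.hmap n _ y) = 0
      rw [← map_smul, ← map_smul, this, map_zero]
    have h3 : maximalIdeal A ≤ r.asIdeal := by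
      by_contra h3
      exact hap _ (Or.inr ⟨hrK, h3⟩) har
    have h4 := ch_eq_zero h3
    obtain rfl : n = 0 := by omega
    have hsub : Subsingleton (Φ.H M₁ 0) := by
      have : Subsingleton (gam (maximalIdeal A) M₁) := by
        rw [Submodule.subsingleton_iff_eq_bot, hgam]
      exact (Φ.η M₁).injective.subsingleton
    exact hz ((hsurj.subsingleton).elim _ _)

/-- Complete local rings are catenary. -/
theorem IsInjHull.ch_eq {q p : PrimeSpectrum A} (hqp : q ≤ p) {a : A} (haq : a ∉ q.asIdeal)
    (hap : a ∈ p.asIdeal)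
    (hmin : ∀ r : PrimeSpectrum A, q ≤ r → a ∈ r.asIdeal → r ≤ p → r = p) : ch p + 1 = ch q := by
  let Φ := stdPowRes (maximalIdeal A)
  have hlt : q < p := lt_of_le_of_ne hqp (by rintro rfl; exact haq hap)
  have hchlt := ch_lt hlt
  obtain ⟨n, hn⟩ : ∃ n, ch q = n + 1 := ⟨ch q - 1, by omega⟩
  suffices n ≤ ch p by omega
  have hsupp : ∀ r, r ∈ Module.support A (A ⧸ q.asIdeal) ↔ q ≤ r := fun r => by
    rw [Module.mem_support_iff_of_finite, Ideal.annihilator_quotient]; rfl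
  have hB : DimLE A (A ⧸ q.asIdeal) 0 (n + 1) := fun r hr =>
    (ch_le ((hsupp r).1 hr)).trans hn.le
  have := hE.nontrivial_H Φ (n + 1) _ hB ⟨q, (hsupp q).2 le_rfl, hn.ge⟩
  have := hE.finite_dual_H Φ (n + 1) (A ⧸ q.asIdeal)
  obtain ⟨z, hz⟩ := exists_ne (0 : Φ.H (A ⧸ q.asIdeal) (n + 1))
  obtain ⟨φ, hφ⟩ := hE.exists_apply_ne_zero hz
  have : Nontrivial (Φ.H (A ⧸ q.asIdeal) (n + 1) →ₗ[A] E) := ⟨φ, 0, fun h => hφ (by rw [h]; rfl)⟩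
  have hkill : q.asIdeal ≤ Module.annihilator A (Φ.H (A ⧸ q.asIdeal) (n + 1) →ₗ[A] E) := by
    intro s hs
    refine Module.mem_annihilator.2 fun φ => LinearMap.ext fun z => ?_
    have hs0 : LinearMap.lsmul A (A ⧸ q.asIdeal) s = 0 := LinearMap.ext fun b => by
      obtain ⟨b, rfl⟩ := Ideal.Quotient.mk_surjective b
      change Ideal.Quotient.mk _ (s * b) = 0
      exact Ideal.Quotient.eq_zero_iff_mem.2 (q.asIdeal.mul_mem_right _ hs)
    have hs1 : s • z = 0 := by
      rw [← Φ.hmap_lsmul, hs0, ← zero_smul A (0 : (A ⧸ q.asIdeal) →ₗ[A] (A ⧸ q.asIdeal)),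
        Φ.hmap_smul, zero_smul, LinearMap.zero_apply]
    rw [LinearMap.smul_apply, ← map_smul, hs1, map_zero, LinearMap.zero_apply]
  have hqK : q ∈ Module.support A (Φ.H (A ⧸ q.asIdeal) (n + 1) →ₗ[A] E) := by
    obtain ⟨r, hr⟩ := exists_mem_associatedPrimes (A := A)
      (Φ.H (A ⧸ q.asIdeal) (n + 1) →ₗ[A] E)
    have h1 := le_ch_of_mem_associatedPrimes_dual Φ hB hr
    have hqr : q ≤ r := hkill.trans
      (Submodule.annihilator_top.ge.trans (IsAssociatedPrime.annihilator_le hr))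
    rcases hqr.eq_or_lt with rfl | hqr
    · exact mem_support_of_mem_associatedPrimes hr
    · have := ch_lt hqr
      omega
  have hareg : IsSMulRegular (A ⧸ q.asIdeal) a := by
    refine (injective_iff_map_eq_zero (LinearMap.lsmul A (A ⧸ q.asIdeal) a)).2 fun b hb => ?_
    obtain ⟨b, rfl⟩ := Ideal.Quotient.mk_surjective b
    exact Ideal.Quotient.eq_zero_iff_mem.2
      ((q.2.mem_or_mem (Ideal.Quotient.eq_zero_iff_mem.1 hb)).resolve_left haq)
  obtain ⟨-, κ, -, hκ⟩ := Φ.exists_connecting_smul n hareg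
  obtain ⟨g, hg, -⟩ := hE.exists_injective_quotient κ hκ
  have hBa : DimLE A ((A ⧸ q.asIdeal) ⧸ a • (⊤ : Submodule A (A ⧸ q.asIdeal))) 0 n := by
    refine (hB.quotient (a := a) fun r hr hrn har => ?_).mono (by omega)
    rcases ((hsupp r).1 hr).eq_or_lt with rfl | h
    · exact haq har
    · have := ch_lt h
      omega
  refine le_ch_of_mem_associatedPrimes_dual Φ hBa (associatedPrimes.subset_of_injective (f := g) hg ?_)
  obtain ⟨r, hrp, hr⟩ := exists_mem_associatedPrimes_le
    (mem_support_quotient.2 ⟨Module.mem_support_mono hqp hqK, hap⟩)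
  obtain ⟨hr1, hr2⟩ := mem_support_quotient.1 (mem_support_of_mem_associatedPrimes hr)
  rwa [← hmin r (hkill.trans (Module.annihilator_le_of_mem_support hr1)) hr2 hrp]

end Nonvanishing

section Serre

variable {A : Type} [CommRing A] {M : Type} [AddCommGroup M] [Module A M]

theorem LocalizedModule.mk_eq_zero_iff_exists {S : Submonoid A} {m : M} {s : S} :
    LocalizedModule.mk m s = 0 ↔ ∃ t : S, (t : A) • m = 0 := by
  rw [← LocalizedModule.zero_mk s, LocalizedModule.mk_eq]
  refine ⟨fun ⟨t, ht⟩ => ⟨t * s, ?_⟩, fun ⟨t, ht⟩ => ⟨t, ?_⟩⟩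
  · rw [smul_zero, smul_zero] at ht
    rw [Submonoid.coe_mul, mul_smul]
    exact ht
  · rw [smul_zero, smul_zero, smul_comm]
    exact (congrArg (s • ·) ht).trans (smul_zero _)

theorem mem_support_localizedModule {p : PrimeSpectrum A}
    {q : PrimeSpectrum (Localization.AtPrime p.asIdeal)} :
    q ∈ Module.support (Localization.AtPrime p.asIdeal)
      (LocalizedModule p.asIdeal.primeCompl M) ↔
    PrimeSpectrum.comap (algebraMap A (Localization.AtPrime p.asIdeal)) q ∈ Module.support A M := by
  simp only [Module.mem_support_iff_exists_annihilator]
  constructor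
  · rintro ⟨z, hz⟩
    induction z using LocalizedModule.induction_on with | h m s => ?_
    refine ⟨m, fun r hr => hz ?_⟩
    rw [Submodule.mem_annihilator_span_singleton] at hr ⊢
    rw [algebraMap_smul, LocalizedModule.smul'_mk, hr, LocalizedModule.zero_mk]
  · rintro ⟨m, hm⟩
    refine ⟨LocalizedModule.mk m 1, fun r hr => ?_⟩
    obtain ⟨a, s, rfl⟩ := IsLocalization.exists_mk'_eq p.asIdeal.primeCompl r
    rw [Submodule.mem_annihilator_span_singleton, ← Localization.mk_eq_mk',
      LocalizedModule.mk_smul_mk, LocalizedModule.mk_eq_zero_iff_exists] at hr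
    obtain ⟨t, ht⟩ := hr
    have h1 : (t : A) * a ∈ (PrimeSpectrum.comap
        (algebraMap A (Localization.AtPrime p.asIdeal)) q).asIdeal := hm (by
      rw [Submodule.mem_annihilator_span_singleton, mul_smul]; exact ht)
    rw [IsLocalization.mk'_mem_iff]
    refine ((PrimeSpectrum.comap _ q).2.mem_or_mem h1).resolve_left fun h2 => ?_
    exact q.2.ne_top (Ideal.eq_top_of_isUnit_mem _ h2 (IsLocalization.map_units _ t))

theorem comap_lt_comap_localization {p : PrimeSpectrum A}
    {q q' : PrimeSpectrum (Localization.AtPrime p.asIdeal)} (h : q < q') :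
    PrimeSpectrum.comap (algebraMap A (Localization.AtPrime p.asIdeal)) q <
      PrimeSpectrum.comap (algebraMap A (Localization.AtPrime p.asIdeal)) q' :=
  (IsLocalization.AtPrime.primeSpectrumOrderIso
    (Localization.AtPrime p.asIdeal) p.asIdeal).strictMono h

theorem comap_localization_le {p : PrimeSpectrum A}
    (q : PrimeSpectrum (Localization.AtPrime p.asIdeal)) :
    PrimeSpectrum.comap (algebraMap A (Localization.AtPrime p.asIdeal)) q ≤ p :=
  (IsLocalization.AtPrime.primeSpectrumOrderIso
    (Localization.AtPrime p.asIdeal) p.asIdeal q).2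

theorem exists_comap_localization_eq {p q : PrimeSpectrum A} (h : q ≤ p) :
    ∃ q', PrimeSpectrum.comap (algebraMap A (Localization.AtPrime p.asIdeal)) q' = q :=
  ⟨(IsLocalization.AtPrime.primeSpectrumOrderIso
    (Localization.AtPrime p.asIdeal) p.asIdeal).symm ⟨q, h⟩, congrArg Subtype.val
    ((IsLocalization.AtPrime.primeSpectrumOrderIso
      (Localization.AtPrime p.asIdeal) p.asIdeal).apply_symm_apply ⟨q, h⟩)⟩

theorem lt_of_comap_localization_lt {p : PrimeSpectrum A}
    {q q' : PrimeSpectrum (Localization.AtPrime p.asIdeal)}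
    (h : PrimeSpectrum.comap (algebraMap A (Localization.AtPrime p.asIdeal)) q <
      PrimeSpectrum.comap (algebraMap A (Localization.AtPrime p.asIdeal)) q') : q < q' :=
  (IsLocalization.AtPrime.primeSpectrumOrderIso
    (Localization.AtPrime p.asIdeal) p.asIdeal).lt_iff_lt.1 h

theorem one_le_mdim_localizedModule_iff {p : PrimeSpectrum A} :
    1 ≤ mdim (Localization.AtPrime p.asIdeal) (LocalizedModule p.asIdeal.primeCompl M) ↔
      ∃ q ∈ Module.support A M, q < p := by
  rw [mdim, Order.one_le_krullDim_iff]
  constructor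
  · rintro ⟨⟨a, ha⟩, ⟨b, _⟩, hab⟩
    exact ⟨_, mem_support_localizedModule.1 ha,
      (comap_lt_comap_localization hab).trans_le (comap_localization_le b)⟩
  · rintro ⟨q, hq, hqp⟩
    obtain ⟨a, rfl⟩ := exists_comap_localization_eq hqp.le
    obtain ⟨b, hb⟩ := exists_comap_localization_eq (le_refl p)
    refine ⟨⟨a, mem_support_localizedModule.2 hq⟩, ⟨b, mem_support_localizedModule.2 ?_⟩,
      lt_of_comap_localization_lt (hqp.trans_eq hb.symm)⟩
    rw [hb]; exact Module.mem_support_mono hqp.le hq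

theorem two_le_mdim_localizedModule_iff {p : PrimeSpectrum A} :
    2 ≤ mdim (Localization.AtPrime p.asIdeal) (LocalizedModule p.asIdeal.primeCompl M) ↔
      ∃ q ∈ Module.support A M, ∃ q', q < q' ∧ q' < p := by
  rw [mdim, show (2 : WithBot ℕ∞) = ((2 : ℕ) : WithBot ℕ∞) from rfl, Order.le_krullDim_iff]
  constructor
  · rintro ⟨l, hl⟩
    have h01 : l ⟨0, by omega⟩ < l ⟨1, by omega⟩ := l.strictMono (Nat.zero_lt_one)
    have h12 : l ⟨1, by omega⟩ < l ⟨2, by omega⟩ := l.strictMono (Nat.one_lt_two)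
    exact ⟨_, mem_support_localizedModule.1 (l ⟨0, by omega⟩).2, _,
      comap_lt_comap_localization h01,
      (comap_lt_comap_localization h12).trans_le (comap_localization_le _)⟩
  · rintro ⟨q, hq, q', hqq', hqp⟩
    obtain ⟨a, rfl⟩ := exists_comap_localization_eq (hqq'.trans hqp).le
    obtain ⟨b, rfl⟩ := exists_comap_localization_eq hqp.le
    obtain ⟨c, hc⟩ := exists_comap_localization_eq (le_refl p)
    have hb := Module.mem_support_mono hqq'.le hq
    have hcs : PrimeSpectrum.comap (algebraMap A (Localization.AtPrime p.asIdeal)) c ∈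
      Module.support A M := by
      rw [hc]; exact Module.mem_support_mono hqp.le hb
    refine ⟨⟨2, ![⟨a, mem_support_localizedModule.2 hq⟩, ⟨b, mem_support_localizedModule.2 hb⟩,
      ⟨c, mem_support_localizedModule.2 hcs⟩], fun i => ?_⟩, rfl⟩
    fin_cases i
    · exact lt_of_comap_localization_lt hqq'
    · exact lt_of_comap_localization_lt (hqp.trans_eq hc.symm)

theorem exists_isRegular_of_lt_gradeI {J : Ideal A} {n : ℕ} (h : (n : ℕ∞) < gradeI A J M) :
    ∃ rs : List A, n < rs.length ∧ (∀ r ∈ rs, r ∈ J) ∧ RingTheory.Sequence.IsRegular M rs := by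
  obtain ⟨_, ⟨rs, rfl, h1, h2⟩, hn⟩ := lt_sSup_iff.1 h
  exact ⟨rs, by exact_mod_cast hn, h1, h2⟩

theorem exists_smul_mk_eq {p : PrimeSpectrum A} {u : M} {y : A}
    (h : ∀ a ∈ p.asIdeal, ∃ w : M, a • u = y • w) {r : Localization.AtPrime p.asIdeal}
    (hr : r ∈ maximalIdeal (Localization.AtPrime p.asIdeal)) :
    ∃ v : LocalizedModule p.asIdeal.primeCompl M, r • LocalizedModule.mk u 1 = y • v := by
  obtain ⟨a, s, rfl⟩ := IsLocalization.exists_mk'_eq p.asIdeal.primeCompl r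
  obtain ⟨w, hw⟩ := h a ((IsLocalization.AtPrime.mk'_mem_maximal_iff _ p.asIdeal a s).1 hr)
  refine ⟨LocalizedModule.mk w s, ?_⟩
  rw [← Localization.mk_eq_mk', LocalizedModule.mk_smul_mk, hw, LocalizedModule.smul'_mk, mul_one]

variable (hS : Serre A 2 M)
include hS

theorem Serre.not_lt [IsNoetherianRing A] {p q : PrimeSpectrum A} (hp : p.asIdeal ∈ associatedPrimes A M)
    (hq : q ∈ Module.support A M) : ¬ q < p := fun hqp => by
  obtain ⟨-, u, hu⟩ := isAssociatedPrime_iff.1 hp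
  have hmem : ∀ a : A, a ∈ p.asIdeal ↔ a • u = 0 := fun a => by
    rw [hu, Submodule.mem_colon_singleton, Submodule.mem_bot]
  have h1 : ((1 : ℕ∞) : WithBot ℕ∞) ≤ gradeI _ (maximalIdeal (Localization.AtPrime p.asIdeal))
      (LocalizedModule p.asIdeal.primeCompl M) :=
    (le_min (by norm_num) (one_le_mdim_localizedModule_iff.2 ⟨q, hq, hqp⟩)).trans
      (hS p.asIdeal)
  obtain ⟨rs, hl, hrs, hreg⟩ := exists_isRegular_of_lt_gradeI (n := 0)
    (lt_of_lt_of_le (by norm_num) (WithBot.coe_le_coe.1 h1))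
  obtain - | ⟨r, rs⟩ := rs
  · simp at hl
  have hr := (RingTheory.Sequence.isWeaklyRegular_cons_iff _ _ _).1 hreg.toIsWeaklyRegular
  obtain ⟨v, hv⟩ := exists_smul_mk_eq (p := p) (u := u) (y := 0)
    (fun a ha => ⟨0, by rw [(hmem a).1 ha, smul_zero]⟩) (hrs r (by simp))
  have h0 : LocalizedModule.mk u 1 = (0 : LocalizedModule p.asIdeal.primeCompl M) :=
    hr.1 (by show r • _ = r • _; rw [hv, zero_smul, smul_zero])
  obtain ⟨s, hs⟩ := LocalizedModule.mk_eq_zero_iff_exists.1 h0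
  exact s.2 ((hmem s).2 hs)

theorem Serre.not_lt_lt [IsNoetherianRing A] {y : A} (hy : IsSMulRegular M y)
    {p q q' : PrimeSpectrum A}
    (hp : p.asIdeal ∈ associatedPrimes A (M ⧸ y • (⊤ : Submodule A M)))
    (hq : q ∈ Module.support A M) (hqq' : q < q') : ¬ q' < p := fun hqp => by
  obtain ⟨-, u, hu⟩ := isAssociatedPrime_iff.1 hp
  obtain ⟨u, rfl⟩ := Submodule.mkQ_surjective _ u
  have hmem : ∀ a : A, a ∈ p.asIdeal ↔ ∃ w, a • u = y • w := fun a => by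
    rw [hu, Submodule.mem_colon_singleton, Submodule.mem_bot, ← map_smul, Submodule.mkQ_apply,
      Submodule.Quotient.mk_eq_zero, Submodule.mem_smul_pointwise_iff_exists]
    simp only [Submodule.mem_top, true_and, eq_comm]
  have h1 : ((2 : ℕ∞) : WithBot ℕ∞) ≤ gradeI _ (maximalIdeal (Localization.AtPrime p.asIdeal))
      (LocalizedModule p.asIdeal.primeCompl M) :=
    (le_min le_rfl (two_le_mdim_localizedModule_iff.2 ⟨q, hq, q', hqq', hqp⟩)).trans
      (hS p.asIdeal)
  obtain ⟨rs, hl, hrs, hreg⟩ := exists_isRegular_of_lt_gradeI (n := 1)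
    (lt_of_lt_of_le (by norm_num) (WithBot.coe_le_coe.1 h1))
  obtain - | ⟨r, _ | ⟨r', rs⟩⟩ := rs
  · simp at hl
  · simp at hl
  obtain ⟨hr, hr'⟩ :=
    (RingTheory.Sequence.isWeaklyRegular_cons_iff _ _ _).1 hreg.toIsWeaklyRegular
  replace hr' := ((RingTheory.Sequence.isWeaklyRegular_cons_iff _ _ _).1 hr').1
  obtain ⟨v, hv⟩ := exists_smul_mk_eq (fun a ha => (hmem a).1 ha) (hrs r (by simp))
  obtain ⟨w, hw⟩ := exists_smul_mk_eq (fun a ha => (hmem a).1 ha) (hrs r' (by simp))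
  have hyl : IsSMulRegular (LocalizedModule p.asIdeal.primeCompl M) y := by
    refine (injective_iff_map_eq_zero (LinearMap.lsmul A _ y)).2 fun z hz => ?_
    induction z using LocalizedModule.induction_on with | h m s => ?_
    rw [LinearMap.lsmul_apply, LocalizedModule.smul'_mk, LocalizedModule.mk_eq_zero_iff_exists] at hz
    obtain ⟨t, ht⟩ := hz
    refine LocalizedModule.mk_eq_zero_iff_exists.2 ⟨t, hy ?_⟩
    show y • (t : A) • m = y • 0
    rw [smul_zero, smul_comm]; exact ht
  have h2 : r' • v = r • w := hyl (by
    show y • _ = y • _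
    rw [smul_comm y r', ← hv, smul_comm y r, ← hw, smul_comm])
  have h3 : (Submodule.Quotient.mk v : QuotSMulTop r _) = 0 := hr' (by
    show r' • _ = r' • _
    rw [smul_zero, ← Submodule.Quotient.mk_smul, Submodule.Quotient.mk_eq_zero,
      Submodule.mem_smul_pointwise_iff_exists]
    exact ⟨w, Submodule.mem_top, h2.symm⟩)
  obtain ⟨v', -, rfl⟩ := Submodule.mem_smul_pointwise_iff_exists _ _ _ |>.1
    ((Submodule.Quotient.mk_eq_zero _).1 h3)
  have h4 : LocalizedModule.mk u 1 = y • v' := hr (by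
    show r • _ = r • _
    rw [hv, smul_comm])
  induction v' using LocalizedModule.induction_on with | h m s => ?_
  rw [LocalizedModule.smul'_mk, LocalizedModule.mk_eq] at h4
  obtain ⟨t, ht⟩ := h4
  refine (t * s).2 ((hmem _).2 ⟨(t : A) • m, ?_⟩)
  rw [one_smul] at ht
  rw [Submonoid.coe_mul, mul_smul, smul_comm y]
  exact ht

omit hS

theorem gradeI_le {J : Ideal A} {rs : List A} (hrs : ∀ r ∈ rs, r ∈ J)
    (h : RingTheory.Sequence.IsRegular M rs) : (rs.length : ℕ∞) ≤ gradeI A J M :=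
  le_sSup ⟨rs, rfl, hrs, h⟩

theorem length_le_gradeI_localizedModule [IsNoetherianRing A] [Module.Finite A M]
    {p : PrimeSpectrum A} (hp : p ∈ Module.support A M) {rs : List A}
    (hrs : ∀ r ∈ rs, r ∈ p.asIdeal) (h : RingTheory.Sequence.IsWeaklyRegular M rs) :
    (rs.length : ℕ∞) ≤ gradeI _ (maximalIdeal (Localization.AtPrime p.asIdeal))
      (LocalizedModule p.asIdeal.primeCompl M) := by
  have : Nontrivial (LocalizedModule p.asIdeal.primeCompl M) := hp
  rw [← List.length_map (algebraMap A (Localization.AtPrime p.asIdeal))]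
  refine gradeI_le ?_ (RingTheory.Sequence.IsWeaklyRegular.isRegular_of_isLocalizedModule_of_mem
    (Localization.AtPrime p.asIdeal) p.asIdeal
    (LocalizedModule.mkLinearMap p.asIdeal.primeCompl M) h hrs)
  intro r hr
  obtain ⟨a, ha, rfl⟩ := List.mem_map.1 hr
  exact (IsLocalization.AtPrime.to_map_mem_maximal_iff _ p.asIdeal a).2 (hrs a ha)

theorem serre_two_of_forall [IsNoetherianRing A] [Module.Finite A M]
    (h1 : ∀ p q : PrimeSpectrum A, q ∈ Module.support A M → q < p →
      ∃ y ∈ p.asIdeal, IsSMulRegular M y)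
    (h2 : ∀ p q q' : PrimeSpectrum A, q ∈ Module.support A M → q < q' → q' < p →
      ∃ y ∈ p.asIdeal, ∃ z ∈ p.asIdeal, IsSMulRegular M y ∧
        IsSMulRegular (M ⧸ y • (⊤ : Submodule A M)) z) : Serre A 2 M := by
  intro P _
  obtain ⟨p, rfl⟩ : ∃ p : PrimeSpectrum A, p.asIdeal = P := ⟨⟨P, ‹_›⟩, rfl⟩
  by_cases hd2 : 2 ≤ mdim (Localization.AtPrime p.asIdeal)
      (LocalizedModule p.asIdeal.primeCompl M)
  · obtain ⟨q, hq, q', hqq', hqp⟩ := two_le_mdim_localizedModule_iff.1 hd2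
    obtain ⟨y, hy, z, hz, hyr, hzr⟩ := h2 p q q' hq hqq' hqp
    refine (min_le_left _ _).trans (WithBot.coe_le_coe.2 (length_le_gradeI_localizedModule
      (rs := [y, z]) (Module.mem_support_mono (hqq'.trans hqp).le hq) (by simp [hy, hz]) ?_))
    rw [RingTheory.Sequence.isWeaklyRegular_cons_iff,
      RingTheory.Sequence.isWeaklyRegular_singleton_iff]
    exact ⟨hyr, hzr⟩
  by_cases hd1 : 1 ≤ mdim (Localization.AtPrime p.asIdeal)
      (LocalizedModule p.asIdeal.primeCompl M)
  · obtain ⟨q, hq, hqp⟩ := one_le_mdim_localizedModule_iff.1 hd1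
    obtain ⟨y, hy, hyr⟩ := h1 p q hq hqp
    have : mdim (Localization.AtPrime p.asIdeal)
      (LocalizedModule p.asIdeal.primeCompl M) ≤ 1 :=
      Order.le_of_lt_succ (not_le.1 hd2)
    refine (min_le_right _ _).trans (this.trans (WithBot.coe_le_coe.2
      (length_le_gradeI_localizedModule (M := M) (rs := [y]) (Module.mem_support_mono hqp.le hq)
        (by simp [hy]) ?_)))
    rwa [RingTheory.Sequence.isWeaklyRegular_singleton_iff]
  · have : mdim (Localization.AtPrime p.asIdeal)
      (LocalizedModule p.asIdeal.primeCompl M) ≤ 0 :=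
      Order.le_of_lt_succ (not_le.1 hd1)
    exact (min_le_right _ _).trans (this.trans (WithBot.coe_le_coe.2 zero_le))

end Serre

section Dimension

variable {A : Type} [CommRing A] [IsNoetherianRing A]
  {M : Type} [AddCommGroup M] [Module A M]

theorem IsSMulRegular.notMem_of_mem_associatedPrimes {y : A} (hy : IsSMulRegular M y) {p : Ideal A}
    (hp : p ∈ associatedPrimes A M) : y ∉ p := fun hyp => by
  obtain ⟨hpr, u, hu⟩ := isAssociatedPrime_iff.1 hp
  have h0 : y • u = 0 := by
    rwa [hu, Submodule.mem_colon_singleton, Submodule.mem_bot] at hyp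
  have hu0 : u = 0 := hy (by show y • u = y • 0; rw [h0, smul_zero])
  refine hpr.ne_top ((Ideal.eq_top_iff_one _).2 ?_)
  rw [hu, Submodule.mem_colon_singleton, hu0, smul_zero]
  exact Submodule.zero_mem _

variable [IsLocalRing A]

omit [IsNoetherianRing A] [IsLocalRing A] in
theorem mem_support_self (p : PrimeSpectrum A) : p ∈ Module.support A A :=
  Module.mem_support_iff_exists_annihilator.2 ⟨1, fun r hr => by
    have := (Submodule.mem_annihilator_span_singleton (1 : A) r).1 hr
    rw [smul_eq_mul, mul_one] at this
    exact this ▸ Submodule.zero_mem _⟩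

theorem exists_mem_associatedPrimes_ch_eq {d : ℕ} (hd : ringKrullDim A = d) :
    ∃ q : PrimeSpectrum A, q.asIdeal ∈ associatedPrimes A A ∧ ch q = d := by
  obtain ⟨l, hl⟩ := Order.le_krullDim_iff.1 hd.ge
  obtain ⟨q, hql, hq⟩ := exists_mem_associatedPrimes_le (mem_support_self l.head)
  refine ⟨q, hq, le_antisymm ?_ ?_⟩
  · have := (ch_coe_le_ringKrullDim q).trans hd.le
    exact_mod_cast this
  · have : ((d : ℕ) : ℕ∞) ≤ Order.coheight l.head := hl ▸ Order.length_le_coheight_head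
    rw [← coe_ch] at this
    exact (by exact_mod_cast this : d ≤ ch l.head).trans (ch_le hql)

variable [IsAdicComplete (maximalIdeal A) A] {E : Type} [AddCommGroup E] [Module A E]
  (hE : IsInjHull A (maximalIdeal A) E)

include hE in
/-- Modulo a nonzerodivisor, the associated primes of an equidimensional `S_2` module drop
in dimension by exactly one. -/
theorem Serre.ch_add_one_eq [Module.Finite A M] (hS : Serre A 2 M) {c : ℕ}
    (hc : ∀ p : PrimeSpectrum A, p.asIdeal ∈ associatedPrimes A M → ch p = c) {y : A}
    (hy : IsSMulRegular M y) {p : PrimeSpectrum A}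
    (hp : p.asIdeal ∈ associatedPrimes A (M ⧸ y • (⊤ : Submodule A M))) : ch p + 1 = c := by
  obtain ⟨hpM, hyp⟩ := mem_support_quotient.1 (mem_support_of_mem_associatedPrimes hp)
  obtain ⟨q, hqp, hq⟩ := exists_mem_associatedPrimes_le hpM
  have hyq := hy.notMem_of_mem_associatedPrimes hq
  rw [← hc q hq]
  refine hE.ch_eq hqp hyq hyp fun r hqr hyr hrp => ?_
  have hlt : q < r := lt_of_le_of_ne hqr fun h => hyq (h ▸ hyr)
  exact hrp.eq_of_not_lt
    (hS.not_lt_lt hy hp (mem_support_of_mem_associatedPrimes hq) hlt)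

include hE in
theorem exists_lt_lt_of_ch_lt (hS : Serre A 2 A) {p q₁ q₂ : PrimeSpectrum A}
    (h₁ : q₁.asIdeal ∈ associatedPrimes A A) (h₂ : q₂.asIdeal ∈ associatedPrimes A A)
    (hlt : ch q₂ < ch q₁) (hp₁ : q₁ ≤ p) (hp₂ : q₂ ≤ p) : ∃ q q', q < q' ∧ q' < p := by
  by_contra! hno
  have key : ∀ q ≠ p, q ≤ p → ch p + 1 = ch q := fun q hne hle => by
    obtain ⟨a, hap, haq⟩ := SetLike.exists_of_lt
      (show q.asIdeal < p.asIdeal from lt_of_le_of_ne hle fun h => hne (PrimeSpectrum.ext h))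
    refine hE.ch_eq hle haq hap fun r hqr har hrp => hrp.eq_of_not_lt
      (hno q r (lt_of_le_of_ne hqr fun h => haq (h ▸ har)))
  have hne₁ : q₁ ≠ p := fun h => hS.not_lt h₁ (mem_support_self q₂)
    (lt_of_le_of_ne (h ▸ hp₂) fun h' => by rw [h'] at hlt; exact hlt.false)
  have hne₂ : q₂ ≠ p := fun h => hS.not_lt h₂ (mem_support_self q₁)
    (lt_of_le_of_ne (h ▸ hp₁) fun h' => by rw [h'] at hlt; exact hlt.false)
  have e₁ := key q₁ hne₁ hp₁
  have e₂ := key q₂ hne₂ hp₂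
  omega

include hE in
/-- A complete local ring satisfying `S_2` is equidimensional. -/
theorem Serre.ch_eq_of_mem_associatedPrimes (hS : Serre A 2 A) {d : ℕ} (hd : ringKrullDim A = d)
    {p : PrimeSpectrum A} (hp : p.asIdeal ∈ associatedPrimes A A) : ch p = d := by
  classical
  obtain ⟨q, hq, hqd⟩ := exists_mem_associatedPrimes_ch_eq hd
  have hfin := associatedPrimes.finite A A
  by_contra hpd
  set F : Set (Ideal A) → Ideal A := fun s =>
    (hfin.toFinset.filter (· ∈ s)).inf id with hF
  have hF_le : ∀ s (r : Ideal A), r ∈ associatedPrimes A A → r ∈ s → F s ≤ r := fun s r hr hrs =>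
    Finset.inf_le (f := id) (by simp [hr, hrs])
  have hF_prime : ∀ s (r : PrimeSpectrum A), F s ≤ r.asIdeal →
      ∃ t : PrimeSpectrum A, t ≤ r ∧ t.asIdeal ∈ associatedPrimes A A ∧ t.asIdeal ∈ s :=
    fun s r h => by
    obtain ⟨t, ht, htr⟩ := (Ideal.IsPrime.inf_le' r.2).1 h
    simp only [Finset.mem_filter, Set.Finite.mem_toFinset] at ht
    exact ⟨⟨t, IsAssociatedPrime.isPrime ht.1⟩, htr, ht.1, ht.2⟩
  set s : Set (Ideal A) := {r | ∀ h : r.IsPrime, ch ⟨r, h⟩ = d} with hs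
  have hnil : F s ⊓ F sᶜ ≤ nilradical A := by
    rw [nilradical_eq_sInf]
    refine le_sInf fun r hr => ?_
    obtain ⟨t, htr, ht⟩ := exists_mem_associatedPrimes_le (mem_support_self ⟨r, hr⟩)
    by_cases hts : t.asIdeal ∈ s
    exacts [inf_le_left.trans ((hF_le s _ ht hts).trans htr),
      inf_le_right.trans ((hF_le sᶜ _ ht hts).trans htr)]
  obtain ⟨n, hn⟩ := IsNoetherianRing.isNilpotent_nilradical A
  set J₁ := F s ^ (n + 1) with hJ₁
  set J₂ := F sᶜ ^ (n + 1) with hJ₂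
  have hJ : J₁ * J₂ = ⊥ := by
    rw [hJ₁, hJ₂, ← mul_pow, eq_bot_iff]
    exact (Ideal.pow_right_mono (Ideal.mul_le_inf.trans hnil) (n + 1)).trans
      (by rw [pow_succ, hn, zero_mul]; exact le_rfl)
  have hchain : ∀ r : PrimeSpectrum A, J₁ ⊔ J₂ ≤ r.asIdeal → ∃ t t', t < t' ∧ t' < r := by
    intro r hr
    obtain ⟨t₁, htr₁, ht₁, hs₁⟩ := hF_prime s r (r.2.le_of_pow_le (le_sup_left.trans hr))
    obtain ⟨t₂, htr₂, ht₂, hs₂⟩ := hF_prime sᶜ r (r.2.le_of_pow_le (le_sup_right.trans hr))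
    refine exists_lt_lt_of_ch_lt hE hS ht₁ ht₂ ?_ htr₁ htr₂
    rw [show ch t₁ = d from hs₁ t₁.2]
    refine lt_of_le_of_ne ?_ fun h => hs₂ fun _ => h
    have := (ch_coe_le_ringKrullDim t₂).trans hd.le
    exact_mod_cast this
  obtain ⟨a, haJ, ha⟩ := exists_mem_forall_notMem hfin (fun _ => IsAssociatedPrime.isPrime)
    fun r hr h => by
      obtain ⟨t, t', h1, h2⟩ := hchain ⟨r, IsAssociatedPrime.isPrime hr⟩ h
      exact hS.not_lt (p := ⟨r, IsAssociatedPrime.isPrime hr⟩) hr (mem_support_self t) (h1.trans h2)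
  have hareg : IsSMulRegular A a := isSMulRegular_of_forall_notMem ha
  obtain ⟨b, hbJ, hb⟩ := exists_mem_forall_notMem
    (associatedPrimes.finite A (A ⧸ a • (⊤ : Submodule A A)))
    (fun _ => IsAssociatedPrime.isPrime) fun r hr h => by
      obtain ⟨t, t', h1, h2⟩ := hchain ⟨r, IsAssociatedPrime.isPrime hr⟩ h
      exact hS.not_lt_lt hareg (p := ⟨r, IsAssociatedPrime.isPrime hr⟩) hr (mem_support_self t) h1 h2
  have hbreg : IsSMulRegular (A ⧸ a • (⊤ : Submodule A A)) b := isSMulRegular_of_forall_notMem hb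
  obtain ⟨a₁, ha₁, a₂, ha₂, rfl⟩ := Submodule.mem_sup.1 haJ
  obtain ⟨b₁, hb₁, b₂, hb₂, rfl⟩ := Submodule.mem_sup.1 hbJ
  have hmul : ∀ u ∈ J₁, ∀ v ∈ J₂, u * v = 0 := fun u hu v hv =>
    (Submodule.mem_bot A).1 (hJ ▸ Ideal.mul_mem_mul hu hv)
  have h0 : (Submodule.Quotient.mk a₁ : A ⧸ (a₁ + a₂) • (⊤ : Submodule A A)) = 0 := hbreg (by
    show (b₁ + b₂) • _ = (b₁ + b₂) • _
    rw [smul_zero, ← Submodule.Quotient.mk_smul, Submodule.Quotient.mk_eq_zero,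
      Submodule.mem_smul_pointwise_iff_exists]
    refine ⟨b₁, Submodule.mem_top, ?_⟩
    simp only [smul_eq_mul]
    linear_combination hmul b₁ hb₁ a₂ ha₂ - hmul a₁ ha₁ b₂ hb₂)
  obtain ⟨c, -, hc⟩ := (Submodule.mem_smul_pointwise_iff_exists _ _ _).1
    ((Submodule.Quotient.mk_eq_zero _).1 h0)
  rw [smul_eq_mul] at hc
  have hcc : c * (1 - c) = 0 := hareg (hareg (by
    show (a₁ + a₂) • (a₁ + a₂) • _ = (a₁ + a₂) • (a₁ + a₂) • _
    simp only [smul_eq_mul]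
    linear_combination (a₁ + a₂) * (1 - c) * hc + hmul a₁ ha₁ a₂ ha₂ - a₁ * hc))
  rcases IsLocalRing.isUnit_or_isUnit_one_sub_self c with h | h
  · have : c = 1 := (sub_eq_zero.1 (h.mul_right_eq_zero.1 hcc)).symm
    rw [this, mul_one] at hc
    refine ha q.asIdeal hq ?_
    rw [hc]
    exact (Ideal.pow_le_self n.succ_ne_zero).trans (hF_le s _ hq fun _ => hqd) ha₁
  · have : c = 0 := h.mul_left_eq_zero.1 hcc
    rw [this, mul_zero] at hc
    refine ha p.asIdeal hp ?_
    rw [← hc, zero_add]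
    exact (Ideal.pow_le_self n.succ_ne_zero).trans (hF_le sᶜ _ hp fun h => hpd (h p.2)) ha₂

variable (Φ : PowRes A (maximalIdeal A))

include hE in
theorem IsInjHull.dimLE_dual_H_quotient [Module.Finite A M] {a : A} (ha : IsSMulRegular M a)
    (ham : a ∈ maximalIdeal A) (n : ℕ) :
    DimLE A ((Φ.H M n →ₗ[A] E) ⧸ a • (⊤ : Submodule A (Φ.H M n →ₗ[A] E))) 1 n := by
  cases n with
  | zero =>
    have hg : gam (maximalIdeal A) M = ⊥ := by
      refine (Submodule.eq_bot_iff _).2 fun z hz => ?_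
      obtain ⟨t, ht⟩ := mem_gam.1 hz
      exact (ha.pow t) (by
        show a ^ t • z = a ^ t • 0
        rw [smul_zero]; exact ht _ (Ideal.pow_mem_pow ham t))
    have : Subsingleton (Φ.H M 0) := by
      have := (Submodule.subsingleton_iff_eq_bot).2 hg
      exact (Φ.η M).injective.subsingleton
    intro p hp
    have hsub := Module.support_subset_of_surjective _ (Submodule.mkQ_surjective
      (a • (⊤ : Submodule A (Φ.H M 0 →ₗ[A] E)))) hp
    rw [Module.support_eq_empty] at hsub
    exact hsub.elim
  | succ n =>
    obtain ⟨-, κ, -, hκ⟩ := Φ.exists_connecting_smul n ha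
    obtain ⟨g, hg, -⟩ := hE.exists_injective_quotient κ hκ
    exact ((hE.dimLE_dual_H Φ n _).of_injective g hg).mono (by omega)

include hE in
/-- The dual of `H^{d-1}(A)` has dimension at most `d - 3` on the locus of a nonzerodivisor. -/
theorem Serre.dimLE_dual_H_quotient (hS : Serre A 2 A) {e : ℕ}
    (hd : ringKrullDim A = (e + 1 : ℕ)) {x : A} (hx : IsSMulRegular A x) (hxm : x ∈ maximalIdeal A) :
    DimLE A ((Φ.H A e →ₗ[A] E) ⧸ x • (⊤ : Submodule A (Φ.H A e →ₗ[A] E))) 2 e := by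
  cases e with
  | zero =>
    intro p hp
    have := hE.dimLE_dual_H_quotient Φ hx hxm 0 p hp
    omega
  | succ f =>
    intro p hp
    obtain ⟨-, κ, -, hκ⟩ := Φ.exists_connecting_smul f hx
    obtain ⟨g, hg, -⟩ := hE.exists_injective_quotient κ hκ
    have hp' := Module.support_subset_of_injective g hg hp
    have hpf := hE.dimLE_dual_H Φ f _ p hp'
    obtain ⟨a, hap, ha⟩ := exists_mem_forall_notMem
      (associatedPrimes.finite A (A ⧸ x • (⊤ : Submodule A A)))
      (I := p.asIdeal) (fun _ => IsAssociatedPrime.isPrime) fun r hr h => by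
        have h1 := hS.ch_add_one_eq hE
          (fun q hq => hS.ch_eq_of_mem_associatedPrimes hE hd hq) hx
          (p := ⟨r, IsAssociatedPrime.isPrime hr⟩) hr
        have h2 : ch (⟨r, IsAssociatedPrime.isPrime hr⟩ : PrimeSpectrum A) ≤ ch p := ch_le h
        omega
    have hfin := hE.finite_dual_H Φ f (A ⧸ x • (⊤ : Submodule A A))
    have := hE.dimLE_dual_H_quotient Φ (isSMulRegular_of_forall_notMem ha)
      (le_maximalIdeal p.2.ne_top hap) f p (mem_support_quotient.2 ⟨hp', hap⟩)
    omega

end Dimension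

section BaseChange

variable {A : Type} [CommRing A]

theorem Module.Injective.exists_smul_eq {I : Type} [AddCommGroup I] [Module A I]
    [Module.Injective A I] {x : A} (hx : IsSMulRegular A x) (z : I) : ∃ w : I, x • w = z := by
  obtain ⟨h, hh⟩ := Module.Injective.out (LinearMap.lsmul A A x) hx (LinearMap.toSpanSingleton A I z)
  refine ⟨h 1, ?_⟩
  have := hh 1
  rw [LinearMap.toSpanSingleton_apply, one_smul] at this
  rw [← this, LinearMap.lsmul_apply, map_smul]

variable {x : A} {Q : Type} [AddCommGroup Q] [Module A Q] [Module (A ⧸ Ideal.span {x}) Q]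
  [IsScalarTower A (A ⧸ Ideal.span {x}) Q]

theorem smul_eq_zero_of_quotient (x : A) {Q : Type} [AddCommGroup Q] [Module A Q]
    [Module (A ⧸ Ideal.span {x}) Q] [IsScalarTower A (A ⧸ Ideal.span {x}) Q] (z : Q) :
    x • z = 0 := by
  rw [← one_smul (A ⧸ Ideal.span {x}) z, ← smul_assoc, Algebra.smul_def, mul_one,
    Ideal.Quotient.algebraMap_eq,
    Ideal.Quotient.eq_zero_iff_mem.2 (Ideal.mem_span_singleton_self x), zero_smul]

/-- A module over a quotient ring is a restriction of scalars; `A`-linear maps between such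
modules are linear over the quotient. -/
def LinearMap.extendQuotient (I : Ideal A) {M N : Type} [AddCommGroup M] [AddCommGroup N]
    [Module A M] [Module A N] [Module (A ⧸ I) M] [Module (A ⧸ I) N] [IsScalarTower A (A ⧸ I) M]
    [IsScalarTower A (A ⧸ I) N] (f : M →ₗ[A] N) : M →ₗ[A ⧸ I] N where
  toFun := f
  map_add' := map_add f
  map_smul' r m := by
    obtain ⟨a, rfl⟩ := Ideal.Quotient.mk_surjective r
    have h : ∀ {P : Type} [AddCommGroup P] [Module A P] [Module (A ⧸ I) P]
        [IsScalarTower A (A ⧸ I) P] (p : P), Ideal.Quotient.mk I a • p = a • p :=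
      fun p => algebraMap_smul (A ⧸ I) a p
    simp only [h, map_smul, RingHom.id_apply]

variable [IsNoetherianRing A] {J : Ideal A} (Φ : PowRes A J)

theorem PowRes.subsingleton_H_torsionBy (hx : IsSMulRegular A x) (I : Type) [AddCommGroup I]
    [Module A I] [Module.Injective A I] (n : ℕ) :
    Subsingleton (Φ.H (Submodule.torsionBy A I x) (n + 1)) := by
  obtain ⟨κ, h1, h2⟩ := Φ.exists_connecting n (Submodule.torsionBy A I x).injective_subtype
    (g := LinearMap.lsmul A I x) (fun z => Module.Injective.exists_smul_eq hx z) (fun z => by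
      rw [LinearMap.lsmul_apply, ← Submodule.mem_torsionBy_iff]
      exact ⟨fun h => ⟨⟨z, h⟩, rfl⟩, by rintro ⟨w, rfl⟩; exact w.2⟩)
  have := Φ.subsingleton_H_of_injective I n
  refine subsingleton_of_forall_eq 0 fun z => ?_
  obtain ⟨y, rfl⟩ := (h2 z).1 (Subsingleton.elim _ _)
  refine (h1 y).2 ?_
  cases n with
  | zero =>
    have := injective_gam J I
    obtain ⟨w, hw⟩ := Module.Injective.exists_smul_eq hx (Φ.η I y)
    refine ⟨(Φ.η I).symm w, ?_⟩
    rw [Φ.hmap_lsmul, ← map_smul, hw, LinearEquiv.symm_apply_apply]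
  | succ n =>
    have := Φ.subsingleton_H_of_injective I n
    exact ⟨0, Subsingleton.elim _ _⟩

theorem PowRes.subsingleton_H_of_injective_quotient (hx : IsSMulRegular A x)
    [Module.Injective (A ⧸ Ideal.span {x}) Q] (n : ℕ) : Subsingleton (Φ.H Q (n + 1)) := by
  obtain ⟨I, _, _, f, hI, hf⟩ := exists_injective_embedding A Q
  have := Φ.subsingleton_H_torsionBy hx I n
  let f' : Q →ₗ[A] Submodule.torsionBy A I x := f.codRestrict _ fun z => by
    rw [Submodule.mem_torsionBy_iff, ← map_smul, smul_eq_zero_of_quotient, map_zero]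
  have : IsScalarTower A (A ⧸ Ideal.span {x}) (Submodule.torsionBy A I x) :=
    Module.IsTorsionBySet.isScalarTower _
  obtain ⟨ρ, hρ⟩ := Module.Injective.out (f'.extendQuotient (Ideal.span {x}))
    (fun a b hab => hf (congr_arg Subtype.val hab)) (LinearMap.id : Q →ₗ[A ⧸ Ideal.span {x}] Q)
  have hcomp : ρ.restrictScalars A ∘ₗ f' = LinearMap.id := LinearMap.ext hρ
  refine (Function.LeftInverse.injective (g := Φ.hmap (n + 1) (ρ.restrictScalars A))
    (f := Φ.hmap (n + 1) f') fun z => ?_).subsingleton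
  rw [← LinearMap.comp_apply, ← Φ.hmap_comp, hcomp, Φ.hmap_id]
  rfl

omit [IsNoetherianRing A] in
theorem mem_gam_quotient (I : Ideal A) {M : Type} [AddCommGroup M] [Module A M] [Module (A ⧸ I) M]
    [IsScalarTower A (A ⧸ I) M] {m : M} :
    m ∈ gam (J.map (Ideal.Quotient.mk I)) M ↔ m ∈ gam J M := by
  have h : ∀ (a : A) (p : M), Ideal.Quotient.mk I a • p = a • p :=
    fun a p => algebraMap_smul (A ⧸ I) a p
  simp only [mem_gam, ← Ideal.map_pow]
  refine exists_congr fun t => ⟨fun H r hr => ?_, fun H r hr => ?_⟩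
  · rw [← h]; exact H _ (Ideal.mem_map_of_mem _ hr)
  · obtain ⟨a, ha, rfl⟩ := (Ideal.mem_map_iff_of_surjective _ Ideal.Quotient.mk_surjective).1 hr
    rw [h]; exact H a ha

omit [IsNoetherianRing A] in
theorem PowRes.exists_bijective_quotient_zero {I : Ideal A} (Φ : PowRes A J)
    (Ψ : PowRes (A ⧸ I) (J.map (Ideal.Quotient.mk I))) (M : Type) [AddCommGroup M] [Module A M]
    [Module (A ⧸ I) M] [IsScalarTower A (A ⧸ I) M] :
    ∃ f : Φ.H M 0 →ₛₗ[Ideal.Quotient.mk I] Ψ.H M 0, Function.Bijective f ∧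
      ∀ z, (Ψ.η M (f z) : M) = Φ.η M z := by
  let f : Φ.H M 0 →ₛₗ[Ideal.Quotient.mk I] Ψ.H M 0 :=
    { toFun := fun z => (Ψ.η M).symm ⟨Φ.η M z, (mem_gam_quotient I).2 (Φ.η M z).2⟩
      map_add' := fun a b => by
        rw [← map_add]
        congr 1
        exact Subtype.ext (by simp)
      map_smul' := fun r a => by
        rw [← map_smul]
        congr 1
        refine Subtype.ext ?_
        rw [map_smul]
        exact (algebraMap_smul (A ⧸ I) r (Φ.η M a : M)).symm }
  have hf : ∀ z, (Ψ.η M (f z) : M) = Φ.η M z := fun z => by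
    simp only [f, LinearMap.coe_mk, AddHom.coe_mk, LinearEquiv.apply_symm_apply]
  refine ⟨f, ⟨fun a b hab => (Φ.η M).injective (Subtype.ext ?_), fun z => ?_⟩, hf⟩
  · rw [← hf, ← hf, hab]
  · refine ⟨(Φ.η M).symm ⟨Ψ.η M z, (mem_gam_quotient I).1 (Ψ.η M z).2⟩,
      (Ψ.η M).injective (Subtype.ext ?_)⟩
    rw [hf, LinearEquiv.apply_symm_apply]

theorem exists_bijective_of_surjective {S T : Type} [CommRing S] [CommRing T] {σ : S →+* T}
    {X Y Z : Type} [AddCommGroup X] [AddCommGroup Y] [AddCommGroup Z] [Module S X] [Module S Y]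
    [Module T Z] (κ : X →ₗ[S] Y) (μ : X →ₛₗ[σ] Z) (hκ : Function.Surjective κ)
    (hμ : Function.Surjective μ) (h : ∀ z, κ z = 0 ↔ μ z = 0) :
    ∃ f : Y →ₛₗ[σ] Z, Function.Bijective f := by
  let e := κ.quotKerEquivOfSurjective hκ
  let g : (X ⧸ LinearMap.ker κ) →ₛₗ[σ] Z := (LinearMap.ker κ).liftQ μ fun z hz => (h z).1 hz
  refine ⟨g.comp e.symm.toLinearMap, ?_⟩
  have hg : Function.Bijective g := by
    refine ⟨(injective_iff_map_eq_zero g).2 fun z hz => ?_, fun z => ?_⟩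
    · obtain ⟨z, rfl⟩ := Submodule.mkQ_surjective _ z
      exact (Submodule.Quotient.mk_eq_zero _).2 ((h z).2 hz)
    · obtain ⟨y, rfl⟩ := hμ z
      exact ⟨Submodule.Quotient.mk y, rfl⟩
  exact hg.comp e.symm.bijective

/-- Independence of the base: local cohomology of a module over `A ⧸ x` may be computed over `A`. -/
theorem PowRes.exists_bijective_quotient (Ψ : PowRes (A ⧸ Ideal.span {x})
      (J.map (Ideal.Quotient.mk (Ideal.span {x})))) (hx : IsSMulRegular A x) (n : ℕ) :
    ∀ (M : Type) [AddCommGroup M] [Module A M] [Module (A ⧸ Ideal.span {x}) M]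
      [IsScalarTower A (A ⧸ Ideal.span {x}) M],
      ∃ f : Φ.H M n →ₛₗ[Ideal.Quotient.mk (Ideal.span {x})] Ψ.H M n, Function.Bijective f := by
  have step : ∀ (n : ℕ) (M Q : Type) [AddCommGroup M] [Module A M]
      [Module (A ⧸ Ideal.span {x}) M] [IsScalarTower A (A ⧸ Ideal.span {x}) M]
      [AddCommGroup Q] [Module A Q]
      [Module (A ⧸ Ideal.span {x}) Q] [IsScalarTower A (A ⧸ Ideal.span {x}) Q]
      [Module.Injective (A ⧸ Ideal.span {x}) Q] (i : M →ₗ[A ⧸ Ideal.span {x}] Q),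
      Function.Injective i →
      ∀ f : Φ.H (Q ⧸ LinearMap.range i) n →ₛₗ[Ideal.Quotient.mk (Ideal.span {x})]
        Ψ.H (Q ⧸ LinearMap.range i) n, Function.Bijective f →
      (∀ z, (∃ y, Φ.hmap n ((LinearMap.range i).mkQ.restrictScalars A) y = z) ↔
        ∃ y, Ψ.hmap n (LinearMap.range i).mkQ y = f z) →
      ∃ f : Φ.H M (n + 1) →ₛₗ[Ideal.Quotient.mk (Ideal.span {x})] Ψ.H M (n + 1),
        Function.Bijective f := by
    intro n M Q _ _ _ _ _ _ _ _ _ i hi f hf hz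
    have hs := Submodule.mkQ_surjective (LinearMap.range i)
    have hex := LinearMap.exact_map_mkQ_range i
    obtain ⟨κ, hκ, hκ'⟩ := Φ.exists_connecting n (f := i.restrictScalars A)
      (g := (LinearMap.range i).mkQ.restrictScalars A) hi hs hex
    obtain ⟨μ, hμ, hμ'⟩ := Ψ.exists_connecting n hi hs hex
    have := Φ.subsingleton_H_of_injective_quotient (Q := Q) hx n
    have := Ψ.subsingleton_H_of_injective Q n
    refine exists_bijective_of_surjective κ (μ.comp f)
      (fun z => (hκ' z).1 (Subsingleton.elim _ _))
      (Function.Surjective.comp (g := μ) (f := f)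
        (fun z => (hμ' z).1 (Subsingleton.elim _ _)) hf.2) fun z => ?_
    exact (hκ z).trans ((hz z).trans (hμ (f z)).symm)
  induction n with
  | zero =>
    intro M _ _ _ _
    obtain ⟨f, hf, -⟩ := Φ.exists_bijective_quotient_zero Ψ M
    exact ⟨f, hf⟩
  | succ n ih =>
    intro M _ _ _ _
    obtain ⟨Q, _, _, i, hQ, hi⟩ := exists_injective_embedding (A ⧸ Ideal.span {x}) M
    let _ : Module A Q := Module.compHom Q (algebraMap A (A ⧸ Ideal.span {x}))
    have : IsScalarTower A (A ⧸ Ideal.span {x}) Q := IsScalarTower.of_compHom A _ Q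
    cases n with
    | zero =>
      obtain ⟨f, hf, hfη⟩ := Φ.exists_bijective_quotient_zero Ψ (Q ⧸ LinearMap.range i)
      obtain ⟨g, hg, hgη⟩ := Φ.exists_bijective_quotient_zero Ψ Q
      refine step 0 M Q i hi f hf fun z => ?_
      have hcomm : ∀ y, f (Φ.hmap 0 ((LinearMap.range i).mkQ.restrictScalars A) y) =
          Ψ.hmap 0 (LinearMap.range i).mkQ (g y) := fun y => by
        refine (Ψ.η _).injective (Subtype.ext ?_)
        rw [hfη, Ψ.η_hmap, hgη, Φ.η_hmap]
        rfl
      constructor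
      · rintro ⟨y, rfl⟩
        exact ⟨g y, (hcomm y).symm⟩
      · rintro ⟨y, hy⟩
        obtain ⟨y, rfl⟩ := hg.2 y
        exact ⟨y, hf.1 ((hcomm y).trans hy)⟩
    | succ n =>
      obtain ⟨f, hf⟩ := ih (Q ⧸ LinearMap.range i)
      have := Φ.subsingleton_H_of_injective_quotient (Q := Q) hx n
      have := Ψ.subsingleton_H_of_injective Q n
      refine step (n + 1) M Q i hi f hf fun z => ?_
      constructor
      · rintro ⟨y, rfl⟩
        rw [Subsingleton.elim y 0, map_zero, map_zero]
        exact ⟨0, map_zero _⟩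
      · rintro ⟨y, hy⟩
        rw [Subsingleton.elim y 0, map_zero] at hy
        exact ⟨0, (map_zero _).trans (hf.1 ((map_zero f).trans hy))⟩

end BaseChange

section LocalDuality

theorem mkQ_smul_eq_zero {A : Type} [CommRing A] {M : Type} [AddCommGroup M] [Module A M]
    (a : A) (w : M) : (a • (⊤ : Submodule A M)).mkQ (a • w) = 0 :=
  (Submodule.Quotient.mk_eq_zero _).2 (Submodule.smul_mem_pointwise_smul w a ⊤ trivial)

variable {A : Type} [CommRing A] [IsNoetherianRing A] [IsLocalRing A]

theorem dimLE_self {d : ℕ} (hd : ringKrullDim A = d) : DimLE A A 0 d := fun p _ => by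
  have := (ch_coe_le_ringKrullDim p).trans hd.le
  exact_mod_cast this

theorem dimLE_self_quotient {e : ℕ} (hd : ringKrullDim A = (e + 1 : ℕ)) {x : A}
    (hx : IsSMulRegular A x) : DimLE A (A ⧸ x • (⊤ : Submodule A A)) 0 e :=
  ((dimLE_self hd).quotient_of_isSMulRegular
    fun _ hp => hx.notMem_of_mem_associatedPrimes hp).mono (by omega)

variable {Φ : PowRes A (maximalIdeal A)} {E : Type} [AddCommGroup E] [Module A E]
  (hE : IsInjHull A (maximalIdeal A) E) {ω : Type} [AddCommGroup ω] [Module A ω]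
  {e : ℕ} (ι : (ω →ₗ[A] E) ≃ₗ[A] Φ.H A e)

include hE ι

omit [IsNoetherianRing A] in
theorem IsInjHull.isSMulRegular_of_equiv {y : A} (hy : ∀ z : Φ.H A e, ∃ w, y • w = z) :
    IsSMulRegular ω y := by
  refine hE.isSMulRegular_of_dual fun φ => ?_
  obtain ⟨w, hw⟩ := hy (ι φ)
  exact ⟨ι.symm w, by rw [← map_smul, hw, ι.symm_apply_apply]⟩

theorem IsInjHull.ch_eq_of_equiv (hd : ringKrullDim A = e) {p : PrimeSpectrum A}
    (hp : p.asIdeal ∈ associatedPrimes A ω) : ch p = e :=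
  le_antisymm (by exact_mod_cast (ch_coe_le_ringKrullDim p).trans hd.le)
    (Φ.le_ch_of_mem_associatedPrimes (dimLE_self hd)
      (fun _ => hE.isSMulRegular_of_equiv ι) hp)

theorem IsInjHull.isSMulRegular_canonical (hd : ringKrullDim A = e) {x : A}
    (hx : IsSMulRegular A x) : IsSMulRegular ω x :=
  hE.isSMulRegular_of_equiv ι <| Φ.exists_smul_eq_H (dimLE_self hd) <|
    (dimLE_self hd).quotient_of_isSMulRegular fun _ hp => hx.notMem_of_mem_associatedPrimes hp

theorem IsInjHull.ch_add_one_eq_of_equiv [IsAdicComplete (maximalIdeal A) A] [Module.Finite A ω]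
    (hd : ringKrullDim A = e) {x : A} (hx : IsSMulRegular A x)
    (hS : Serre A 2 (ω ⧸ x • (⊤ : Submodule A ω))) {p : PrimeSpectrum A}
    (hp : p.asIdeal ∈ associatedPrimes A (ω ⧸ x • (⊤ : Submodule A ω))) : ch p + 1 = e := by
  obtain ⟨hpω, hxp⟩ := mem_support_quotient.1 (mem_support_of_mem_associatedPrimes hp)
  obtain ⟨q, hqp, hq⟩ := exists_mem_associatedPrimes_le hpω
  rw [← hE.ch_eq_of_equiv ι hd hq]
  refine hE.ch_eq hqp
    ((hE.isSMulRegular_canonical ι hd hx).notMem_of_mem_associatedPrimes hq) hxp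
    fun r hqr hxr hrp => ?_
  by_contra hne
  exact hS.not_lt hp (mem_support_quotient.2
    ⟨Module.mem_support_mono hqr (mem_support_of_mem_associatedPrimes hq), hxr⟩)
    (lt_of_le_of_ne hrp hne)

omit ι [IsNoetherianRing A] in
theorem IsInjHull.exists_smul_eq_of_quotient {x y z : A}
    (hz : IsSMulRegular ((ω ⧸ x • (⊤ : Submodule A ω)) ⧸
      y • (⊤ : Submodule A (ω ⧸ x • (⊤ : Submodule A ω)))) z) {φ : ω →ₗ[A] E}
    (hx : x • φ = 0) (hy : y • φ = 0) : ∃ ψ : ω →ₗ[A] E, x • ψ = 0 ∧ y • ψ = 0 ∧ z • ψ = φ := by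
  have hker : ∀ a : A, a • φ = 0 → a • (⊤ : Submodule A ω) ≤ LinearMap.ker φ := by
    rintro a ha _ ⟨w, -, rfl⟩
    exact (map_smul φ a w).trans (LinearMap.congr_fun ha w)
  let φ₁ := (x • (⊤ : Submodule A ω)).liftQ φ (hker x hx)
  let φ₂ := (y • (⊤ : Submodule A (ω ⧸ x • (⊤ : Submodule A ω)))).liftQ φ₁ <| by
    rintro _ ⟨w, -, rfl⟩
    obtain ⟨w, rfl⟩ := Submodule.mkQ_surjective _ w
    exact (map_smul φ₁ y _).trans (LinearMap.congr_fun hy w)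
  obtain ⟨ψ, hψ⟩ := hE.exists_smul_eq hz φ₂
  refine ⟨ψ ∘ₗ Submodule.mkQ _ ∘ₗ Submodule.mkQ _, ?_, ?_, ?_⟩
  · ext w
    change x • ψ (Submodule.mkQ _ (Submodule.mkQ _ w)) = 0
    rw [← map_smul, ← map_smul, ← map_smul, mkQ_smul_eq_zero, map_zero, map_zero]
  · ext w
    change y • ψ (Submodule.mkQ _ (Submodule.mkQ _ w)) = 0
    rw [← map_smul, ← map_smul, mkQ_smul_eq_zero, map_zero]
  · ext w
    exact LinearMap.congr_fun hψ _

end LocalDuality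

section Vanishing

variable {A : Type} [CommRing A] [IsNoetherianRing A] [IsLocalRing A]
  [IsAdicComplete (maximalIdeal A) A]
  {Φ : PowRes A (maximalIdeal A)} {E : Type} [AddCommGroup E] [Module A E]
  (hE : IsInjHull A (maximalIdeal A) E) {ω : Type} [AddCommGroup ω] [Module A ω]
  {e : ℕ} (ι : (ω →ₗ[A] E) ≃ₗ[A] Φ.H A (e + 1)) {x : A}

include hE

variable (Φ) in
theorem IsInjHull.exists_ideal (hS : Serre A 2 A) (hd : ringKrullDim A = (e + 1 : ℕ))
    (hx : IsSMulRegular A x) (hxm : x ∈ maximalIdeal A) :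
    ∃ I : Ideal A, (∀ p : PrimeSpectrum A, I ≤ p.asIdeal → ch p + 2 ≤ e) ∧
      ∀ y ∈ I, ∀ h : Φ.H A e, ∃ h', x • h' = y • h := by
  let K := Φ.H A e →ₗ[A] E
  have hK : Module.Finite A K := hE.finite_dual_H Φ e A
  let T := Submodule.torsionBy A K x
  refine ⟨Module.annihilator A T, fun p hp => ?_, fun y hy h => ?_⟩
  · have hpT : p ∈ Module.support A T := Module.mem_support_iff_of_finite.2 hp
    refine Serre.dimLE_dual_H_quotient hE Φ hS hd hx hxm p (mem_support_quotient.2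
      ⟨Module.support_subset_of_injective T.subtype T.injective_subtype hpT, hp ?_⟩)
    exact Module.mem_annihilator.2 fun t => Subtype.ext t.2
  · by_contra! hne
    have h0 : (x • (⊤ : Submodule A (Φ.H A e))).mkQ (y • h) ≠ 0 := fun h0 => by
      obtain ⟨h', -, hh'⟩ := (Submodule.Quotient.mk_eq_zero _).1 h0
      exact hne h' hh'
    obtain ⟨φ, hφ⟩ := hE.exists_apply_ne_zero h0
    have hT : φ ∘ₗ (x • (⊤ : Submodule A (Φ.H A e))).mkQ ∈ T := by
      refine (Submodule.mem_torsionBy_iff _ _).2 (LinearMap.ext fun w => ?_)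
      change x • φ (Submodule.mkQ _ w) = 0
      rw [← map_smul, ← map_smul, mkQ_smul_eq_zero, map_zero]
    have := LinearMap.congr_fun (congr_arg Subtype.val (Module.mem_annihilator.1 hy ⟨_, hT⟩)) h
    refine hφ ?_
    rw [map_smul, map_smul]
    exact this

include ι

theorem IsInjHull.hmap_mkQ_eq_zero [Module.Finite A ω] (hS : Serre A 2 A)
    (hd : ringKrullDim A = (e + 1 : ℕ)) (hx : IsSMulRegular A x) (hxm : x ∈ maximalIdeal A)
    (hSω : Serre A 2 (ω ⧸ x • (⊤ : Submodule A ω))) (h : Φ.H A e) :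
    Φ.hmap e (x • (⊤ : Submodule A A)).mkQ h = 0 := by
  obtain ⟨I, hI, hIx⟩ := hE.exists_ideal Φ hS hd hx hxm
  have hW := fun (p : PrimeSpectrum A) hp => hE.ch_add_one_eq_of_equiv ι hd hx hSω (p := p) hp
  have hN := fun (p : PrimeSpectrum A) hp =>
    hS.ch_add_one_eq hE (fun q hq => hS.ch_eq_of_mem_associatedPrimes hE hd hq) hx (p := p) hp
  have hdim := dimLE_self_quotient hd hx
  set N := A ⧸ x • (⊤ : Submodule A A)
  set W := ω ⧸ x • (⊤ : Submodule A ω)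
  obtain ⟨y, hyI, hy⟩ := exists_mem_forall_notMem (I := I)
    (s := associatedPrimes A W ∪ associatedPrimes A N)
    ((associatedPrimes.finite A W).union (associatedPrimes.finite A N))
    (by rintro p (hp | hp) <;> exact hp.isPrime) fun p hp hle => by
      have hpr : p.IsPrime := by rcases hp with hp | hp <;> exact hp.isPrime
      have h2 := hI ⟨p, hpr⟩ hle
      have h1 : ch ⟨p, hpr⟩ + 1 = e + 1 := hp.elim (hW ⟨p, hpr⟩) (hN ⟨p, hpr⟩)
      omega
  have hyW : IsSMulRegular W y := isSMulRegular_of_forall_notMem fun p hp => hy p (Or.inl hp)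
  have hyN := hdim.quotient_of_isSMulRegular fun p hp => hy p (Or.inr hp)
  obtain ⟨z, hzI, hz⟩ := exists_mem_forall_notMem (I := I)
    (s := associatedPrimes A (W ⧸ y • (⊤ : Submodule A W)))
    (associatedPrimes.finite A _) (fun p hp => hp.isPrime) fun p hp hle => by
      have h2 := hI ⟨p, hp.isPrime⟩ hle
      have h1 := hSω.ch_add_one_eq hE (c := e)
        (fun q hq => by have := hW q hq; omega) hyW (p := ⟨p, hp.isPrime⟩) hp
      omega
  have hzW := isSMulRegular_of_forall_notMem hz
  obtain ⟨hmk, κ, hκ, hκx⟩ := Φ.exists_connecting_smul e hx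
  have hann : ∀ a ∈ I, ∀ h, a • Φ.hmap e (x • (⊤ : Submodule A A)).mkQ h = 0 := fun a ha h => by
    rw [← map_smul]
    exact (hmk _).2 (hIx a ha h)
  obtain ⟨g, hg⟩ := Φ.exists_smul_eq_H hdim hyN (Φ.hmap e (x • (⊤ : Submodule A A)).mkQ h)
  have hyκ : y • κ g = 0 := by
    rw [← map_smul]
    exact (hκ _).2 ⟨h, hg.symm⟩
  have hxκ : x • κ g = 0 := (hκx _).2 ⟨g, rfl⟩
  obtain ⟨ψ, hψx, hψy, hψz⟩ := hE.exists_smul_eq_of_quotient hzW (φ := ι.symm (κ g))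
    (by rw [← map_smul, hxκ, map_zero]) (by rw [← map_smul, hyκ, map_zero])
  obtain ⟨f, hf⟩ := (hκx (ι ψ)).1 (by rw [← map_smul, hψx, map_zero])
  obtain ⟨h₁, hh₁⟩ := (hκ (y • f)).1 (by rw [map_smul, hf, ← map_smul, hψy, map_zero])
  obtain ⟨h₂, hh₂⟩ := (hκ (g - z • f)).1 (by
    rw [map_sub, map_smul, hf, ← map_smul, hψz, ι.apply_symm_apply, sub_self])
  rw [← hg, show g = (g - z • f) + z • f by abel, ← hh₂, smul_add, hann y hyI, zero_add,
    smul_comm, ← hh₁, hann z hzI]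

end Vanishing

section InjectiveHull

variable {A : Type} [CommRing A]

theorem injective_torsionBy (x : A) (E : Type) [AddCommGroup E] [Module A E]
    [Module.Injective A E] :
    Module.Injective (A ⧸ Ideal.span {x}) (Submodule.torsionBy A E x) := by
  refine ⟨fun X Y _ _ _ _ f hf g => ?_⟩
  let _ : Module A X := Module.compHom X (algebraMap A (A ⧸ Ideal.span {x}))
  have : IsScalarTower A (A ⧸ Ideal.span {x}) X := IsScalarTower.of_compHom A _ X
  let _ : Module A Y := Module.compHom Y (algebraMap A (A ⧸ Ideal.span {x}))
  have : IsScalarTower A (A ⧸ Ideal.span {x}) Y := IsScalarTower.of_compHom A _ Y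
  obtain ⟨h, hh⟩ := Module.Injective.out (f.restrictScalars A) hf
    ((Submodule.torsionBy A E x).subtype ∘ₗ g.restrictScalars A)
  have hx : ∀ y, h y ∈ Submodule.torsionBy A E x := fun y => by
    rw [Submodule.mem_torsionBy_iff, ← map_smul, smul_eq_zero_of_quotient x y, map_zero]
  exact ⟨(h.codRestrict _ hx).extendQuotient (Ideal.span {x}), fun z => Subtype.ext (hh z)⟩

theorem IsInjHull.torsionBy {J : Ideal A} {x : A} (hxJ : x ∈ J) {E : Type} [AddCommGroup E]
    [Module A E] (hE : IsInjHull A J E) :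
    IsInjHull (A ⧸ Ideal.span {x}) (J.map (Ideal.Quotient.mk (Ideal.span {x})))
      (Submodule.torsionBy A E x) := by
  obtain ⟨hinj, f, hf, hess⟩ := hE
  refine ⟨injective_torsionBy x E, ?_⟩
  set e₀ := f (Ideal.Quotient.mk J 1) with he₀
  have hsmul : ∀ a, a • e₀ = f (Ideal.Quotient.mk J a) := fun a => by
    rw [he₀, ← map_smul, ← Ideal.Quotient.mk_eq_mk, ← Ideal.Quotient.mk_eq_mk,
      ← Submodule.Quotient.mk_smul, smul_eq_mul, mul_one]
  have h0 : ∀ a, a • e₀ = 0 ↔ a ∈ J := fun a => by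
    rw [hsmul, map_eq_zero_iff f hf, Ideal.Quotient.eq_zero_iff_mem]
  let e₁ : Submodule.torsionBy A E x := ⟨e₀, (Submodule.mem_torsionBy_iff _ _).2 ((h0 x).2 hxJ)⟩
  have h1 : ∀ a : A, Ideal.Quotient.mk (Ideal.span {x}) a • e₁ = 0 ↔ a ∈ J := fun a => by
    rw [← h0]
    exact Subtype.ext_iff
  have hker : J.map (Ideal.Quotient.mk (Ideal.span {x})) =
      LinearMap.ker (LinearMap.toSpanSingleton (A ⧸ Ideal.span {x}) _ e₁) := by
    refine le_antisymm (Ideal.map_le_iff_le_comap.2 fun a ha => (h1 a).2 ha) fun b hb => ?_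
    obtain ⟨a, rfl⟩ := Ideal.Quotient.mk_surjective b
    exact Ideal.mem_map_of_mem _ ((h1 a).1 hb)
  refine ⟨Submodule.liftQ _ (LinearMap.toSpanSingleton _ _ e₁) hker.le,
    LinearMap.ker_eq_bot.1 (Submodule.ker_liftQ_eq_bot' _ _ hker), fun N hN h => ?_⟩
  let N' : Submodule A E := (N.restrictScalars A).map (Submodule.torsionBy A E x).subtype
  have hN' : N' ≠ ⊥ := fun h => hN ((Submodule.eq_bot_iff _).2 fun n hn =>
    Subtype.ext ((Submodule.eq_bot_iff _).1 h n ⟨n, hn, rfl⟩))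
  obtain ⟨n, hn, hn0⟩ := Submodule.exists_mem_ne_zero_of_ne_bot (hess N' hN')
  obtain ⟨⟨n, hnN, rfl⟩, b, hb⟩ := hn
  obtain ⟨a, rfl⟩ := Ideal.Quotient.mk_surjective b
  refine hn0 (congr_arg Subtype.val ((Submodule.eq_bot_iff _).1 h n ⟨hnN, ?_⟩))
  refine ⟨Ideal.Quotient.mk _ (Ideal.Quotient.mk _ a), Subtype.ext (Eq.trans ?_ hb)⟩
  exact hsmul a

end InjectiveHull

section Quotient

variable {A : Type} [CommRing A]

theorem nonempty_linearEquiv_of_bijective {S T : Type} [CommRing S] [CommRing T] {σ : S →+* T}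
    (hσ : Function.Surjective σ) {X Y Z : Type} [AddCommGroup X] [AddCommGroup Y]
    [AddCommGroup Z] [Module S X] [Module T Y] [Module T Z] (f : X →ₛₗ[σ] Y) (g : X →ₛₗ[σ] Z)
    (hf : Function.Bijective f) (hg : Function.Bijective g) : Nonempty (Y ≃ₗ[T] Z) := by
  let f' := Equiv.ofBijective f hf
  have hf' : ∀ y, f (f'.symm y) = y := f'.apply_symm_apply
  refine ⟨LinearEquiv.ofBijective
    { toFun := fun y => g (f'.symm y)
      map_add' := fun y z => ?_
      map_smul' := fun t y => ?_ } (hg.comp f'.symm.bijective)⟩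
  · exact (congr_arg g (hf.1 (by rw [hf', map_add f, hf', hf']))).trans (map_add g _ _)
  · obtain ⟨s, rfl⟩ := hσ t
    exact (congr_arg g (hf.1 (by rw [hf', map_smulₛₗ f, hf']))).trans (map_smulₛₗ g _ _)

/-- A linear map killed by `x` induces a linear map of `A ⧸ (x)`-modules from the quotient of
the source by `x` to the `x`-torsion of the target. -/
def torsionByHom (x : A) (M E : Type) [AddCommGroup M] [Module A M] [AddCommGroup E]
    [Module A E] :
    Submodule.torsionBy A (M →ₗ[A] E) x →ₛₗ[Ideal.Quotient.mk (Ideal.span {x})]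
      ((M ⧸ x • (⊤ : Submodule A M)) →ₗ[A ⧸ Ideal.span {x}] Submodule.torsionBy A E x) where
  toFun φ := (((x • (⊤ : Submodule A M)).liftQ φ.1 (by
    rintro _ ⟨w, -, rfl⟩
    exact (map_smul φ.1 x w).trans (LinearMap.congr_fun φ.2 w))).codRestrict
      (Submodule.torsionBy A E x) fun w => by
        obtain ⟨w, rfl⟩ := Submodule.mkQ_surjective _ w
        exact LinearMap.congr_fun φ.2 w).extendQuotient (Ideal.span {x})
  map_add' φ ψ := by
    refine LinearMap.ext fun w => ?_
    obtain ⟨w, rfl⟩ := Submodule.mkQ_surjective _ w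
    rfl
  map_smul' a φ := by
    refine LinearMap.ext fun w => ?_
    obtain ⟨w, rfl⟩ := Submodule.mkQ_surjective _ w
    rfl

theorem bijective_torsionByHom (x : A) (M E : Type) [AddCommGroup M] [Module A M]
    [AddCommGroup E] [Module A E] : Function.Bijective (torsionByHom x M E) := by
  refine ⟨(injective_iff_map_eq_zero _).2 fun φ hφ => ?_, fun ψ => ?_⟩
  · refine Subtype.ext (LinearMap.ext fun w => ?_)
    exact congr_arg Subtype.val (LinearMap.congr_fun hφ (Submodule.mkQ _ w))
  · refine ⟨⟨(Submodule.torsionBy A E x).subtype ∘ₗ ψ.restrictScalars A ∘ₗ Submodule.mkQ _, ?_⟩, ?_⟩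
    · refine (Submodule.mem_torsionBy_iff _ _).2 (LinearMap.ext fun w => ?_)
      exact (Submodule.mem_torsionBy_iff _ _).1 (ψ (Submodule.mkQ _ w)).2
    · refine LinearMap.ext fun w => ?_
      obtain ⟨w, rfl⟩ := Submodule.mkQ_surjective _ w
      rfl

/-- The quotient ring by `(x)` as the quotient module by `x`. -/
def quotSpanEquiv (x : A) : (A ⧸ Ideal.span {x}) ≃ₗ[A] A ⧸ x • (⊤ : Submodule A A) :=
  Submodule.quotEquivOfEq _ _ (by
    ext a
    rw [Ideal.mem_span_singleton', Submodule.mem_smul_pointwise_iff_exists]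
    simp [mul_comm])

variable [IsNoetherianRing A]

theorem exists_canonical_quotient {J : Ideal A} {x : A} (hxJ : x ∈ J) (hx : IsSMulRegular A x)
    {Φ : PowRes A J} {E : Type} [AddCommGroup E] [Module A E] (hE : IsInjHull A J E) {ω : Type}
    [AddCommGroup ω] [Module A ω] [Module.Finite A ω] {e : ℕ}
    (ι : (ω →ₗ[A] E) ≃ₗ[A] Φ.H A (e + 1))
    (hzero : ∀ h : Φ.H A e, Φ.hmap e (x • (⊤ : Submodule A A)).mkQ h = 0) :
    IsCanonicalModule (A ⧸ Ideal.span {x}) (J.map (Ideal.Quotient.mk (Ideal.span {x}))) e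
      (ModuleCat.of _ (A ⧸ Ideal.span {x}))
      (ModuleCat.of (A ⧸ Ideal.span {x}) (ω ⧸ x • (⊤ : Submodule A ω))) := by
  have hfin : Module.Finite (A ⧸ Ideal.span {x}) (ω ⧸ x • (⊤ : Submodule A ω)) :=
    Module.Finite.of_restrictScalars_finite A _ _
  refine ⟨hfin, ModuleCat.of _ (Submodule.torsionBy A E x), hE.torsionBy hxJ, ?_⟩
  let Ψ := stdPowRes (J.map (Ideal.Quotient.mk (Ideal.span {x})))
  obtain ⟨f, hf⟩ := Φ.exists_bijective_quotient Ψ hx e (A ⧸ Ideal.span {x})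
  obtain ⟨-, κ, hκ, hκx⟩ := Φ.exists_connecting_smul e hx
  let ε := Φ.hcongr e (quotSpanEquiv x)
  let g : Φ.H (A ⧸ Ideal.span {x}) e →ₗ[A] Submodule.torsionBy A (ω →ₗ[A] E) x :=
    (ι.symm.toLinearMap ∘ₗ κ ∘ₗ ε.toLinearMap).codRestrict _ fun z => by
      refine (Submodule.mem_torsionBy_iff _ _).2 ?_
      refine (map_smul ι.symm x _).symm.trans ?_
      exact (congr_arg ι.symm ((hκx _).2 ⟨_, rfl⟩)).trans (map_zero _)
  have hg : Function.Bijective g := by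
    refine ⟨(injective_iff_map_eq_zero g).2 fun z hz => ?_, fun φ => ?_⟩
    · have h1 : ι.symm (κ (ε z)) = 0 := congr_arg Subtype.val hz
      rw [map_eq_zero_iff _ ι.symm.injective] at h1
      obtain ⟨h, hh⟩ := (hκ _).1 h1
      rw [hzero] at hh
      exact (map_eq_zero_iff _ ε.injective).1 hh.symm
    · have hφ : x • φ.1 = 0 := φ.2
      obtain ⟨z, hz⟩ := (hκx (ι φ.1)).1 (by rw [← map_smul, hφ, map_zero])
      refine ⟨ε.symm z, Subtype.ext ?_⟩
      change ι.symm (κ (ε (ε.symm z))) = φ.1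
      rw [LinearEquiv.apply_symm_apply, hz, ι.symm_apply_apply]
  obtain ⟨u⟩ := nonempty_linearEquiv_of_bijective Ideal.Quotient.mk_surjective
    ((torsionByHom x ω E).comp g) f ((bijective_torsionByHom x ω E).comp hg) hf
  obtain ⟨v⟩ := nonempty_LC_equiv (J.map (Ideal.Quotient.mk (Ideal.span {x})))
    (ModuleCat.of _ (A ⧸ Ideal.span {x})) e
  exact ⟨u.trans v⟩

end Quotient

section Regularity

variable {A : Type} [CommRing A] {X : Type} [AddCommGroup X] [Module A X]

theorem isSMulRegular_quotient_iff {y z : A} :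
    IsSMulRegular (X ⧸ y • (⊤ : Submodule A X)) z ↔
      ∀ m n : X, z • m = y • n → ∃ k, y • k = m := by
  constructor
  · intro h m n hmn
    have h0 : (y • (⊤ : Submodule A X)).mkQ m = 0 :=
      (injective_iff_map_eq_zero (LinearMap.lsmul A (X ⧸ y • (⊤ : Submodule A X)) z)).1 h _ <| by
        rw [LinearMap.lsmul_apply, ← map_smul, hmn, mkQ_smul_eq_zero]
    obtain ⟨k, -, hk⟩ := (Submodule.Quotient.mk_eq_zero _).1 h0
    exact ⟨k, hk⟩
  · intro h
    refine (injective_iff_map_eq_zero (LinearMap.lsmul A (X ⧸ y • (⊤ : Submodule A X)) z)).2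
      fun m hm => ?_
    obtain ⟨m, rfl⟩ := Submodule.mkQ_surjective _ m
    rw [LinearMap.lsmul_apply, ← map_smul] at hm
    obtain ⟨n, -, hn⟩ := (Submodule.Quotient.mk_eq_zero _).1 hm
    obtain ⟨k, rfl⟩ := h m n hn.symm
    exact mkQ_smul_eq_zero y k

theorem IsInjHull.isSMulRegular_quotient_of_dual [IsLocalRing A] {E : Type} [AddCommGroup E]
    [Module A E] (hE : IsInjHull A (maximalIdeal A) E) {y z : A}
    (h : ∀ φ : X →ₗ[A] E, y • φ = 0 → ∃ ψ : X →ₗ[A] E, y • ψ = 0 ∧ z • ψ = φ) :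
    IsSMulRegular (X ⧸ y • (⊤ : Submodule A X)) z := by
  refine hE.isSMulRegular_of_dual fun φ => ?_
  obtain ⟨ψ, hψ, hψz⟩ := h (φ ∘ₗ (y • (⊤ : Submodule A X)).mkQ) <| LinearMap.ext fun w => by
    change y • φ (Submodule.mkQ _ w) = 0
    rw [← map_smul, ← map_smul, mkQ_smul_eq_zero, map_zero]
  refine ⟨(y • (⊤ : Submodule A X)).liftQ ψ ?_, LinearMap.ext fun w => ?_⟩
  · rintro _ ⟨w, -, rfl⟩
    exact (map_smul ψ y w).trans (LinearMap.congr_fun hψ w)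
  · obtain ⟨w, rfl⟩ := Submodule.mkQ_surjective _ w
    exact LinearMap.congr_fun hψz w

end Regularity

section Descent

variable {A : Type} [CommRing A] [IsNoetherianRing A] [IsLocalRing A]

omit [IsNoetherianRing A] in
theorem isLocalRing_quotient_span {x : A} (hxm : x ∈ maximalIdeal A) :
    IsLocalRing (A ⧸ Ideal.span {x}) := by
  have : Nontrivial (A ⧸ Ideal.span {x}) :=
    Ideal.Quotient.nontrivial_iff.2 fun h => hxm (Ideal.span_singleton_eq_top.1 h)
  exact IsLocalRing.of_surjective' _ Ideal.Quotient.mk_surjective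

theorem serre_of_canonical_quotient {e : ℕ} (hd : ringKrullDim A = (e + 1 : ℕ)) {x : A}
    (hxm : x ∈ maximalIdeal A) (hx : IsSMulRegular A x) {ω : Type} [AddCommGroup ω] [Module A ω]
    [Module.Finite A ω]
    (hω : IsCanonicalModule (A ⧸ Ideal.span {x})
      ((maximalIdeal A).map (Ideal.Quotient.mk (Ideal.span {x}))) e
      (ModuleCat.of _ (A ⧸ Ideal.span {x}))
      (ModuleCat.of (A ⧸ Ideal.span {x}) (ω ⧸ x • (⊤ : Submodule A ω)))) :
    Serre A 2 (ω ⧸ x • (⊤ : Submodule A ω)) := by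
  have hloc := isLocalRing_quotient_span hxm
  obtain ⟨-, E, hE, ⟨ι⟩⟩ := hω
  obtain ⟨v⟩ := nonempty_LC_equiv ((maximalIdeal A).map (Ideal.Quotient.mk (Ideal.span {x})))
    (ModuleCat.of _ (A ⧸ Ideal.span {x})) e
  rw [map_maximalIdeal_of_surjective _ Ideal.Quotient.mk_surjective] at hE
  let Φ := stdPowRes (maximalIdeal A)
  obtain ⟨f, hf⟩ := Φ.exists_bijective_quotient
    (stdPowRes ((maximalIdeal A).map (Ideal.Quotient.mk (Ideal.span {x})))) hx e
    (A ⧸ Ideal.span {x})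
  let N := A ⧸ x • (⊤ : Submodule A A)
  let W := ω ⧸ x • (⊤ : Submodule A ω)
  let ε := Φ.hcongr e (quotSpanEquiv x)
  let F : Φ.H N e →ₛₗ[Ideal.Quotient.mk (Ideal.span {x})] (W →ₗ[A ⧸ Ideal.span {x}] E) :=
    ((v.trans ι.symm).toLinearMap.comp f).comp ε.symm.toLinearMap
  have hF : Function.Bijective F :=
    ((v.trans ι.symm).bijective.comp hf).comp ε.symm.bijective
  have hreg : ∀ y : A, (∀ z : Φ.H N e, ∃ w, y • w = z) →
      IsSMulRegular W y := fun y hy => by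
    have h : IsSMulRegular W (Ideal.Quotient.mk (Ideal.span {x}) y) :=
      hE.isSMulRegular_of_dual fun φ => by
        obtain ⟨z, rfl⟩ := hF.2 φ
        obtain ⟨w, rfl⟩ := hy z
        exact ⟨F w, (map_smulₛₗ F y w).symm⟩
    exact h
  have hreg₂ : ∀ y z : A, (∀ u : Φ.H N e, y • u = 0 → ∃ w : Φ.H N e, y • w = 0 ∧ z • w = u) →
      IsSMulRegular (W ⧸ y • (⊤ : Submodule A W)) z := fun y z hyz => by
    have h := isSMulRegular_quotient_iff.1 <| hE.isSMulRegular_quotient_of_dual (X := W)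
      (y := Ideal.Quotient.mk (Ideal.span {x}) y) (z := Ideal.Quotient.mk (Ideal.span {x}) z)
      fun φ hφ => by
        obtain ⟨u, rfl⟩ := hF.2 φ
        obtain ⟨w, hw, rfl⟩ := hyz u (hF.1 (by rw [map_smulₛₗ F, hφ, map_zero]))
        exact ⟨F w, by rw [← map_smulₛₗ F, hw, map_zero], (map_smulₛₗ F z w).symm⟩
    exact isSMulRegular_quotient_iff.2 h
  have hdim : DimLE A N 0 e := dimLE_self_quotient hd hx
  have hch : ∀ q ∈ Module.support A W, ch q ≤ e := fun q hq =>
    hdim q (mem_support_quotient.2 ⟨mem_support_self q, (mem_support_quotient.1 hq).2⟩)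
  refine serre_two_of_forall (fun p q hq hqp => ?_) fun p q q' hq hqq' hqp => ?_
  · have hlt := (ch_lt hqp).trans_le (hch q hq)
    obtain ⟨y, hyp, hy⟩ := hdim.exists_quotient (I := p.asIdeal) fun r _ hr hpr => by
      have := ch_le (p := p) (q := r) hpr
      omega
    exact ⟨y, hyp, hreg y (Φ.exists_smul_eq_H hdim hy)⟩
  · have h1 := ch_lt hqq'
    have h2 := ch_lt hqp
    have h3 := hch q hq
    obtain ⟨y, hyp, hy⟩ := hdim.exists_quotient (I := p.asIdeal) fun r _ hr hpr => by
      have := ch_le (p := p) (q := r) hpr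
      omega
    have hreg₁ := hreg y (Φ.exists_smul_eq_H hdim hy)
    obtain ⟨e, rfl⟩ : ∃ e', e = e' + 1 := ⟨e - 1, by omega⟩
    have hy0 : DimLE A (N ⧸ y • (⊤ : Submodule A N)) 0 e := hy.mono (by omega)
    obtain ⟨z, hzp, hz⟩ := hy0.exists_quotient (I := p.asIdeal) fun r _ hr hpr => by
      have := ch_le (p := p) (q := r) hpr
      omega
    exact ⟨y, hyp, z, hzp, hreg₁, hreg₂ y z fun u hu =>
      Φ.exists_smul_eq_of_smul_eq_zero hy0 hz hu⟩

end Descent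

section Main

theorem IsCanonicalModule.congr {S : Type} [CommRing S] {J : Ideal S} {d : ℕ} {M : ModuleCat.{0} S}
    {ω : ModuleCat S} {ω' : ModuleCat S} (h : IsCanonicalModule S J d M ω) (e : ω ≃ₗ[S] ω') :
    IsCanonicalModule S J d M ω' := by
  obtain ⟨_, E, hE, ⟨ι⟩⟩ := h
  exact ⟨Module.Finite.equiv e, E, hE, ⟨(LinearEquiv.congrLeft E S e).symm.trans ι⟩⟩

theorem exists_isCanonicalModule_iff {A : Type} [CommRing A] {x : A}
    {J : Ideal (A ⧸ Ideal.span {x})} {d : ℕ} {M : ModuleCat.{0} (A ⧸ Ideal.span {x})} {ω : Type}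
    [AddCommGroup ω] [Module A ω] :
    (∃ ω' : ModuleCat (A ⧸ Ideal.span {x}), IsCanonicalModule (A ⧸ Ideal.span {x}) J d M ω' ∧
      Nonempty ((ω ⧸ x • (⊤ : Submodule A ω)) ≃ₗ[A]
        (ModuleCat.restrictScalars (Ideal.Quotient.mk (Ideal.span {x}))).obj ω')) ↔
    IsCanonicalModule (A ⧸ Ideal.span {x}) J d M
      (ModuleCat.of (A ⧸ Ideal.span {x}) (ω ⧸ x • (⊤ : Submodule A ω))) := by
  constructor
  · rintro ⟨ω', h, ⟨e⟩⟩
    refine h.congr (LinearEquiv.symm (M := ω ⧸ x • (⊤ : Submodule A ω)) (M₂ := ω')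
      { toFun := e
        map_add' := e.map_add
        map_smul' := fun r w => ?_
        invFun := e.symm
        left_inv := e.left_inv
        right_inv := e.right_inv })
    obtain ⟨a, rfl⟩ := Ideal.Quotient.mk_surjective r
    exact e.map_smul a w
  · intro h
    exact ⟨ModuleCat.of _ (ULift (ω ⧸ x • (⊤ : Submodule A ω))), h.congr ULift.moduleEquiv.symm,
      ⟨{ toFun := ULift.up
         map_add' := fun _ _ => rfl
         map_smul' := fun _ _ => rfl
         invFun := ULift.down
         left_inv := fun _ => rfl
         right_inv := fun _ => rfl }⟩⟩

theorem isCanonicalModule_of_subsingleton {S : Type} [CommRing S] [Subsingleton S] (J : Ideal S)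
    (d : ℕ) (M ω : ModuleCat.{0} S) : IsCanonicalModule S J d M ω := by
  have h := fun (X : ModuleCat.{0} S) => Module.subsingleton S X
  have := h ω
  have := h (LC S J d M)
  refine ⟨inferInstance, ModuleCat.of S PUnit,
    ⟨⟨fun X Y _ _ _ _ f _ g => ⟨0, fun _ => rfl⟩⟩, 0, Function.injective_of_subsingleton _,
      fun N hN => (hN (Subsingleton.elim _ _)).elim⟩, ⟨0⟩⟩

theorem isCanonicalModule_quotient_iff_serre {A : Type} [CommRing A] [IsNoetherianRing A]
    [IsLocalRing A] [IsAdicComplete (maximalIdeal A) A] {d : ℕ} (hd : ringKrullDim A = d)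
    (hS : Serre A 2 A) {x : A} (hx : IsSMulRegular A x) {ω : ModuleCat.{0} A}
    (hω : IsCanonicalModule A (maximalIdeal A) d (ModuleCat.of A A) ω) :
    IsCanonicalModule (A ⧸ Ideal.span {x})
      ((maximalIdeal A).map (Ideal.Quotient.mk (Ideal.span {x}))) (d - 1)
      (ModuleCat.of _ (A ⧸ Ideal.span {x}))
      (ModuleCat.of (A ⧸ Ideal.span {x}) (ω ⧸ x • (⊤ : Submodule A ω))) ↔
    Serre A 2 (ω ⧸ x • (⊤ : Submodule A ω)) := by
  obtain ⟨_, E, hE, ⟨ι⟩⟩ := hω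
  by_cases hxm : x ∈ maximalIdeal A
  · obtain ⟨q, hq, hqd⟩ := exists_mem_associatedPrimes_ch_eq hd
    have hpos : 0 < ch q := ch_pos fun h => hx.notMem_of_mem_associatedPrimes hq (h hxm)
    obtain ⟨e, rfl⟩ : ∃ e, d = e + 1 := ⟨d - 1, by omega⟩
    refine ⟨serre_of_canonical_quotient hd hxm hx, fun hSω => ?_⟩
    obtain ⟨v⟩ := nonempty_LC_equiv (maximalIdeal A) (ModuleCat.of A A) (e + 1)
    exact exists_canonical_quotient hxm hx hE (ι.trans v.symm)
      (hE.hmap_mkQ_eq_zero (ι.trans v.symm) hS hd hx hxm hSω)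
  · have hu : IsUnit x := by simpa using hxm
    have : Subsingleton (A ⧸ Ideal.span {x}) :=
      Ideal.Quotient.subsingleton_iff.2 (Ideal.span_singleton_eq_top.2 hu)
    have : Subsingleton (ω ⧸ x • (⊤ : Submodule A ω)) :=
      Module.subsingleton (A ⧸ Ideal.span {x}) _
    have h0 : Module.support A (ω ⧸ x • (⊤ : Submodule A ω)) = ∅ :=
      Module.support_eq_empty_iff.2 this
    exact iff_of_true (isCanonicalModule_of_subsingleton _ _ _ _)
      (serre_two_of_forall (by simp [h0]) (by simp [h0]))

end Main

theorem stmt8 (R : Type) [CommRing R] [IsNoetherianRing R] [IsLocalRing R]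
    (d : ℕ) (hd : ringKrullDim (Cmpl R) = (d : WithBot ℕ∞))
    (hS2 : Serre (Cmpl R) 2 (Cmpl R))
    (x : R) (hreg : IsSMulRegular R x)
    (ω : ModuleCat (Cmpl R))
    (hω : IsCanonicalModule (Cmpl R)
      ((maximalIdeal R).map (algebraMap R (Cmpl R))) d
      (ModuleCat.of (Cmpl R) (Cmpl R)) ω) :
    (∃ ω' : ModuleCat ((Cmpl R) ⧸ Ideal.span {algebraMap R (Cmpl R) x}),
        IsCanonicalModule ((Cmpl R) ⧸ Ideal.span {algebraMap R (Cmpl R) x})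
          (((maximalIdeal R).map (algebraMap R (Cmpl R))).map
            (Ideal.Quotient.mk (Ideal.span {algebraMap R (Cmpl R) x})))
          (d - 1)
          (ModuleCat.of ((Cmpl R) ⧸ Ideal.span {algebraMap R (Cmpl R) x})
            ((Cmpl R) ⧸ Ideal.span {algebraMap R (Cmpl R) x})) ω' ∧
        Nonempty ((↥ω ⧸ ((algebraMap R (Cmpl R) x) • (⊤ : Submodule (Cmpl R) ↥ω)))
          ≃ₗ[Cmpl R]
          ↥((ModuleCat.restrictScalars
              (Ideal.Quotient.mk (Ideal.span {algebraMap R (Cmpl R) x}))).obj ω'))) ↔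
      Serre (Cmpl R) 2
        (↥ω ⧸ ((algebraMap R (Cmpl R) x) • (⊤ : Submodule (Cmpl R) ↥ω))) := by
  have : IsNoetherianRing (Cmpl R) := isNoetherianRing_cmpl R
  rw [← AdicCompletion.maximalIdeal_eq_map] at hω ⊢
  exact exists_isCanonicalModule_iff.trans
    (isCanonicalModule_quotient_iff_serre hd hS2 (IsSMulRegular.of_flat hreg) hω)
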